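/- arXiv:1003.2792 — 4 statements merged into one kernel-verified Lean document; each statement's English description precedes it below -/
import Mathlib

section
/- Let q = p^e ≥ 5 be an odd prime power with p prime. Then PGL₂(q) admits an unmixed Beauville structure of type ((p, q−1, q−1), ((q+1)/2, q+1, q+1)); and if moreover q ≥ 7, then PGL₂(q) also admits unmixed Beauville structures of types (((q−1)/2, q−1, q−1), (p, q+1, q+1)) and (((q−1)/2, q−1, q−1), ((q+1)/2, q+1, q+1)). -/
open Matrix

/-- The projective general linear group `PGL₂(F) = GL(2, F) / Z(GL(2, F))`. -/
abbrev PGL2 (F : Type*) [Field F] :=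
  Matrix.GeneralLinearGroup (Fin 2) F ⧸ Subgroup.center (Matrix.GeneralLinearGroup (Fin 2) F)

/-- `Σ(a)`: the union of the conjugacy classes of all powers of `a`. -/
def conjPowers {G : Type*} [Group G] (a : G) : Set G :=
  {x | ∃ (g : G) (j : ℕ), x = g * a ^ j * g⁻¹}

/-- `Σ(a, b, c)`: the union of the conjugacy classes of all powers of `a`, of `b`, and
of `c`. -/
def sigma3 {G : Type*} [Group G] (a b c : G) : Set G :=
  conjPowers a ∪ conjPowers b ∪ conjPowers c

/-- An unmixed Beauville structure for a group `G`: two triples, each with product `1` and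
generating `G`, whose `Σ`-sets intersect trivially. -/
def IsUnmixedBeauville {G : Type*} [Group G] (a₁ b₁ c₁ a₂ b₂ c₂ : G) : Prop :=
  a₁ * b₁ * c₁ = 1 ∧ a₂ * b₂ * c₂ = 1 ∧
  Subgroup.closure ({a₁, b₁} : Set G) = ⊤ ∧ Subgroup.closure ({a₂, b₂} : Set G) = ⊤ ∧
  sigma3 a₁ b₁ c₁ ∩ sigma3 a₂ b₂ c₂ = {1}

/-- `G` admits an unmixed Beauville structure of type `((r₁,s₁,t₁),(r₂,s₂,t₂))`. -/
def HasBeauvilleOfType (G : Type*) [Group G] (r₁ s₁ t₁ r₂ s₂ t₂ : ℕ) : Prop :=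
  ∃ a₁ b₁ c₁ a₂ b₂ c₂ : G, IsUnmixedBeauville a₁ b₁ c₁ a₂ b₂ c₂ ∧
    orderOf a₁ = r₁ ∧ orderOf b₁ = s₁ ∧ orderOf c₁ = t₁ ∧
    orderOf a₂ = r₂ ∧ orderOf b₂ = s₂ ∧ orderOf c₂ = t₂

section Generation

open Polynomial

variable {F : Type*} [Field F]

/-- The invertible matrix with rows `(x, y)` and `(z, w)` lies in `H`. -/
def HasMatrix (H : Subgroup (GL (Fin 2) F)) (x y z w : F) : Prop :=
  ∃ g ∈ H, (g : Matrix (Fin 2) (Fin 2) F) = !![x, y; z, w]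

namespace HasMatrix

variable {H : Subgroup (GL (Fin 2) F)} {x y z w x' y' z' w' : F}

lemma det_ne_zero (h : HasMatrix H x y z w) : x * w - y * z ≠ 0 := by
  obtain ⟨g, -, hg⟩ := h
  have := g.det.ne_zero
  rwa [GeneralLinearGroup.val_det_apply, hg, det_fin_two_of] at this

lemma mul (h : HasMatrix H x y z w) (h' : HasMatrix H x' y' z' w') :
    HasMatrix H (x * x' + y * z') (x * y' + y * w') (z * x' + w * z') (z * y' + w * w') := by
  obtain ⟨g, hg, e⟩ := h
  obtain ⟨g', hg', e'⟩ := h'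
  refine ⟨g * g', H.mul_mem hg hg', ?_⟩
  rw [Units.val_mul, e, e']
  simp

lemma smul (hH : Subgroup.center (GL (Fin 2) F) ≤ H) (h : HasMatrix H x y z w) {c : F}
    (hc : c ≠ 0) : HasMatrix H (c * x) (c * y) (c * z) (c * w) := by
  obtain ⟨g, hg, e⟩ := h
  refine ⟨GeneralLinearGroup.scalar (Fin 2) (Units.mk0 c hc) * g, H.mul_mem (hH ?_) hg, ?_⟩
  · rw [GeneralLinearGroup.center_eq_range_scalar]
    exact ⟨_, rfl⟩
  · rw [Units.val_mul, e]
    ext i j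
    fin_cases i <;> fin_cases j <;> simp

lemma adjugate (hH : Subgroup.center (GL (Fin 2) F) ≤ H) (h : HasMatrix H x y z w) :
    HasMatrix H w (-y) (-z) x := by
  have hd := h.det_ne_zero
  have h' : HasMatrix H ((x * w - y * z)⁻¹ * w) ((x * w - y * z)⁻¹ * -y)
      ((x * w - y * z)⁻¹ * -z) ((x * w - y * z)⁻¹ * x) := by
    obtain ⟨g, hg, e⟩ := h
    refine ⟨g⁻¹, H.inv_mem hg, ?_⟩
    rw [coe_units_inv, inv_def, e, adjugate_fin_two_of, det_fin_two_of]
    simp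
  simpa [hd] using h'.smul hH hd

lemma of_eq (h : HasMatrix H x y z w) (hx : x = x') (hy : y = y') (hz : z = z') (hw : w = w') :
    HasMatrix H x' y' z' w' := by
  subst hx hy hz hw
  exact h

/-- A subgroup of `GL₂` properly containing the upper triangular matrices is everything. -/
theorem eq_top_of_borel (hH : Subgroup.center (GL (Fin 2) F) ≤ H)
    (hU : ∀ t, HasMatrix H 1 t 0 1) (hT : ∀ k ≠ 0, HasMatrix H k 0 0 1)
    (h : HasMatrix H x y z w) (hz : z ≠ 0) : H = ⊤ := by
  have hd := h.det_ne_zero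
  have hJ : ∀ m ≠ 0, ∀ r ≠ 0, HasMatrix H 0 m r 0 := by
    intro m hm r hr
    have hk : -(m * z ^ 2) / (r * (x * w - y * z)) ≠ 0 := by
      refine div_ne_zero (neg_ne_zero.2 ?_) ?_ <;> positivity
    have := (((hT _ hk).mul ((hU (-(x / z))).mul (h.mul (hU (-(w / z)))))).smul hH
      (div_ne_zero hr hz))
    generalize hD : x * w - y * z = D at *
    obtain rfl : y = (x * w - D) / z := by field_simp; linear_combination -hD
    refine this.of_eq ?_ ?_ ?_ ?_ <;> field_simp <;> ring
  rw [eq_top_iff]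
  intro g _
  suffices hg : HasMatrix H (g 0 0) (g 0 1) (g 1 0) (g 1 1) by
    obtain ⟨g', hg', e⟩ := hg
    rw [← eta_fin_two (g : Matrix (Fin 2) (Fin 2) F)] at e
    rwa [← Units.ext e]
  have hg : g 0 0 * g 1 1 - g 0 1 * g 1 0 ≠ 0 := by
    rw [← det_fin_two]
    exact g.det.ne_zero
  generalize g 0 0 = p at *
  generalize g 0 1 = q at *
  generalize g 1 0 = r at *
  generalize g 1 1 = s at *
  by_cases hr : r = 0
  · subst hr
    have hs : s ≠ 0 := by rintro rfl; simp at hg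
    have hp : p ≠ 0 := by rintro rfl; simp at hg
    refine (((hU (q / s)).mul (hT (p / s) (div_ne_zero hp hs))).smul hH hs).of_eq ?_ ?_ ?_ ?_ <;>
      field_simp <;> ring
  · have hm : -(p * s - q * r) / r ≠ 0 := div_ne_zero (neg_ne_zero.2 hg) hr
    refine ((hU (p / r)).mul ((hJ _ hm r hr).mul (hU (s / r)))).of_eq ?_ ?_ ?_ ?_ <;>
      field_simp <;> ring

theorem eq_top_of_diagonal (hH : Subgroup.center (GL (Fin 2) F) ≤ H)
    (hT : ∀ k ≠ 0, HasMatrix H k 0 0 1) {p q s : F} (h' : HasMatrix H p q 0 s) (hq : q ≠ 0)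
    (h : HasMatrix H x y z w) (hz : z ≠ 0) : H = ⊤ := by
  have hps := h'.det_ne_zero
  have hs : s ≠ 0 := by rintro rfl; simp at hps
  have hp : p ≠ 0 := by rintro rfl; simp at hps
  refine eq_top_of_borel hH (fun t ↦ ?_) hT h hz
  by_cases ht : t = 0
  · subst ht
    exact hT 1 one_ne_zero
  · have hk : t * s / q ≠ 0 := by positivity
    refine (((hT _ hk).mul (h'.mul (hT (s / p / (t * s / q)) (by positivity)))).smul hH
      (inv_ne_zero hs)).of_eq ?_ ?_ ?_ ?_ <;> field_simp <;> ring

lemma diagonal (hH : Subgroup.center (GL (Fin 2) F) ≤ H)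
    (hT : ∀ k ≠ 0, HasMatrix H k 0 0 1) {k l : F} (hk : k ≠ 0) (hl : l ≠ 0) :
    HasMatrix H k 0 0 l := by
  refine ((hT (k / l) (div_ne_zero hk hl)).smul hH hl).of_eq ?_ ?_ ?_ ?_ <;> field_simp <;> ring

/-- The diagonal matrices and a unipotent element sharing no fixed point with them generate. -/
theorem eq_top_of_diagonal_of_unipotent (hH : Subgroup.center (GL (Fin 2) F) ≤ H)
    (h2 : (2 : F) ≠ 0) (hT : ∀ k ≠ 0, HasMatrix H k 0 0 1) (h : HasMatrix H x y z w)
    (htr : x + w = 2) (hdet : x * w - y * z = 1) (hyz : y * z ≠ 0) : H = ⊤ := by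
  wlog hx : x ≠ 0 generalizing x y z w
  · push Not at hx
    subst hx
    refine this (h.adjugate hH) (by linear_combination htr) (by linear_combination hdet)
      (by simpa using hyz) ?_
    rw [zero_add] at htr
    rwa [htr]
  have hy : y ≠ 0 := left_ne_zero_of_mul hyz
  have hz : z ≠ 0 := right_ne_zero_of_mul hyz
  obtain rfl : w = 2 - x := by linear_combination htr
  have hm : x - 1 ≠ 0 := fun h ↦ hyz (by linear_combination -hdet - (x - 1) * h)
  have hz' : z = (x * (2 - x) - 1) / y := by field_simp; linear_combination -hdet
  have key := (h.adjugate hH).mul ((diagonal hH hT hx hm).mul (h.mul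
    ((diagonal hH hT hm hx).mul h)))
  refine eq_top_of_diagonal hH hT (key.of_eq rfl rfl ?_ rfl) ?_ h hz
  · rw [hz']
    field_simp
    ring
  · convert hy using 1
    rw [hz']
    field_simp
    ring

/-- The diagonal matrices and an element sharing no fixed point with them generate, unless
that element normalises the diagonal matrices. -/
theorem eq_top_of_diagonal_of_seven_le_card [Fintype F]
    (hH : Subgroup.center (GL (Fin 2) F) ≤ H) (hF : 7 ≤ Fintype.card F)
    (hT : ∀ k ≠ 0, HasMatrix H k 0 0 1) (h : HasMatrix H x y z w)
    (htr : x + w ≠ 0) (hyz : y * z ≠ 0) : H = ⊤ := by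
  wlog hx : x ≠ 0 generalizing x y z w
  · push Not at hx
    subst hx
    exact this (h.adjugate hH) (by simpa using htr) (by simpa using hyz) (by simpa using htr)
  have hd := h.det_ne_zero
  have hy : y ≠ 0 := left_ne_zero_of_mul hyz
  have hz : z ≠ 0 := right_ne_zero_of_mul hyz
  obtain ⟨l, hl⟩ : ∃ l, (X * (C x * X + C w) * (C (y * z) * X + C (w ^ 2)) *
      (C (x ^ 2) * X ^ 2 + C (x * w + y * z) * X + C (w ^ 2))).eval l ≠ 0 := by
    refine exists_eval_ne_zero_of_natDegree_lt_card _ ?_ ?_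
    · refine mul_ne_zero (mul_ne_zero (mul_ne_zero X_ne_zero fun h0 ↦ hx ?_) fun h0 ↦ hyz ?_)
        fun h0 ↦ pow_ne_zero 2 hx ?_
      · simpa using congrArg (coeff · 1) h0
      · simpa only [coeff_add, coeff_C_mul, coeff_X_one, coeff_C_succ, coeff_zero, mul_one,
          add_zero] using congrArg (coeff · 1) h0
      · simpa only [coeff_add, coeff_C_mul, coeff_X_pow_self, coeff_X_of_ne_one (n := 2)
          (by decide), coeff_C_succ, coeff_zero, mul_one, mul_zero, add_zero]
          using congrArg (coeff · 2) h0
    · refine lt_of_le_of_lt (b := ((5 : ℕ) : Cardinal)) ?_ ?_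
      · norm_cast
        compute_degree
      · rw [Cardinal.mk_fintype]
        norm_cast
        lia
  simp only [eval_mul, eval_add, eval_X, eval_C, eval_pow, mul_ne_zero_iff] at hl
  obtain ⟨⟨⟨hl0, hl1⟩, hl2⟩, hl3⟩ := hl
  have key := h.mul ((hT l hl0).mul (h.mul
    ((diagonal hH hT (neg_ne_zero.2 hl2) (mul_ne_zero hx hl1)).mul h)))
  refine eq_top_of_diagonal hH hT (key.of_eq rfl rfl ?_ rfl) ?_ h hz
  · ring
  · have := mul_ne_zero (mul_ne_zero hy hd) hl3
    convert this using 1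
    ring

/-- A subgroup containing the scalars, the matrices `(k u, b u; 0, 1)`, where the pairs `(k u, b u)`
are distinct and each value of `k` is taken at most twice, and a matrix which is not upper
triangular is everything. -/
theorem eq_top_of_image [Fintype F] (hH : Subgroup.center (GL (Fin 2) F) ≤ H) (k b : F → F)
    (hk : ∀ u, k u ≠ 0) (hkb : ∀ u, HasMatrix H (k u) (b u) 0 1)
    (hcard : ∀ c, ∃ f : F[X], f ≠ 0 ∧ f.natDegree ≤ 2 ∧ ∀ u, k u = c → f.eval u = 0)
    (hinj : ∀ u v, k u = k v → b u = b v → u = v)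
    (h : HasMatrix H x y z w) (hz : z ≠ 0) : H = ⊤ := by
  classical
  let D : Subgroup Fˣ :=
    { carrier := {a | ∃ c, HasMatrix H a c 0 1}
      one_mem' := ⟨0, 1, H.one_mem, by rw [Units.val_one, Units.val_one, one_fin_two]⟩
      mul_mem' := by
        rintro a a' ⟨c, hc⟩ ⟨c', hc'⟩
        exact ⟨_, (hc.mul hc').of_eq (by simp) rfl (by simp) (by simp)⟩
      inv_mem' := by
        rintro a ⟨c, hc⟩
        exact ⟨_, ((hc.adjugate hH).smul hH (inv_ne_zero a.ne_zero)).of_eq (by simp) rfl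
          (by simp) (by simp)⟩ }
  let κ : F → Fˣ := fun u ↦ Units.mk0 (k u) (hk u)
  have hD : D = ⊤ := by
    rw [← Subgroup.index_eq_one]
    by_contra hne
    have h0 : D.index ≠ 0 := Subgroup.index_ne_zero_of_finite
    have hmul := D.card_mul_index
    have hcu : Nat.card Fˣ + 1 = Fintype.card F := by
      rw [Nat.card_units, Nat.card_eq_fintype_card]
      have := Fintype.card_pos (α := F)
      lia
    have h1 : Fintype.card F ≤ 2 * (Finset.univ.image κ).card := by
      refine Finset.card_le_mul_card_image _ 2 fun c _ ↦ ?_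
      obtain ⟨f, hf0, hf2, hf⟩ := hcard c
      refine le_trans (Finset.card_le_card (t := f.roots.toFinset) fun u hu ↦ ?_)
        ((Multiset.toFinset_card_le _).trans ((card_roots' f).trans hf2))
      rw [Multiset.mem_toFinset, mem_roots hf0]
      refine hf u ?_
      simpa [κ] using congrArg Units.val (Finset.mem_filter.1 hu).2
    have h2 : (Finset.univ.image κ).card ≤ Nat.card D := by
      rw [← Set.ncard_coe_finset, ← SetLike.coe_sort_coe, Nat.card_coe_set_eq]
      refine Set.ncard_le_ncard (fun a ha ↦ ?_) (Set.toFinite _)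
      obtain ⟨u, -, rfl⟩ := Finset.mem_image.1 (Finset.mem_coe.1 ha)
      exact ⟨b u, hkb u⟩
    have h3 : 2 ≤ D.index := by lia
    have h4 := Nat.mul_le_mul_left (Nat.card D) h3
    clear_value D κ
    lia
  have hD' : ∀ a ≠ 0, ∃ c, HasMatrix H a c 0 1 := fun a ha ↦
    (hD ▸ Subgroup.mem_top _ : Units.mk0 a ha ∈ D)
  obtain ⟨u, v, huv, he⟩ := Fintype.exists_ne_map_eq_of_card_lt κ (by
    rw [Fintype.card_units]
    have := Fintype.card_pos (α := F)
    lia)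
  have he' : k u = k v := by simpa [κ] using congrArg Units.val he
  have hb : b u - b v ≠ 0 := fun h0 ↦ huv (hinj u v he' (sub_eq_zero.1 h0))
  have hbase : HasMatrix H 1 (b u - b v) 0 1 := by
    have := hk v
    refine (((he' ▸ hkb u).mul ((hkb v).adjugate hH)).smul hH (inv_ne_zero (hk v))).of_eq
      ?_ ?_ ?_ ?_ <;> field_simp <;> ring
  have hU : ∀ t, HasMatrix H 1 t 0 1 := by
    intro t
    by_cases ht : t = 0
    · exact ⟨1, H.one_mem, by rw [ht, Units.val_one, one_fin_two]⟩
    · have ha := div_ne_zero ht hb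
      obtain ⟨c, hc⟩ := hD' _ ha
      refine ((hc.mul (hbase.mul (hc.adjugate hH))).smul hH (inv_ne_zero ha)).of_eq
        ?_ ?_ ?_ ?_ <;> field_simp <;> ring
  refine eq_top_of_borel hH hU (fun a ha ↦ ?_) h hz
  obtain ⟨c, hc⟩ := hD' a ha
  exact ((hU (-c)).mul hc).of_eq (by ring) (by ring) (by ring) (by ring)

/-- A nonsplit torus and an element outside its normaliser generate. -/
theorem eq_top_of_nonsplit [Fintype F] (hH : Subgroup.center (GL (Fin 2) F) ≤ H)
    (h2 : (2 : F) ≠ 0) {d : F} (hd : ∀ r, r ^ 2 ≠ d)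
    (hC : ∀ u v, (u ≠ 0 ∨ v ≠ 0) → HasMatrix H u (d * v) v u) (h : HasMatrix H x y z w)
    (hne : ¬ (x * y = d * z * w ∧ y ^ 2 - d * w ^ 2 + d * (x ^ 2 - d * z ^ 2) = 0)) :
    H = ⊤ := by
  have hdet := h.det_ne_zero
  have hnorm : ∀ p r : F, (p ≠ 0 ∨ r ≠ 0) → p ^ 2 - d * r ^ 2 ≠ 0 := by
    intro p r hpr h0
    have hr : r ≠ 0 := by
      rintro rfl
      simp_all
    exact hd (p / r) (by field_simp; linear_combination h0)
  have hQ : ∀ u : F, u ^ 2 - d ≠ 0 := fun u h0 ↦ hd u (sub_eq_zero.1 h0)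
  have hpr : ∀ u, x * u + y ≠ 0 ∨ z * u + w ≠ 0 := by
    intro u
    by_contra! h0
    exact hdet (by linear_combination x * h0.2 - z * h0.1)
  generalize hΔ : x * w - y * z = Δ at hdet
  have hN := fun u ↦ hnorm _ _ (hpr u)
  refine eq_top_of_image hH
    (fun u ↦ ((x * u + y) ^ 2 - d * (z * u + w) ^ 2) / (Δ * (u ^ 2 - d)))
    (fun u ↦ ((x * y - d * z * w) * u ^ 2 +
      (y ^ 2 - d * w ^ 2 + d * (x ^ 2 - d * z ^ 2)) * u + d * (x * y - d * z * w)) /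
      (Δ * (u ^ 2 - d))) (fun u ↦ div_ne_zero (hN u) (mul_ne_zero hdet (hQ u))) (fun u ↦ ?_)
      (fun c ↦ ?_) (fun u v hk hb ↦ ?_) (hC 0 1 (by simp)) one_ne_zero
  · have h1 := hC (x * u + y) (-(z * u + w)) (by simpa only [neg_ne_zero] using hpr u)
    have := hQ u
    refine ((h1.mul (h.mul (hC u 1 (by simp)))).smul hH
      (inv_ne_zero (mul_ne_zero hdet (hQ u)))).of_eq ?_ ?_ ?_ ?_
    · field_simp; ring
    · field_simp; ring
    · field_simp; ring
    · field_simp; rw [← hΔ]; ring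
  · refine ⟨C (x ^ 2 - d * z ^ 2 - c * Δ) * X ^ 2 + C (2 * (x * y - d * z * w)) * X +
      C (y ^ 2 - d * w ^ 2 + d * (c * Δ)), fun h0 ↦ hne ?_, by compute_degree, ?_⟩
    · have e0 := congrArg (coeff · 0) h0
      have e1 := congrArg (coeff · 1) h0
      have e2 := congrArg (coeff · 2) h0
      simp only [coeff_add, coeff_C_mul, coeff_X_pow, coeff_X, coeff_C, coeff_zero] at e0 e1 e2
      norm_num at e0 e1 e2
      refine ⟨sub_eq_zero.1 (e1.resolve_left h2), by linear_combination e0 + d * e2⟩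
    · rintro u rfl
      have := hQ u
      simp only [eval_add, eval_mul, eval_C, eval_pow, eval_X]
      field_simp
      ring
  · by_contra huv
    have huv' := sub_ne_zero.2 huv
    have hu := hQ u
    have hv := hQ v
    apply hne
    generalize hE : x * y - d * z * w = E at *
    generalize hP : y ^ 2 - d * w ^ 2 + d * (x ^ 2 - d * z ^ 2) = P at *
    have hX : (2 * E * u + P) / (u ^ 2 - d) = (2 * E * v + P) / (v ^ 2 - d) := by
      field_simp at hk ⊢
      subst hE hP
      linear_combination hk
    have hY : (P * u + 2 * d * E) / (u ^ 2 - d) = (P * v + 2 * d * E) / (v ^ 2 - d) := by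
      field_simp at hb ⊢
      linear_combination hb
    obtain ⟨a, ha⟩ : ∃ a, (2 * E * u + P) / (u ^ 2 - d) = a := ⟨_, rfl⟩
    obtain ⟨b, hb⟩ : ∃ b, (P * u + 2 * d * E) / (u ^ 2 - d) = b := ⟨_, rfl⟩
    rw [hX] at ha
    rw [hY] at hb
    have e1 : u * a - b = 2 * E := by
      rw [← ha, ← hX, ← hb, ← hY]; field_simp; ring
    have e2 : v * a - b = 2 * E := by
      rw [← ha, ← hb]; field_simp; ring
    have e3 : u * b - d * a = P := by
      rw [← ha, ← hX, ← hb, ← hY]; field_simp; ring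
    have e4 : v * b - d * a = P := by
      rw [← ha, ← hb]; field_simp; ring
    have a0 : a = 0 :=
      (mul_eq_zero.1 (by linear_combination e1 - e2 : (u - v) * a = 0)).resolve_left huv'
    have b0 : b = 0 :=
      (mul_eq_zero.1 (by linear_combination e3 - e4 : (u - v) * b = 0)).resolve_left huv'
    rw [a0, b0] at e1 e3
    have hE0 : E = 0 := by simpa [h2] using e1.symm
    exact ⟨sub_eq_zero.1 (hE.trans hE0), by simpa using e3.symm⟩

end HasMatrix

end Generation

section Projective

variable {F : Type*} [Field F]

lemma PGL2_mk_eq_one_iff {g : GL (Fin 2) F} :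
    (QuotientGroup.mk g : PGL2 F) = 1 ↔ g 0 1 = 0 ∧ g 1 0 = 0 ∧ g 0 0 = g 1 1 := by
  rw [QuotientGroup.eq_one_iff, GeneralLinearGroup.mem_center_iff_val_mem_range_scalar]
  constructor
  · rintro ⟨c, hc⟩
    simp [← hc]
  · rintro ⟨h1, h2, h3⟩
    refine ⟨g 0 0, ?_⟩
    ext i j
    fin_cases i <;> fin_cases j <;> simp [h1, h2, h3]

lemma sq_eq_trace_smul_sub_det_smul (A : Matrix (Fin 2) (Fin 2) F) :
    A * A = A.trace • A - A.det • 1 := by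
  ext i j
  fin_cases i <;> fin_cases j <;> simp [mul_apply, trace_fin_two, det_fin_two] <;> ring

lemma sub_smul_pow_eq {A : Matrix (Fin 2) (Fin 2) F} {α β : F} (htr : A.trace = α + β)
    (hdet : A.det = α * β) (n : ℕ) :
    (α - β) • A ^ n = (α ^ n - β ^ n) • A + (α * β ^ n - β * α ^ n) • 1 := by
  induction n with
  | zero => simp
  | succ n ih =>
    rw [pow_succ, ← smul_mul_assoc, ih, add_mul, smul_mul_assoc, smul_mul_assoc, one_mul,
      sq_eq_trace_smul_sub_det_smul, htr, hdet, smul_sub, smul_smul, smul_smul]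
    module

lemma exists_pow_eq (A : Matrix (Fin 2) (Fin 2) F) (n : ℕ) :
    ∃ k c : F, A ^ n = k • A + c • 1 := by
  induction n with
  | zero => exact ⟨0, 1, by simp⟩
  | succ n ih =>
    obtain ⟨k, c, h⟩ := ih
    refine ⟨k * A.trace + c, -(k * A.det), ?_⟩
    rw [pow_succ, h, add_mul, smul_mul_assoc, sq_eq_trace_smul_sub_det_smul, smul_mul_assoc,
      one_mul]
    module

/-- The order in `PGL₂` of an element with distinct eigenvalues is the order of their ratio. -/
theorem orderOf_PGL2_mk {K : Type*} [Field K] [Algebra F K] (g : GL (Fin 2) F) {α β : K}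
    (hαβ : α ≠ β) (htr : algebraMap F K (g 0 0 + g 1 1) = α + β)
    (hdet : algebraMap F K (g 0 0 * g 1 1 - g 0 1 * g 1 0) = α * β) :
    orderOf (QuotientGroup.mk g : PGL2 F) = orderOf (α / β) := by
  have hβ : β ≠ 0 := by
    rintro rfl
    rw [← det_fin_two, mul_zero, map_eq_zero] at hdet
    exact g.det.ne_zero hdet
  set A : Matrix (Fin 2) (Fin 2) K := (g : Matrix (Fin 2) (Fin 2) F).map (algebraMap F K) with hA
  have hpow (n : ℕ) (i j : Fin 2) : algebraMap F K ((g ^ n : GL (Fin 2) F) i j) = (A ^ n) i j := by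
    rw [hA, ← Matrix.map_pow, Units.val_pow_eq_pow_val, map_apply]
  have hinj := (algebraMap F K).injective
  have htr' : A.trace = α + β := by rw [← htr, trace_fin_two]; simp [hA]
  have hdet' : A.det = α * β := by rw [← hdet, det_fin_two]; simp [hA]
  refine orderOf_eq_orderOf_iff.2 fun n ↦ ?_
  rw [← QuotientGroup.mk_pow, PGL2_mk_eq_one_iff, div_pow, div_eq_one_iff_eq (pow_ne_zero _ hβ),
    ← map_eq_zero (algebraMap F K), ← map_eq_zero (algebraMap F K), ← hinj.eq_iff, hpow, hpow, hpow,
    hpow]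
  have key := sub_smul_pow_eq htr' hdet' n
  have hentry (i j : Fin 2) : (α - β) * (A ^ n) i j =
      (α ^ n - β ^ n) * A i j + (α * β ^ n - β * α ^ n) * (1 : Matrix (Fin 2) (Fin 2) K) i j := by
    simpa only [Matrix.smul_apply, Matrix.add_apply, smul_eq_mul] using
      congrArg (fun M : Matrix (Fin 2) (Fin 2) K ↦ M i j) key
  have h01 := hentry 0 1
  have h10 := hentry 1 0
  have h00 := hentry 0 0
  have h11 := hentry 1 1
  simp only [one_apply_eq, one_apply_ne (n := Fin 2) zero_ne_one,
    one_apply_ne (n := Fin 2) one_ne_zero, mul_zero, add_zero, mul_one] at h01 h10 h00 h11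
  have hne := sub_ne_zero.2 hαβ
  constructor
  · rintro ⟨h1, h2, h3⟩
    by_contra hn
    have hn := sub_ne_zero.2 hn
    have a01 : A 0 1 = 0 := by simpa [h1, hn] using h01
    have a10 : A 1 0 = 0 := by simpa [h2, hn] using h10
    have a00 : A 0 0 = A 1 1 := mul_left_cancel₀ hn (by linear_combination h11 - h00 + (α - β) * h3)
    rw [trace_fin_two, a00] at htr'
    rw [det_fin_two, a01, a00] at hdet'
    exact pow_ne_zero 2 hne
      (by linear_combination 4 * hdet' - (α + β + A 1 1 + A 1 1) * htr')
  · intro hn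
    rw [hn] at h01 h10 h00 h11
    refine ⟨by simpa [hne] using h01, by simpa [hne] using h10,
      mul_left_cancel₀ hne (by linear_combination h00 - h11)⟩

theorem orderOf_PGL2_mk_of_unipotent {p : ℕ} [hp : Fact p.Prime] [CharP F p] (g : GL (Fin 2) F)
    (htr : g 0 0 + g 1 1 = 2) (hdet : g 0 0 * g 1 1 - g 0 1 * g 1 0 = 1)
    (hg : g 0 1 ≠ 0 ∨ g 1 0 ≠ 0) :
    orderOf (QuotientGroup.mk g : PGL2 F) = p := by
  rw [← trace_fin_two] at htr
  rw [← det_fin_two] at hdet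
  have hpow (n : ℕ) : (g : Matrix (Fin 2) (Fin 2) F) ^ n =
      (n : F) • (g : Matrix (Fin 2) (Fin 2) F) + (1 - n : F) • 1 := by
    induction n with
    | zero => simp
    | succ n ih =>
      rw [pow_succ, ih, add_mul, smul_mul_assoc, smul_mul_assoc, one_mul,
        sq_eq_trace_smul_sub_det_smul, htr, hdet]
      push_cast
      module
  refine orderOf_eq_prime ?_ fun h ↦ ?_
  swap
  · have := PGL2_mk_eq_one_iff.1 h
    exact hg.elim (fun h ↦ h this.1) fun h ↦ h this.2.1
  have hgp : g ^ p = 1 := by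
    ext1
    rw [Units.val_pow_eq_pow_val, hpow, CharP.cast_eq_zero]
    simp
  rw [← QuotientGroup.mk_pow, hgp, QuotientGroup.mk_one]

lemma discr_smul_add_smul_one (A : Matrix (Fin 2) (Fin 2) F) (k c : F) :
    (k • A + c • (1 : Matrix (Fin 2) (Fin 2) F)).discr = k ^ 2 * A.discr := by
  simp [discr_fin_two, trace_fin_two, det_fin_two]
  ring

/-- The class of the discriminant modulo nonzero squares is an invariant of the nontrivial
elements of `Σ(g)`. -/
lemma exists_discr_eq_of_mem_conjPowers {g X : GL (Fin 2) F}
    (hX : (QuotientGroup.mk X : PGL2 F) ∈ conjPowers (QuotientGroup.mk g : PGL2 F))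
    (h1 : (QuotientGroup.mk X : PGL2 F) ≠ 1) :
    ∃ k ≠ 0, X.val.discr = k ^ 2 * g.val.discr := by
  obtain ⟨h, j, e⟩ := hX
  induction h using QuotientGroup.induction_on with | H h => ?_
  have e' : (QuotientGroup.mk (h * g ^ j * h⁻¹) : PGL2 F) = QuotientGroup.mk X := e.symm
  rw [QuotientGroup.eq, GeneralLinearGroup.center_eq_range_scalar] at e'
  obtain ⟨u, hu⟩ := e'
  obtain ⟨k, c, hk⟩ := exists_pow_eq (g : Matrix (Fin 2) (Fin 2) F) j
  have hX' : X = h * g ^ j * h⁻¹ * GeneralLinearGroup.scalar (Fin 2) u := by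
    rw [hu, mul_inv_cancel_left]
  have hXval : X.val = h.val * ((u * k : F) • g.val + (u * c : F) • 1) * h⁻¹.val := by
    have hs : (GeneralLinearGroup.scalar (Fin 2) u).val = (u : F) • 1 := by
      ext i j
      fin_cases i <;> fin_cases j <;> simp
    rw [hX', Units.val_mul, Units.val_mul, Units.val_mul, Units.val_pow_eq_pow_val, hk, hs,
      mul_smul_comm, mul_one, ← smul_mul_assoc, ← mul_smul_comm, smul_add, smul_smul, smul_smul]
  refine ⟨u * k, fun h0 ↦ h1 ?_, ?_⟩
  · have : X.val = (u * c : F) • 1 := by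
      rw [hXval, h0, zero_smul, zero_add, mul_smul_comm, mul_one, smul_mul_assoc, ← Units.val_mul,
        mul_inv_cancel, Units.val_one]
    rw [PGL2_mk_eq_one_iff]
    simp [this]
  · rw [hXval, coe_units_inv, discr_conj, discr_smul_add_smul_one]

lemma discr_inv (g : GL (Fin 2) F) : (g⁻¹).val.discr = (g.det.val⁻¹) ^ 2 * g.val.discr := by
  rw [coe_units_inv, inv_def, adjugate_fin_two, Ring.inverse_eq_inv',
    ← GeneralLinearGroup.val_det_apply]
  generalize g.det.val⁻¹ = c
  simp [discr_fin_two, trace_fin_two, det_fin_two]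
  ring

lemma exists_discr_eq_of_mem_sigma3 {a b X : GL (Fin 2) F}
    (hX : (QuotientGroup.mk X : PGL2 F) ∈ sigma3 (QuotientGroup.mk a : PGL2 F)
      (QuotientGroup.mk b) (QuotientGroup.mk (a * b)⁻¹))
    (h1 : (QuotientGroup.mk X : PGL2 F) ≠ 1) :
    ∃ g, (g = a ∨ g = b ∨ g = a * b) ∧ ∃ k ≠ 0, X.val.discr = k ^ 2 * g.val.discr := by
  rcases hX with (hX | hX) | hX
  · exact ⟨a, by simp, exists_discr_eq_of_mem_conjPowers hX h1⟩
  · exact ⟨b, by simp, exists_discr_eq_of_mem_conjPowers hX h1⟩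
  · obtain ⟨k, hk, h⟩ := exists_discr_eq_of_mem_conjPowers hX h1
    refine ⟨a * b, by simp, k * (a * b).det.val⁻¹,
      mul_ne_zero hk (inv_ne_zero (Units.ne_zero _)), ?_⟩
    rw [h, discr_inv]
    ring

lemma one_mem_conjPowers {G : Type*} [Group G] (a : G) : 1 ∈ conjPowers a := ⟨1, 0, by simp⟩

/-- `(a, b, (ab)⁻¹)` generates `PGL₂(F)` and has the orders `r`, `s`, `t`. -/
structure IsTripleLift (a b : GL (Fin 2) F) (r s t : ℕ) : Prop where
  closure_eq_top : ∀ H : Subgroup (GL (Fin 2) F),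
    Subgroup.center (GL (Fin 2) F) ≤ H → a ∈ H → b ∈ H → H = ⊤
  orderOf_left : orderOf (QuotientGroup.mk a : PGL2 F) = r
  orderOf_right : orderOf (QuotientGroup.mk b : PGL2 F) = s
  orderOf_mul : orderOf (QuotientGroup.mk (a * b) : PGL2 F) = t

lemma IsTripleLift.closure_pair {a b : GL (Fin 2) F} {r s t : ℕ} (h : IsTripleLift a b r s t) :
    Subgroup.closure {(QuotientGroup.mk a : PGL2 F), QuotientGroup.mk b} = ⊤ := by
  set S := Subgroup.closure {(QuotientGroup.mk a : PGL2 F), QuotientGroup.mk b} with hS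
  have := h.closure_eq_top (S.comap (QuotientGroup.mk' _))
    (fun g hg ↦ by
      rw [Subgroup.mem_comap, QuotientGroup.mk'_apply, (QuotientGroup.eq_one_iff g).2 hg]
      exact S.one_mem)
    (Subgroup.subset_closure (by simp)) (Subgroup.subset_closure (by simp))
  rw [eq_top_iff]
  intro x _
  induction x using QuotientGroup.induction_on with | H x => ?_
  exact (this ▸ Subgroup.mem_top x : x ∈ S.comap (QuotientGroup.mk' _))

theorem hasBeauvilleOfType_of_lifts {a₁ b₁ a₂ b₂ : GL (Fin 2) F} {r₁ s₁ t₁ r₂ s₂ t₂ : ℕ}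
    (h₁ : IsTripleLift a₁ b₁ r₁ s₁ t₁) (h₂ : IsTripleLift a₂ b₂ r₂ s₂ t₂)
    (hdiscr : ∀ g₁ g₂ : GL (Fin 2) F, (g₁ = a₁ ∨ g₁ = b₁ ∨ g₁ = a₁ * b₁) →
      (g₂ = a₂ ∨ g₂ = b₂ ∨ g₂ = a₂ * b₂) → ∀ k ≠ 0, k ^ 2 * g₁.val.discr ≠ g₂.val.discr) :
    HasBeauvilleOfType (PGL2 F) r₁ s₁ t₁ r₂ s₂ t₂ := by
  refine ⟨QuotientGroup.mk a₁, QuotientGroup.mk b₁, QuotientGroup.mk (a₁ * b₁)⁻¹,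
    QuotientGroup.mk a₂, QuotientGroup.mk b₂, QuotientGroup.mk (a₂ * b₂)⁻¹,
    ⟨?_, ?_, h₁.closure_pair, h₂.closure_pair, ?_⟩, h₁.orderOf_left, h₁.orderOf_right, ?_,
    h₂.orderOf_left, h₂.orderOf_right, ?_⟩
  · rw [← QuotientGroup.mk_mul, ← QuotientGroup.mk_mul, mul_inv_cancel, QuotientGroup.mk_one]
  · rw [← QuotientGroup.mk_mul, ← QuotientGroup.mk_mul, mul_inv_cancel, QuotientGroup.mk_one]
  · refine Set.Subset.antisymm (fun x hx ↦ ?_) ?_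
    · induction x using QuotientGroup.induction_on with | H x => ?_
      by_contra h1
      obtain ⟨g₁, hg₁, k₁, hk₁, e₁⟩ := exists_discr_eq_of_mem_sigma3 hx.1 h1
      obtain ⟨g₂, hg₂, k₂, hk₂, e₂⟩ := exists_discr_eq_of_mem_sigma3 hx.2 h1
      refine hdiscr g₁ g₂ hg₁ hg₂ (k₁ / k₂) (div_ne_zero hk₁ hk₂) ?_
      rw [e₁] at e₂
      field_simp
      exact e₂
    · rintro x rfl
      exact ⟨.inl (.inl (one_mem_conjPowers _)), .inl (.inl (one_mem_conjPowers _))⟩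
  · rw [QuotientGroup.mk_inv, orderOf_inv, h₁.orderOf_mul]
  · rw [QuotientGroup.mk_inv, orderOf_inv, h₂.orderOf_mul]

end Projective

section Split

variable {F : Type*} [Field F]

lemma exists_orderOf_eq_card_sub_one (F : Type*) [Field F] [Fintype F] :
    ∃ ω : F, orderOf ω = Fintype.card F - 1 ∧ ∀ k ≠ 0, ∃ n : ℕ, ω ^ n = k := by
  classical
  obtain ⟨ω, hω⟩ := IsCyclic.exists_monoid_generator (α := Fˣ)
  refine ⟨ω, ?_, fun k hk ↦ ?_⟩
  · rw [orderOf_units, orderOf_eq_card_of_forall_mem_powers hω, Nat.card_units,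
      Nat.card_eq_fintype_card]
  · obtain ⟨n, hn⟩ := hω (Units.mk0 k hk)
    exact ⟨n, by simpa [Units.ext_iff] using hn⟩

lemma pow_ne_one_of_lt_card {F : Type*} [Field F] [Fintype F] {ω : F}
    (hω : orderOf ω = Fintype.card F - 1) {n : ℕ} (hn : n ≠ 0) (hn' : n < Fintype.card F - 1) :
    ω ^ n ≠ 1 :=
  pow_ne_one_of_lt_orderOf hn (hω ▸ hn')

/-- A pair `(a, b)` with `b` a diagonal matrix, `a` of trace `τ` and determinant `1`, and `a * b`
having eigenvalues `-ω` and `-1`. -/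
lemma exists_pair_diagonal {ω : F} (hgen : ∀ k ≠ 0, ∃ n : ℕ, ω ^ n = k) (hω0 : ω ≠ 0)
    (hω1 : ω ≠ 1) (τ : F) :
    ∃ a b : GL (Fin 2) F, a 0 0 + a 1 1 = τ ∧ a 0 0 * a 1 1 - a 0 1 * a 1 0 = 1 ∧ a 1 0 = 1 ∧
      a 0 1 * (ω - 1) ^ 2 = -(2 * (ω ^ 2 + 1) + τ * (1 + ω) ^ 2 + τ ^ 2 * ω) ∧
      orderOf (QuotientGroup.mk b : PGL2 F) = orderOf ω ∧
      orderOf (QuotientGroup.mk (a * b) : PGL2 F) = orderOf ω ∧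
      b.val.discr = (ω - 1) ^ 2 ∧ (a * b).val.discr = (ω - 1) ^ 2 ∧
      ∀ H : Subgroup (GL (Fin 2) F), b ∈ H → ∀ k ≠ 0, HasMatrix H k 0 0 1 := by
  have hne := sub_ne_zero.2 hω1
  obtain ⟨x, hx⟩ : ∃ x, x * (ω - 1) = -(1 + ω + τ) := ⟨_, div_mul_cancel₀ _ hne⟩
  obtain ⟨w, rfl⟩ : ∃ w, x + w = τ := ⟨τ - x, by ring⟩
  obtain ⟨a, ha⟩ : ∃ a : GL (Fin 2) F, (a : Matrix _ _ F) = !![x, x * w - 1; 1, w] :=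
    ⟨GeneralLinearGroup.mkOfDetNeZero !![x, x * w - 1; 1, w] (by simp [det_fin_two]), rfl⟩
  obtain ⟨b, hb⟩ : ∃ b : GL (Fin 2) F, (b : Matrix _ _ F) = !![ω, 0; 0, 1] :=
    ⟨GeneralLinearGroup.mkOfDetNeZero !![ω, 0; 0, 1] (by simpa [det_fin_two]), rfl⟩
  have hab : (a * b).val = !![x * ω, x * w - 1; ω, w] := by
    rw [Units.val_mul, ha, hb]
    simp
  refine ⟨a, b, ?_, ?_, ?_, ?_, ?_, ?_, ?_, ?_, fun H hbH k hk ↦ ?_⟩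
  · simp [ha]
  · simp [ha]
  · simp [ha]
  · simp only [ha, of_apply, cons_val', cons_val_one, cons_val_zero, cons_val_fin_one]
    linear_combination ((x + w) * (ω - 1) - x * (ω - 1) + (1 + ω + (x + w))) * hx
  · rw [orderOf_PGL2_mk (K := F) b hω1 (by simp [hb]) (by simp [hb]), div_one]
  · rw [orderOf_PGL2_mk (K := F) (a * b) (α := -ω) (β := -1) (by simpa), neg_div_neg_eq, div_one]
    · simp only [hab]
      simp
      linear_combination hx
    · simp only [hab]
      simp
      ring
  · simp [hb, discr_fin_two, trace_fin_two, det_fin_two]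
    ring
  · rw [hab]
    simp [discr_fin_two, trace_fin_two, det_fin_two]
    linear_combination (x * ω + w - 1 - ω) * hx
  · obtain ⟨n, rfl⟩ := hgen k hk
    refine ⟨b ^ n, pow_mem hbH n, ?_⟩
    rw [Units.val_pow_eq_pow_val, hb]
    clear hk
    induction n with
    | zero => simp [one_fin_two]
    | succ n ih => rw [pow_succ, ih]; simp [pow_succ]

variable [Fintype F]

theorem exists_isTripleLift_unipotent_split {p : ℕ} [Fact p.Prime] [CharP F p] (h2 : (2 : F) ≠ 0)
    (hF : 5 ≤ Fintype.card F) :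
    ∃ a b : GL (Fin 2) F, IsTripleLift a b p (Fintype.card F - 1) (Fintype.card F - 1) ∧
      a.val.discr = 0 ∧ (∃ s ≠ 0, b.val.discr = s ^ 2) ∧ ∃ s ≠ 0, (a * b).val.discr = s ^ 2 := by
  obtain ⟨ω, hω, hgen⟩ := exists_orderOf_eq_card_sub_one F
  have hω1 : ω ≠ 1 := by simpa using pow_ne_one_of_lt_card hω one_ne_zero (by lia)
  have hω2 : ω ^ 2 ≠ 1 := pow_ne_one_of_lt_card hω two_ne_zero (by lia)
  have hω0 : ω ≠ 0 := by
    rintro rfl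
    simp at hω
    lia
  obtain ⟨a, b, htr, hdet, h10, h01, hb, hab, hdb, hdab, hT⟩ :=
    exists_pair_diagonal hgen hω0 hω1 2
  have hne : ω + 1 ≠ 0 := fun h ↦ hω2 (by linear_combination (ω - 1) * h)
  have hy : a 0 1 ≠ 0 := by
    intro h
    rw [h] at h01
    exact mul_ne_zero (pow_ne_zero 2 h2) (pow_ne_zero 2 hne) (by linear_combination h01)
  refine ⟨a, b, ⟨fun H hH ha hb ↦ ?_, ?_, hω ▸ hb, hω ▸ hab⟩, ?_, ⟨_, sub_ne_zero.2 hω1, hdb⟩,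
    ⟨_, sub_ne_zero.2 hω1, hdab⟩⟩
  · exact HasMatrix.eq_top_of_diagonal_of_unipotent hH h2 (hT H hb) ⟨a, ha, eta_fin_two _⟩ htr hdet
      (by rw [h10]; simpa)
  · exact orderOf_PGL2_mk_of_unipotent a htr hdet (.inl hy)
  · rw [discr_fin_two, trace_fin_two, det_fin_two, htr, hdet]
    ring

theorem exists_isTripleLift_split (h2 : (2 : F) ≠ 0) (hF : 7 ≤ Fintype.card F)
    (hodd : Odd (Fintype.card F)) :
    ∃ a b : GL (Fin 2) F,
      IsTripleLift a b ((Fintype.card F - 1) / 2) (Fintype.card F - 1) (Fintype.card F - 1) ∧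
      (∃ s ≠ 0, a.val.discr = s ^ 2) ∧ (∃ s ≠ 0, b.val.discr = s ^ 2) ∧
      ∃ s ≠ 0, (a * b).val.discr = s ^ 2 := by
  obtain ⟨ω, hω, hgen⟩ := exists_orderOf_eq_card_sub_one F
  have hω1 : ω ≠ 1 := by simpa using pow_ne_one_of_lt_card hω one_ne_zero (by lia)
  have hω2 : ω ^ 2 ≠ 1 := pow_ne_one_of_lt_card hω two_ne_zero (by lia)
  have hω4 : ω ^ 4 ≠ 1 := pow_ne_one_of_lt_card hω four_ne_zero (by lia)
  have hω0 : ω ≠ 0 := by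
    rintro rfl
    simp at hω
    lia
  obtain ⟨a, b, htr, hdet, h10, h01, hb, hab, hdb, hdab, hT⟩ :=
    exists_pair_diagonal hgen hω0 hω1 (ω + ω⁻¹)
  have hinv : ω * ω⁻¹ = 1 := mul_inv_cancel₀ hω0
  have hne : ω + 1 ≠ 0 := fun h ↦ hω2 (by linear_combination (ω - 1) * h)
  have hne' : ω ^ 2 + 1 ≠ 0 := fun h ↦ hω4 (by linear_combination (ω ^ 2 - 1) * h)
  have hτ : ω + ω⁻¹ ≠ 0 := fun h ↦ hne' (by linear_combination ω * h - hinv)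
  have hsub : ω - ω⁻¹ ≠ 0 := fun h ↦ hω2 (by linear_combination ω * h + hinv)
  have hy : a 0 1 ≠ 0 := by
    intro h
    rw [h] at h01
    refine mul_ne_zero (mul_ne_zero h2 hne') (pow_ne_zero 2 hne) ?_
    field_simp at h01
    linear_combination h01
  refine ⟨a, b, ⟨fun H hH ha hb ↦ ?_, ?_, hω ▸ hb, hω ▸ hab⟩, ⟨_, hsub, ?_⟩,
    ⟨_, sub_ne_zero.2 hω1, hdb⟩, ⟨_, sub_ne_zero.2 hω1, hdab⟩⟩
  · exact HasMatrix.eq_top_of_diagonal_of_seven_le_card hH hF (hT H hb) ⟨a, ha, eta_fin_two _⟩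
      (htr ▸ hτ) (by rw [h10]; simpa)
  · rw [orderOf_PGL2_mk (K := F) a (α := ω) (β := ω⁻¹) (sub_ne_zero.1 hsub) (by simpa)
      (by simpa [hinv]), div_inv_eq_mul, ← sq, orderOf_pow_of_dvd two_ne_zero, hω]
    rw [hω]
    obtain ⟨k, hk⟩ := hodd
    exact ⟨k, by lia⟩
  · rw [discr_fin_two, trace_fin_two, det_fin_two, htr, hdet]
    linear_combination 4 * hinv

end Split

section Nonsplit

lemma card_quadraticAlgebra {R : Type*} [Fintype R] (a b : R) :
    Nat.card (QuadraticAlgebra R a b) = Fintype.card R ^ 2 := by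
  rw [Nat.card_congr (QuadraticAlgebra.equivProd a b), Nat.card_prod, Nat.card_eq_fintype_card, sq]

variable {F : Type*} [Field F] [Fintype F] {d : F}

instance (a b : F) : Finite (QuadraticAlgebra F a b) :=
  .of_equiv _ (QuadraticAlgebra.equivProd a b).symm

variable [hd : Fact (∀ r : F, r ^ 2 ≠ d + 0 * r)]

lemma star_eq_pow_card (h2 : (2 : F) ≠ 0) (z : QuadraticAlgebra F d 0) :
    star z = z ^ Fintype.card F := by
  have hd0 : d ≠ 0 := by
    rintro rfl
    exact hd.out 0 (by simp)
  have hchar : ringChar F ≠ 2 := fun h ↦ h2 (by exact_mod_cast h ▸ ringChar.Nat.cast_ringChar)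
  have hω : (⟨0, 1⟩ : QuadraticAlgebra F d 0) ^ Fintype.card F = ⟨0, -1⟩ := by
    have hodd := FiniteField.odd_card_of_char_ne_two hchar
    have hpow : d ^ (Fintype.card F / 2) = -1 := by
      refine (FiniteField.pow_dichotomy hchar hd0).resolve_left fun h ↦ ?_
      obtain ⟨r, hr⟩ := (FiniteField.isSquare_iff hchar hd0).2 h
      exact hd.out r (by rw [hr]; ring)
    have hsq : (⟨0, 1⟩ : QuadraticAlgebra F d 0) ^ 2 = algebraMap F _ d := by
      ext <;> simp [sq]
    rw [← Nat.div_add_mod (Fintype.card F) 2, hodd, pow_add, pow_mul, hsq, ← map_pow, hpow]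
    ext <;> simp
  have hz : z = algebraMap F _ z.re + algebraMap F _ z.im * ⟨0, 1⟩ := by
    ext <;> simp
  have key := map_add (FiniteField.frobeniusAlgHom F (QuadraticAlgebra F d 0))
    (algebraMap F _ z.re) (algebraMap F _ z.im * ⟨0, 1⟩)
  rw [map_mul, AlgHom.commutes, AlgHom.commutes, ← hz, FiniteField.frobeniusAlgHom_apply,
    FiniteField.frobeniusAlgHom_apply, hω] at key
  rw [key]
  ext <;> simp

lemma exists_orderOf_div_star_eq (h2 : (2 : F) ≠ 0) :
    ∃ β : QuadraticAlgebra F d 0, orderOf (β / star β) = Fintype.card F + 1 ∧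
      ∀ z ≠ 0, ∃ n : ℕ, β ^ n = z := by
  obtain ⟨β, hβ⟩ := IsCyclic.exists_monoid_generator (α := (QuadraticAlgebra F d 0)ˣ)
  refine ⟨β, ?_, fun z hz ↦ ?_⟩
  · have h1 : 1 < Fintype.card F := Fintype.one_lt_card
    have hcard : orderOf (β : QuadraticAlgebra F d 0) =
        (Fintype.card F - 1) * (Fintype.card F + 1) := by
      rw [orderOf_units, orderOf_eq_card_of_forall_mem_powers hβ, Nat.card_units,
        card_quadraticAlgebra, mul_comm, ← Nat.sq_sub_sq, one_pow]
    have hdiv : (β : QuadraticAlgebra F d 0) / star (β : QuadraticAlgebra F d 0) =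
        (β ^ (Fintype.card F - 1) : QuadraticAlgebra F d 0)⁻¹ := by
      rw [star_eq_pow_card h2, pow_sub₀ _ β.ne_zero h1.le]
      simp [div_eq_mul_inv]
    have hinv : orderOf (β ^ (Fintype.card F - 1) : QuadraticAlgebra F d 0)⁻¹ =
        orderOf (β ^ (Fintype.card F - 1) : QuadraticAlgebra F d 0) :=
      orderOf_eq_orderOf_iff.2 fun n ↦ by rw [inv_pow, inv_eq_one]
    rw [hdiv, hinv, orderOf_pow_of_dvd (by lia) (hcard ▸ dvd_mul_right _ _), hcard,
      Nat.mul_div_cancel_left _ (by lia)]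
  · obtain ⟨n, hn⟩ := hβ (Units.mk0 z hz)
    exact ⟨n, by simpa [Units.ext_iff] using hn⟩

/-- A pair `(a, b)` with `a` of trace `τ` and determinant `1`, and `b` and `-a * b` both having the
eigenvalues `β` and `star β`. -/
lemma exists_pair_nonsplit (h2 : (2 : F) ≠ 0) {β : QuadraticAlgebra F d 0}
    (hgen : ∀ z ≠ 0, ∃ n : ℕ, β ^ n = z) (hβ : β ≠ star β) {τ ν : F} (hτ : τ ≠ 0)
    (hτν : β.re * τ + β.im * ν = -(2 * β.re)) (hR : d * τ ^ 2 - ν ^ 2 - 4 * d ≠ 0) :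
    ∃ a b : GL (Fin 2) F, a 0 0 + a 1 1 = τ ∧ a 0 0 * a 1 1 - a 0 1 * a 1 0 = 1 ∧
      a 0 1 + d * a 1 0 = ν ∧
      orderOf (QuotientGroup.mk b : PGL2 F) = orderOf (β / star β) ∧
      orderOf (QuotientGroup.mk (a * b) : PGL2 F) = orderOf (β / star β) ∧
      b.val.discr = d * (2 * β.im) ^ 2 ∧ (a * b).val.discr = d * (2 * β.im) ^ 2 ∧
      ∀ H : Subgroup (GL (Fin 2) F), Subgroup.center (GL (Fin 2) F) ≤ H → a ∈ H → b ∈ H →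
        H = ⊤ := by
  have hd' (r : F) : r ^ 2 ≠ d := by simpa using hd.out r
  have hd0 : d ≠ 0 := fun h ↦ hd' 0 (by simp [h])
  have h4d : 4 * d ≠ 0 := mul_ne_zero (by convert pow_ne_zero 2 h2 using 1; norm_num) hd0
  have hδ : β.re * β.re - d * β.im * β.im ≠ 0 := by
    intro h
    have : β * star β = 0 := by
      ext
      · simp
        linear_combination h
      · simp
        ring
    rcases mul_eq_zero.1 this with h | h
    · simp [h] at hβ
    · rw [star_eq_zero] at h
      simp [h] at hβ
  obtain ⟨m, n, hmn⟩ : ∃ m n, d * m ^ 2 - n ^ 2 = d * τ ^ 2 - ν ^ 2 - 4 * d := by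
    have hchar : ringChar F ≠ 2 := fun h ↦ h2 (by exact_mod_cast h ▸ ringChar.Nat.cast_ringChar)
    obtain ⟨m, n, h⟩ := FiniteField.exists_root_sum_quadratic
      (f := .C d * .X ^ 2 + .C 0 * .X + .C 0)
      (g := .C (-1) * .X ^ 2 + .C 0 * .X + .C (-(d * τ ^ 2 - ν ^ 2 - 4 * d)))
      (Polynomial.degree_quadratic hd0) (Polynomial.degree_quadratic (by simp))
      (FiniteField.odd_card_of_char_ne_two hchar)
    simp at h
    exact ⟨m, n, by linear_combination h⟩
  obtain ⟨x, hx⟩ : ∃ x, x * 2 = τ + m := ⟨_, div_mul_cancel₀ _ h2⟩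
  obtain ⟨w, rfl⟩ : ∃ w, x + w = τ := ⟨τ - x, by ring⟩
  obtain ⟨z, hz⟩ : ∃ z, z * (2 * d) = ν - n := ⟨_, div_mul_cancel₀ _ (mul_ne_zero h2 hd0)⟩
  obtain ⟨y, rfl⟩ : ∃ y, y + d * z = ν := ⟨ν - d * z, by ring⟩
  obtain rfl : m = x - w := by linear_combination -hx
  obtain rfl : n = y - d * z := by linear_combination hz
  have hdet : x * w - y * z = 1 := mul_left_cancel₀ h4d (by linear_combination -hmn)
  obtain ⟨a, ha⟩ : ∃ a : GL (Fin 2) F, (a : Matrix _ _ F) = !![x, y; z, w] :=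
    ⟨GeneralLinearGroup.mkOfDetNeZero !![x, y; z, w] (by simp [det_fin_two, hdet]), rfl⟩
  obtain ⟨b, hb⟩ : ∃ b : GL (Fin 2) F, (b : Matrix _ _ F) = !![β.re, d * β.im; β.im, β.re] :=
    ⟨GeneralLinearGroup.mkOfDetNeZero !![β.re, d * β.im; β.im, β.re] (by simpa [det_fin_two]), rfl⟩
  have hab : (a * b).val = !![x * β.re + y * β.im, x * (d * β.im) + y * β.re;
      z * β.re + w * β.im, z * (d * β.im) + w * β.re] := by
    rw [Units.val_mul, ha, hb]
    simp
  refine ⟨a, b, ?_, ?_, ?_, ?_, ?_, ?_, ?_, fun H hH haH hbH ↦ ?_⟩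
  · simp [ha]
  · simpa [ha] using hdet
  · simp [ha]
  · refine orderOf_PGL2_mk b hβ ?_ ?_
    · ext <;> simp [hb]
    · ext
      · simp [hb]
        ring
      · simp [hb]
        ring
  · rw [orderOf_PGL2_mk (a * b) (α := -β) (β := -star β) (by simpa), neg_div_neg_eq]
    · ext
      · simp [hab]
        linear_combination hτν
      · simp [hab]
    · ext
      · simp [hab]
        linear_combination (β.re * β.re - d * β.im * β.im) * hdet
      · simp [hab]
        ring
  · simp [hb, discr_fin_two, trace_fin_two, det_fin_two]
    ring
  · rw [hab]
    simp [discr_fin_two, trace_fin_two, det_fin_two]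
    linear_combination (β.re * (x + w) + β.im * (y + d * z) - 2 * β.re) * hτν -
      4 * (β.re * β.re - d * β.im * β.im) * hdet
  · refine HasMatrix.eq_top_of_nonsplit hH h2 hd' (fun u v huv ↦ ?_) ⟨a, haH, ha⟩ ?_
    · obtain ⟨n, hn⟩ := hgen ⟨u, v⟩ (by
        intro h
        exact huv.elim (fun hu ↦ hu (congrArg QuadraticAlgebra.re h))
          fun hv ↦ hv (congrArg QuadraticAlgebra.im h))
      refine ⟨b ^ n, pow_mem hbH n, ?_⟩
      have hpow (n : ℕ) : (b ^ n).val =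
          !![(β ^ n).re, d * (β ^ n).im; (β ^ n).im, (β ^ n).re] := by
        induction n with
        | zero =>
          rw [pow_zero, pow_zero, Units.val_one, one_fin_two, QuadraticAlgebra.re_one,
            QuadraticAlgebra.im_one, mul_zero]
        | succ n ih =>
          rw [pow_succ, Units.val_mul, ih, hb, pow_succ]
          ext i j
          fin_cases i <;> fin_cases j <;> simp <;> ring
      rw [hpow, hn]
    · rintro ⟨h₁, h₂⟩
      have hm : x - w = 0 := by
        by_contra hm
        refine hd' ((y + d * z) / (x + w)) ?_
        rw [div_pow, div_eq_iff (pow_ne_zero 2 hτ)]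
        refine mul_left_cancel₀ hm ?_
        linear_combination 2 * (y + d * z) * h₁ - (x + w) * h₂
      have hn : y - d * z = 0 := by
        refine (mul_eq_zero.1 (?_ : (x + w) * (y - d * z) = 0)).resolve_left hτ
        linear_combination 2 * h₁ - (y + d * z) * hm
      exact hR (by rw [← hmn, hm, hn]; ring)

lemma ne_of_orderOf_div_star (hF : 5 ≤ Fintype.card F) {β : QuadraticAlgebra F d 0}
    (hβ : orderOf (β / star β) = Fintype.card F + 1) :
    β ≠ star β ∧ β.re ≠ 0 ∧ β.im ≠ 0 ∧ β.re ^ 2 - d * β.im ^ 2 ≠ 0 ∧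
      β.re ^ 2 + d * β.im ^ 2 ≠ 0 := by
  have hβ0 : β ≠ 0 := by
    rintro rfl
    simp at hβ
  have hpow {n : ℕ} (hn : n ≠ 0) (hn' : n < 6) : β ^ n ≠ star β ^ n := by
    refine fun h ↦ pow_ne_one_of_lt_orderOf (x := β / star β) hn (by lia) ?_
    rw [div_pow, div_eq_one_iff_eq (pow_ne_zero _ (by simpa)), h]
  have hne : β ≠ star β := by simpa using hpow one_ne_zero (by simp)
  refine ⟨hne, fun h ↦ hpow two_ne_zero (by simp) ?_, fun h ↦ hne ?_,
    fun h ↦ mul_ne_zero hβ0 (by simpa : star β ≠ 0) ?_, fun h ↦ hpow four_ne_zero (by simp) ?_⟩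
  · ext <;> simp [sq, h]
  · ext <;> simp [h]
  · ext
    · simp
      linear_combination h
    · simp
      ring
  · have : β ^ 2 = -star β ^ 2 := by
      ext
      · simp [sq]
        linear_combination 2 * h
      · simp [sq]
        ring
    rw [show 4 = 2 * 2 from rfl, pow_mul, pow_mul, this, neg_sq]

end Nonsplit

section Triples

variable {F : Type*} [Field F] [Fintype F] {d : F}

theorem exists_isTripleLift_unipotent_nonsplit {p : ℕ} [Fact p.Prime] [CharP F p]
    (h2 : (2 : F) ≠ 0) (hF : 5 ≤ Fintype.card F) (hd : ∀ r, r ^ 2 ≠ d) :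
    ∃ a b : GL (Fin 2) F, IsTripleLift a b p (Fintype.card F + 1) (Fintype.card F + 1) ∧
      a.val.discr = 0 ∧ (∃ s ≠ 0, b.val.discr = d * s ^ 2) ∧
      ∃ s ≠ 0, (a * b).val.discr = d * s ^ 2 := by
  have : Fact (∀ r : F, r ^ 2 ≠ d + 0 * r) := ⟨by simpa using hd⟩
  obtain ⟨β, hβ, hgen⟩ := exists_orderOf_div_star_eq (d := d) h2
  obtain ⟨hne, hre, him, -, -⟩ := ne_of_orderOf_div_star hF hβ
  have h4 : (4 : F) ≠ 0 := by convert pow_ne_zero 2 h2 using 1; norm_num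
  have hν : -(4 * β.re / β.im) ≠ 0 := neg_ne_zero.2 (div_ne_zero (mul_ne_zero h4 hre) him)
  obtain ⟨a, b, htr, hdet, hν', hb, hab, hdb, hdab, hgenerate⟩ :=
    exists_pair_nonsplit (τ := 2) (ν := -(4 * β.re / β.im)) h2 hgen hne h2 (by field_simp; ring)
      (fun h ↦ pow_ne_zero 2 hν (by linear_combination -h))
  refine ⟨a, b, ⟨hgenerate, orderOf_PGL2_mk_of_unipotent a htr hdet ?_, hβ ▸ hb, hβ ▸ hab⟩, ?_,
    ⟨_, mul_ne_zero h2 him, hdb⟩, ⟨_, mul_ne_zero h2 him, hdab⟩⟩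
  · by_contra! h
    exact hν (by rw [← hν', h.1, h.2]; ring)
  · rw [discr_fin_two, trace_fin_two, det_fin_two, htr, hdet]
    ring

theorem exists_isTripleLift_nonsplit (h2 : (2 : F) ≠ 0) (hF : 5 ≤ Fintype.card F)
    (hodd : Odd (Fintype.card F)) (hd : ∀ r, r ^ 2 ≠ d) :
    ∃ a b : GL (Fin 2) F,
      IsTripleLift a b ((Fintype.card F + 1) / 2) (Fintype.card F + 1) (Fintype.card F + 1) ∧
      (∃ s ≠ 0, a.val.discr = d * s ^ 2) ∧ (∃ s ≠ 0, b.val.discr = d * s ^ 2) ∧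
      ∃ s ≠ 0, (a * b).val.discr = d * s ^ 2 := by
  have : Fact (∀ r : F, r ^ 2 ≠ d + 0 * r) := ⟨by simpa using hd⟩
  obtain ⟨β, hβ, hgen⟩ := exists_orderOf_div_star_eq (d := d) h2
  obtain ⟨hne, hre, him, hδ, hδ'⟩ := ne_of_orderOf_div_star hF hβ
  have h4 : (4 : F) ≠ 0 := by convert pow_ne_zero 2 h2 using 1; norm_num
  have hβ0 : β ≠ 0 := by
    rintro rfl
    simp at hne
  have hβ0' : star β ≠ 0 := by simpa
  obtain ⟨τ, hτ⟩ : ∃ τ, τ * (β.re ^ 2 - d * β.im ^ 2) = 2 * (β.re ^ 2 + d * β.im ^ 2) :=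
    ⟨_, div_mul_cancel₀ _ hδ⟩
  obtain ⟨ν, hν⟩ : ∃ ν, ν * (β.im * (β.re ^ 2 - d * β.im ^ 2)) = -(4 * β.re ^ 3) :=
    ⟨_, div_mul_cancel₀ _ (mul_ne_zero him hδ)⟩
  have hR : d * τ ^ 2 - ν ^ 2 - 4 * d ≠ 0 := by
    intro h
    refine mul_ne_zero (mul_ne_zero (pow_ne_zero 2 (mul_ne_zero h4 hre)) hδ) hδ' ?_
    linear_combination -(β.im * (β.re ^ 2 - d * β.im ^ 2)) ^ 2 * h +
      d * β.im ^ 2 * (τ * (β.re ^ 2 - d * β.im ^ 2) + 2 * (β.re ^ 2 + d * β.im ^ 2)) * hτ -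
      (ν * (β.im * (β.re ^ 2 - d * β.im ^ 2)) - 4 * β.re ^ 3) * hν
  obtain ⟨a, b, htr, hdet, -, hb, hab, hdb, hdab, hgenerate⟩ :=
    exists_pair_nonsplit h2 hgen hne (τ := τ) (ν := ν)
      (by rintro rfl; exact mul_ne_zero h2 hδ' (by linear_combination -hτ))
      (mul_right_cancel₀ hδ (by linear_combination β.re * hτ + hν)) hR
  refine ⟨a, b, ⟨hgenerate, ?_, hβ ▸ hb, hβ ▸ hab⟩,
    ⟨4 * β.re * β.im / (β.re ^ 2 - d * β.im ^ 2), by positivity, ?_⟩,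
    ⟨_, mul_ne_zero h2 him, hdb⟩, ⟨_, mul_ne_zero h2 him, hdab⟩⟩
  · have hinv : (β / star β) * (star β / β) = 1 := by field_simp
    rw [orderOf_PGL2_mk a (α := β / star β) (β := star β / β), ← inv_div β (star β),
      div_inv_eq_mul, ← sq, orderOf_pow_of_dvd two_ne_zero, hβ]
    · rw [hβ]
      obtain ⟨k, hk⟩ := hodd
      exact ⟨k + 1, by lia⟩
    · intro h
      rw [← h, ← sq] at hinv
      exact pow_ne_one_of_lt_orderOf two_ne_zero (by lia) hinv
    · rw [htr]
      field_simp
      ext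
      · simp [sq]
        linear_combination hτ
      · simp [sq]
        ring
    · rw [hdet, hinv, map_one]
  · rw [discr_fin_two, trace_fin_two, det_fin_two, htr, hdet]
    field_simp
    linear_combination (τ * (β.re ^ 2 - d * β.im ^ 2) + 2 * (β.re ^ 2 + d * β.im ^ 2)) * hτ

end Triples

lemma sq_mul_sq_ne_mul_sq {F : Type*} [Field F] {d k s t : F} (hd : ∀ r, r ^ 2 ≠ d) (ht : t ≠ 0) :
    k ^ 2 * s ^ 2 ≠ d * t ^ 2 := fun h ↦
  hd (k * s / t) (by rw [div_pow, mul_pow, h, mul_div_cancel_right₀ _ (pow_ne_zero 2 ht)])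

/-- Let `q = p ^ e ≥ 5` be an odd prime power.  Then `PGL₂(q)` admits an
unmixed Beauville structure of type `((p, q-1, q-1), ((q+1)/2, q+1, q+1))`; and if `q ≥ 7`
it also admits unmixed Beauville structures of types
`(((q-1)/2, q-1, q-1), (p, q+1, q+1))` and `(((q-1)/2, q-1, q-1), ((q+1)/2, q+1, q+1))`. -/
theorem beauville_types_PGL2 (p e : ℕ) (hp : p.Prime) (hodd : Odd p) (he : 0 < e)
    (hq : 5 ≤ p ^ e)
    (F : Type*) [Field F] [Fintype F] (hF : Fintype.card F = p ^ e) :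
    HasBeauvilleOfType (PGL2 F) p (p ^ e - 1) (p ^ e - 1)
      ((p ^ e + 1) / 2) (p ^ e + 1) (p ^ e + 1) ∧
    (7 ≤ p ^ e →
      HasBeauvilleOfType (PGL2 F) ((p ^ e - 1) / 2) (p ^ e - 1) (p ^ e - 1)
        p (p ^ e + 1) (p ^ e + 1) ∧
      HasBeauvilleOfType (PGL2 F) ((p ^ e - 1) / 2) (p ^ e - 1) (p ^ e - 1)
        ((p ^ e + 1) / 2) (p ^ e + 1) (p ^ e + 1)) := by
  have : Fact p.Prime := ⟨hp⟩
  have hcard_odd : Odd (Fintype.card F) := hF ▸ hodd.pow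
  have hcharP : CharP F p := by
    obtain ⟨r, _⟩ := CharP.exists F
    have hr : r.Prime := CharP.char_is_prime F r
    obtain ⟨n, -, hn⟩ := FiniteField.card F r
    rwa [(Nat.prime_dvd_prime_iff_eq hp hr).1 (hp.dvd_of_dvd_pow
      (hn ▸ hF ▸ dvd_pow_self p he.ne' : p ∣ r ^ (n : ℕ)))]
  have hchar : ringChar F ≠ 2 := by
    rw [ringChar.eq F p]
    rintro rfl
    exact absurd hodd (by decide)
  have h2 : (2 : F) ≠ 0 := Ring.two_ne_zero hchar
  obtain ⟨d, hd⟩ := FiniteField.exists_nonsquare hchar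
  replace hd : ∀ r, r ^ 2 ≠ d := fun r hr ↦ hd ⟨r, by rw [← hr, sq]⟩
  have hd0 : d ≠ 0 := fun h ↦ hd 0 (by simp [h])
  rw [← hF] at hq ⊢
  obtain ⟨a₄, b₄, h₄, ⟨s₄, hs₄, ha₄⟩, ⟨t₄, ht₄, hb₄⟩, u₄, hu₄, hab₄⟩ :=
    exists_isTripleLift_nonsplit h2 hq hcard_odd hd
  refine ⟨?_, fun h7 ↦ ?_⟩
  · obtain ⟨a₁, b₁, h₁, ha₁, ⟨t₁, ht₁, hb₁⟩, u₁, hu₁, hab₁⟩ :=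
      exists_isTripleLift_unipotent_split (p := p) h2 hq
    refine hasBeauvilleOfType_of_lifts h₁ h₄ ?_
    rintro _ _ (rfl | rfl | rfl) (rfl | rfl | rfl) k hk <;>
      simp only [ha₁, hb₁, hab₁, ha₄, hb₄, hab₄] <;>
      first
      | exact sq_mul_sq_ne_mul_sq hd ‹_›
      | simp [*]
  · obtain ⟨a₂, b₂, h₂, ⟨s₂, hs₂, ha₂⟩, ⟨t₂, ht₂, hb₂⟩, u₂, hu₂, hab₂⟩ :=
      exists_isTripleLift_split h2 h7 hcard_odd
    obtain ⟨a₃, b₃, h₃, ha₃, ⟨t₃, ht₃, hb₃⟩, u₃, hu₃, hab₃⟩ :=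
      exists_isTripleLift_unipotent_nonsplit (p := p) h2 hq hd
    refine ⟨hasBeauvilleOfType_of_lifts h₂ h₃ ?_, hasBeauvilleOfType_of_lifts h₂ h₄ ?_⟩
    · rintro _ _ (rfl | rfl | rfl) (rfl | rfl | rfl) k hk <;>
        simp only [ha₂, hb₂, hab₂, ha₃, hb₃, hab₃] <;>
        first
        | exact sq_mul_sq_ne_mul_sq hd ‹_›
        | simp [*]
    · rintro _ _ (rfl | rfl | rfl) (rfl | rfl | rfl) k hk <;>
        simp only [ha₂, hb₂, hab₂, ha₄, hb₄, hab₄] <;>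
        exact sq_mul_sq_ne_mul_sq hd ‹_›
end

section
/- Let p be an odd prime, q = p^e, and let A ∈ PSL₂(q) be an element of order p. If e is odd, then there exists an integer i with 0 < i < p such that A^i is conjugate in PSL₂(q) to the image of the matrix [[1,1],[0,1]]. If e is even, then for every integer i with 0 < i < p, the element A^i is conjugate in PSL₂(q) to A. -/
open Matrix

/-- The projective special linear group `PSL₂(F) = SL(2, F) / Z(SL(2, F))`. -/
abbrev PSL2 (F : Type*) [Field F] :=
  Matrix.SpecialLinearGroup (Fin 2) F ⧸ Subgroup.center (Matrix.SpecialLinearGroup (Fin 2) F)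

/-- A power `p ^ e` of an odd number `p = 2 m + 1` is `2 m S + 1`, where `S` has the parity
of `e`. -/
theorem exists_pow_eq_two_mul_mul_add_one (m e : ℕ) :
    ∃ S : ℕ, (2 * m + 1) ^ e = 2 * (m * S) + 1 ∧ (Even S ↔ Even e) := by
  induction e with
  | zero => exact ⟨0, by simp, by simp⟩
  | succ e ih =>
    obtain ⟨S, hS, hpar⟩ := ih
    refine ⟨(2 * m + 1) * S + 1, by rw [pow_succ, hS]; ring, ?_⟩
    rw [Nat.even_add_one, Nat.even_add_one, Nat.even_mul, hpar]
    simp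

/-- In a finite field of order `p ^ e` with `e` even, nonzero elements of the prime field are
squares. -/
theorem isSquare_natCast_of_even {F : Type*} [Field F] [Fintype F] {p e : ℕ} [Fact p.Prime]
    [CharP F p] (hodd : Odd p) (hF : Fintype.card F = p ^ e) (he : Even e) {i : ℕ}
    (hi : (i : F) ≠ 0) : IsSquare (i : F) := by
  obtain ⟨m, rfl⟩ := hodd
  obtain ⟨S, hS, hpar⟩ := exists_pow_eq_two_mul_mul_add_one m e
  obtain ⟨k, rfl⟩ := hpar.2 he
  have h2 : ringChar F ≠ 2 := by rw [ringChar.eq F (2 * m + 1)]; omega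
  rw [FiniteField.isSquare_iff h2 hi, hF, hS]
  have h1 : (i : ZMod (2 * m + 1)) ^ (2 * m) = 1 := by
    refine ZMod.pow_card_sub_one_eq_one fun h => hi ?_
    rw [ZMod.natCast_eq_zero_iff] at h
    exact (CharP.cast_eq_zero_iff F _ i).2 h
  have h1' : (i : F) ^ (2 * m) = 1 := by
    simpa using congrArg (ZMod.castHom (dvd_refl (2 * m + 1)) F) h1
  rw [show (2 * (m * (k + k)) + 1) / 2 = 2 * m * k by
    rw [show 2 * (m * (k + k)) = 2 * (2 * m * k) by ring]; omega, pow_mul, h1', one_pow]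

/-- In a finite field of order `p ^ e` with `e` odd, some element of the prime field is not a
square. -/
theorem exists_natCast_not_isSquare_of_odd {F : Type*} [Field F] [Fintype F] {p e : ℕ}
    [Fact p.Prime] [CharP F p] (hodd : Odd p) (hF : Fintype.card F = p ^ e) (he : Odd e) :
    ∃ i : ℕ, 0 < i ∧ i < p ∧ ¬ IsSquare (i : F) := by
  obtain ⟨m, rfl⟩ := hodd
  obtain ⟨S, hS, hpar⟩ := exists_pow_eq_two_mul_mul_add_one m e
  have hSodd : Odd S := by
    rw [← Nat.not_even_iff_odd, hpar, Nat.not_even_iff_odd]; exact he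
  have h2 : ringChar F ≠ 2 := by rw [ringChar.eq F (2 * m + 1)]; omega
  obtain ⟨a, ha⟩ := FiniteField.exists_nonsquare (F := ZMod (2 * m + 1))
    (by rw [ZMod.ringChar_zmod_n]; omega)
  have ha0 : a ≠ 0 := by rintro rfl; exact ha (IsSquare.zero)
  have ham : a ^ m = -1 := by
    have h := ZMod.pow_div_two_eq_neg_one_or_one (2 * m + 1) ha0
    have h' := mt (ZMod.euler_criterion (2 * m + 1) ha0).2 ha
    rw [show (2 * m + 1) / 2 = m by omega] at h h'
    exact h.resolve_left h'
  have hcast : (a.val : F) = ZMod.castHom (dvd_refl (2 * m + 1)) F a := by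
    rw [← map_natCast (ZMod.castHom (dvd_refl (2 * m + 1)) F), ZMod.natCast_zmod_val]
  refine ⟨a.val, ZMod.val_pos.2 ha0, a.val_lt, ?_⟩
  have hne : (a.val : F) ≠ 0 := by
    rw [hcast]; exact (map_ne_zero _).2 ha0
  rw [FiniteField.isSquare_iff h2 hne, hF, hS,
    show (2 * (m * S) + 1) / 2 = m * S by omega, pow_mul, hcast, ← map_pow, ham, map_neg,
    map_one, hSodd.neg_one_pow]
  exact Ring.neg_one_ne_one_of_char_ne_two h2

namespace Matrix.SpecialLinearGroup

/-- The upper unitriangular matrix `[[1, t], [0, 1]]`. -/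
def upperUnipotent {F : Type*} [Field F] (t : F) : SpecialLinearGroup (Fin 2) F :=
  ⟨!![1, t; 0, 1], by simp [Matrix.det_fin_two_of]⟩

theorem coe_upperUnipotent {F : Type*} [Field F] (t : F) :
    (upperUnipotent t : Matrix (Fin 2) (Fin 2) F) = !![1, t; 0, 1] := rfl

theorem upperUnipotent_zero {F : Type*} [Field F] : upperUnipotent (0 : F) = 1 := by
  apply Subtype.ext
  rw [coe_upperUnipotent, coe_one, Matrix.one_fin_two]

theorem upperUnipotent_pow {F : Type*} [Field F] (t : F) (n : ℕ) :
    upperUnipotent t ^ n = upperUnipotent (n * t) := by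
  induction n with
  | zero => rw [pow_zero, Nat.cast_zero, zero_mul, upperUnipotent_zero]
  | succ n ih =>
    rw [pow_succ, ih]
    apply Subtype.ext
    rw [coe_mul]
    simp only [coe_upperUnipotent, Matrix.mul_fin_two]
    rw [show ((n + 1 : ℕ) : F) * t = t + n * t by push_cast; ring]
    simp

/-- Conjugacy in the special linear group, from an intertwining matrix of determinant one. -/
theorem isConj_of_mul_eq_mul {n R : Type*} [Fintype n] [DecidableEq n] [CommRing R]
    {M N : SpecialLinearGroup n R} (P : Matrix n n R) (hP : P.det = 1)
    (h : P * (M : Matrix n n R) = (N : Matrix n n R) * P) : IsConj M N :=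
  ⟨toUnits (⟨P, hP⟩ : SpecialLinearGroup n R), Subtype.ext h⟩

theorem isConj_upperUnipotent_mul_sq {F : Type*} [Field F] (t : F) {u : F} (hu : u ≠ 0) :
    IsConj (upperUnipotent t) (upperUnipotent (t * u ^ 2)) := by
  refine isConj_of_mul_eq_mul !![u, 0; 0, u⁻¹] (by simp [Matrix.det_fin_two_of, hu]) ?_
  ext i j
  fin_cases i <;> fin_cases j <;>
    simp [coe_upperUnipotent, Matrix.mul_apply, Fin.sum_univ_two]
  field_simp

/-- A nontrivial element of `SL₂` of trace two is conjugate to an upper unitriangular matrix. -/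
theorem exists_isConj_upperUnipotent {F : Type*} [Field F] {N : SpecialLinearGroup (Fin 2) F}
    (hN : N ≠ 1) (htr : N.1.trace = 2) : ∃ t : F, t ≠ 0 ∧ IsConj (upperUnipotent t) N := by
  obtain ⟨a, b, c, d, hM⟩ : ∃ a b c d : F, N.1 = !![a, b; c, d] :=
    ⟨_, _, _, _, Matrix.eta_fin_two N.1⟩
  have hdet := N.2
  rw [hM, Matrix.det_fin_two_of] at hdet
  rw [hM, Matrix.trace_fin_two_of] at htr
  by_cases hc : c = 0
  · have ha : a = 1 := by
      have h : (a - 1) ^ 2 = 0 := by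
        linear_combination a * htr - hdet - b * hc
      exact sub_eq_zero.1 (pow_eq_zero_iff two_ne_zero |>.1 h)
    have hd : d = 1 := by linear_combination htr - ha
    have hNU : N = upperUnipotent b := by
      apply Subtype.ext
      rw [hM, coe_upperUnipotent, ha, hc, hd]
    refine ⟨b, fun h => hN ?_, hNU ▸ IsConj.refl _⟩
    rw [hNU, h, upperUnipotent_zero]
  · refine ⟨-c, neg_ne_zero.2 hc,
      isConj_of_mul_eq_mul !![-(a - 1) / c, 1; -1, 0] (by simp [Matrix.det_fin_two_of]) ?_⟩
    rw [coe_upperUnipotent, hM]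
    ext i j
    fin_cases i <;> fin_cases j <;> simp [Matrix.mul_apply, Fin.sum_univ_two]
    · field_simp
      linear_combination a * htr - hdet
    · field_simp
      ring
    · field_simp
      linear_combination htr

/-- In characteristic `p`, an element of `SL₂` whose `p`-th power is trivial has trace two. -/
theorem trace_eq_two_of_pow_char_eq_one {F : Type*} [Field F] (p : ℕ) [Fact p.Prime] [CharP F p]
    {N : SpecialLinearGroup (Fin 2) F} (hN : N ^ p = 1) : N.1.trace = 2 := by
  have hNp : N.1 ^ p = 1 := by simpa using congrArg Subtype.val hN
  have hnil : IsNilpotent (N.1 - 1) :=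
    ⟨p, by rw [sub_pow_char_of_commute p (Commute.one_right _), hNp, one_pow, sub_self]⟩
  have h := (Matrix.isNilpotent_trace_of_isNilpotent hnil).eq_zero
  rw [Matrix.trace_sub, Matrix.trace_one, Fintype.card_fin] at h
  simpa using sub_eq_zero.1 h

/-- Central elements of `SL₂` square to one. -/
theorem sq_eq_one_of_mem_center {F : Type*} [Field F] {z : SpecialLinearGroup (Fin 2) F}
    (hz : z ∈ Subgroup.center (SpecialLinearGroup (Fin 2) F)) : z ^ 2 = 1 := by
  obtain ⟨r, hr, h⟩ := mem_center_iff.1 hz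
  rw [Fintype.card_fin] at hr
  apply Subtype.ext
  rw [coe_pow, ← h, ← map_pow, hr, map_one, coe_one]

end Matrix.SpecialLinearGroup

open Matrix.SpecialLinearGroup in
/-- For odd `p`, an element of order `p` of `PSL₂` in characteristic `p` is conjugate to the image
of an upper unitriangular matrix. -/
theorem PSL2.exists_isConj_mk_upperUnipotent {F : Type*} [Field F] {p : ℕ} [Fact p.Prime]
    [CharP F p] (hodd : Odd p) {A : PSL2 F} (hA : orderOf A = p) :
    ∃ t : F, t ≠ 0 ∧ IsConj (QuotientGroup.mk (upperUnipotent t) : PSL2 F) A := by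
  obtain ⟨M, rfl⟩ := QuotientGroup.mk_surjective A
  have hz : M ^ p ∈ Subgroup.center (Matrix.SpecialLinearGroup (Fin 2) F) := by
    rw [← QuotientGroup.eq_one_iff, QuotientGroup.mk_pow, ← hA, pow_orderOf_eq_one]
  have hmk : (QuotientGroup.mk (M * M ^ p) : PSL2 F) = QuotientGroup.mk M :=
    QuotientGroup.mk_mul_of_mem M hz
  have hpow : (M * M ^ p) ^ p = 1 := by
    obtain ⟨m, hm⟩ := hodd
    rw [← pow_succ', ← pow_mul, mul_comm, pow_mul, show p + 1 = 2 * (m + 1) by omega, pow_mul,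
      sq_eq_one_of_mem_center hz, one_pow]
  have hne : M * M ^ p ≠ 1 := by
    intro h
    rw [← hmk, h, QuotientGroup.mk_one, orderOf_one] at hA
    exact (Fact.out : p.Prime).ne_one hA.symm
  obtain ⟨t, ht, hconj⟩ :=
    exists_isConj_upperUnipotent hne (trace_eq_two_of_pow_char_eq_one p hpow)
  refine ⟨t, ht, ?_⟩
  rw [← hmk]
  exact (QuotientGroup.mk' (Subgroup.center _)).map_isConj hconj

/-- Let `p` be an odd prime, `q = p ^ e`, and `A ∈ PSL₂(q)` of order `p`.
If `e` is odd then some power `A ^ i` with `0 < i < p` is conjugate to the image of the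
matrix `[[1,1],[0,1]]`; if `e` is even then every power `A ^ i` with `0 < i < p` is
conjugate to `A`. -/
theorem unipotent_powers_PSL2 (p e : ℕ) (hp : p.Prime) (hodd : Odd p) (he : 0 < e)
    (F : Type*) [Field F] [Fintype F] (hF : Fintype.card F = p ^ e)
    (A : PSL2 F) (hA : orderOf A = p) :
    (Odd e → ∃ i : ℕ, 0 < i ∧ i < p ∧
      IsConj (A ^ i)
        (QuotientGroup.mk (⟨!![1, 1; 0, 1], by simp [Matrix.det_fin_two_of]⟩ :
          Matrix.SpecialLinearGroup (Fin 2) F) : PSL2 F)) ∧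
    (Even e → ∀ i : ℕ, 0 < i → i < p → IsConj (A ^ i) A) := by
  classical
  have : Fact p.Prime := ⟨hp⟩
  have : CharP F p := charP_of_card_eq_prime_pow hF
  obtain ⟨t, ht, hconj⟩ := PSL2.exists_isConj_mk_upperUnipotent hodd hA
  have hpow : ∀ i : ℕ,
      IsConj (A ^ i) (QuotientGroup.mk (SpecialLinearGroup.upperUnipotent (i * t)) : PSL2 F) := by
    intro i
    rw [← SpecialLinearGroup.upperUnipotent_pow, QuotientGroup.mk_pow]
    exact (hconj.pow i).symm
  have hsq : ∀ {s u : F}, u ≠ 0 → IsConj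
      (QuotientGroup.mk (SpecialLinearGroup.upperUnipotent s) : PSL2 F)
      (QuotientGroup.mk (SpecialLinearGroup.upperUnipotent (s * u ^ 2))) := fun {s u} hu =>
    (QuotientGroup.mk' (Subgroup.center _)).map_isConj
      (SpecialLinearGroup.isConj_upperUnipotent_mul_sq s hu)
  have hcast : ∀ i : ℕ, 0 < i → i < p → (i : F) ≠ 0 := fun i h0 hlt h =>
    absurd (Nat.le_of_dvd h0 ((CharP.cast_eq_zero_iff F p i).1 h)) (not_le.2 hlt)
  constructor
  · intro heodd
    obtain ⟨i, h0, hlt, hi⟩ : ∃ i : ℕ, 0 < i ∧ i < p ∧ IsSquare ((i : F) * t) := by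
      by_cases hts : IsSquare t
      · exact ⟨1, one_pos, hp.one_lt, by simpa using hts⟩
      · obtain ⟨i, h0, hlt, hi⟩ := exists_natCast_not_isSquare_of_odd hodd hF heodd
        refine ⟨i, h0, hlt, ?_⟩
        rw [← quadraticChar_one_iff_isSquare (mul_ne_zero (hcast i h0 hlt) ht), map_mul,
          quadraticChar_neg_one_iff_not_isSquare.2 hi,
          quadraticChar_neg_one_iff_not_isSquare.2 hts]
        norm_num
    obtain ⟨u, hu⟩ := hi
    have hu0 : u ≠ 0 := by
      rintro rfl
      exact mul_ne_zero (hcast i h0 hlt) ht (by simpa using hu)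
    refine ⟨i, h0, hlt, (hpow i).trans ?_⟩
    have h := hsq (s := 1) hu0
    rw [one_mul, sq, ← hu] at h
    exact h.symm
  · intro heven i h0 hlt
    obtain ⟨u, hu⟩ := isSquare_natCast_of_even hodd hF heven (hcast i h0 hlt)
    have hu0 : u ≠ 0 := by
      rintro rfl
      exact hcast i h0 hlt (by simpa using hu)
    have h := hsq (s := t) hu0
    rw [sq, ← hu, mul_comm] at h
    exact (hpow i).trans (h.symm.trans hconj)
end

section
/- Let q be an odd prime power, let C ∈ SL(2, 𝔽_q), let γ = tr(C), and let t be the order of the image of C in PSL₂(q). Assume γ ≠ 2 and γ ≠ −2. Then at least one of 2 + γ and 2 − γ is a square in 𝔽_q if and only if t is a good G-order with respect to q. -/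
open Matrix

/-- `n` is a *good `G`-order* with respect to `q = p ^ e` (for `G = PSL₂(q)`, `q` odd):
`n > 1` and either `n` divides `(q-1)/2` and some primitive `2n`-th root of unity `a` of
`𝔽_q` has `-a` a square in `𝔽_q`, or `n` divides `(q+1)/2` and some primitive `2n`-th root
of unity `a` of `𝔽_{q²}` satisfies `-a = c ^ 2` for some `c ∈ 𝔽_{q²}` with `c ^ (q+1) = 1`. -/
def IsGoodGOrder (p e : ℕ) [Fact p.Prime] (n : ℕ) : Prop :=
  1 < n ∧
  ((n ∣ (p ^ e - 1) / 2 ∧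
      ∃ a : GaloisField p e, orderOf a = 2 * n ∧ ∃ c : GaloisField p e, -a = c ^ 2) ∨
   (n ∣ (p ^ e + 1) / 2 ∧
      ∃ a : GaloisField p (2 * e), orderOf a = 2 * n ∧
        ∃ c : GaloisField p (2 * e), -a = c ^ 2 ∧ c ^ (p ^ e + 1) = 1))

/-- A finite field contains a primitive `n`-th root of unity for every divisor `n` of the order of
its multiplicative group. -/
theorem FiniteField.exists_isPrimitiveRoot_of_dvd {F : Type*} [Field F] [Finite F] {n : ℕ}
    (hn : n ∣ Nat.card F - 1) : ∃ ζ : F, IsPrimitiveRoot ζ n := by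
  obtain ⟨g, hg⟩ := IsCyclic.exists_ofOrder_eq_natCard (α := Fˣ)
  have hcard : Nat.card Fˣ = Nat.card F - 1 := Nat.card_units F
  obtain ⟨k, hk⟩ := hn
  have hprim : IsPrimitiveRoot (g : F) (n * k) := by
    rw [← hk, ← hcard, ← hg, ← orderOf_units]
    exact IsPrimitiveRoot.orderOf _
  have hpos : 0 < n * k := by
    have := Finite.one_lt_card (α := F)
    omega
  exact ⟨(g : F) ^ k, hprim.pow hpos (mul_comm _ _)⟩

theorem FiniteField.exists_sq_eq_and_pow_eq_one_iff {F : Type*} [Field F] [Finite F] {n : ℕ}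
    (hn : 0 < n) (hdvd : 2 * n ∣ Nat.card F - 1) (b : F) :
    (∃ c : F, b = c ^ 2 ∧ c ^ (2 * n) = 1) ↔ b ^ n = 1 := by
  constructor
  · rintro ⟨c, rfl, hc⟩
    rwa [← pow_mul]
  · intro hb
    obtain ⟨ζ, hζ⟩ := FiniteField.exists_isPrimitiveRoot_of_dvd hdvd
    have : NeZero n := ⟨hn.ne'⟩
    obtain ⟨i, -, rfl⟩ := (hζ.pow (by omega) rfl).eq_pow_of_pow_eq_one hb
    refine ⟨ζ ^ i, pow_right_comm _ _ _, ?_⟩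
    rw [pow_right_comm, hζ.pow_eq_one, one_pow]

/-- An element of a larger field which is a root of unity of order dividing `|K| - 1` comes
from the finite field `K`. -/
theorem FiniteField.exists_map_eq_of_pow_eq_one {K L : Type*} [Field K] [Finite K] [Field L]
    (f : K →+* L) {a : L} (ha : a ^ (Nat.card K - 1) = 1) : ∃ b : K, f b = a := by
  obtain ⟨ζ, hζ⟩ := FiniteField.exists_isPrimitiveRoot_of_dvd (dvd_refl (Nat.card K - 1))
  have : NeZero (Nat.card K - 1) := ⟨by have := Finite.one_lt_card (α := K); omega⟩
  obtain ⟨i, -, hi⟩ := (hζ.map_of_injective f.injective).eq_pow_of_pow_eq_one ha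
  exact ⟨ζ ^ i, by rw [map_pow, hi]⟩

theorem orderOf_eq_two_mul_of_pow_eq_neg_one {F : Type*} [Field F] (h2 : (2 : F) ≠ 0) {l : F}
    {t : ℕ} (ht : ∀ k, t ∣ k ↔ l ^ (2 * k) = 1) (hl : l ^ t = -1) : orderOf l = 2 * t := by
  have h1 : orderOf l ∣ 2 * t := orderOf_dvd_of_pow_eq_one ((ht t).1 dvd_rfl)
  obtain ⟨k, hk⟩ : t ∣ orderOf l := (ht _).2 (by rw [mul_comm, pow_mul, pow_orderOf_eq_one, one_pow])
  rcases Nat.even_or_odd' k with ⟨j, rfl | rfl⟩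
  · exact Nat.dvd_antisymm h1 ⟨j, by rw [hk]; ring⟩
  · have h := pow_orderOf_eq_one l
    rw [hk, pow_mul, hl, Odd.neg_one_pow ⟨j, rfl⟩] at h
    exact absurd (by linear_combination -h) h2

/-- In a field, let `l` have order `t` modulo `±1` and satisfy `l ^ (2 * m) = 1`. Then `l` or `-l`
is an `m`-torsion element iff `-a` is for some element `a` of order `2 * t`. -/
theorem pow_eq_one_or_neg_pow_eq_one_iff {F : Type*} [Field F] (h2 : (2 : F) ≠ 0) {l : F}
    {t m : ℕ} (ht0 : 0 < t) (ht : ∀ k, t ∣ k ↔ l ^ (2 * k) = 1) (htm : t ∣ m) :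
    (l ^ m = 1 ∨ (-l) ^ m = 1) ↔ ∃ a : F, orderOf a = 2 * t ∧ (-a) ^ m = 1 := by
  wlog hl : l ^ t = -1 generalizing l
  · have ht' : ∀ k, t ∣ k ↔ (-l) ^ (2 * k) = 1 := fun k ↦ by rw [ht, pow_mul, pow_mul, neg_sq]
    have hl1 : l ^ t = 1 := by
      have h := (ht t).1 dvd_rfl
      rw [mul_comm, pow_mul] at h
      exact (sq_eq_one_iff.1 h).resolve_right hl
    have hodd : Odd t := by
      by_contra hev
      obtain ⟨s, rfl⟩ := even_iff_two_dvd.1 (Nat.not_odd_iff_even.1 hev)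
      have := Nat.le_of_dvd (by omega) ((ht s).2 hl1)
      omega
    rw [or_comm, ← this ht' (by rw [hodd.neg_pow, hl1]), neg_neg]
  have hord := orderOf_eq_two_mul_of_pow_eq_neg_one h2 ht hl
  constructor
  · rintro (h | h)
    · refine ⟨l, hord, ?_⟩
      obtain ⟨j, rfl⟩ := orderOf_dvd_of_pow_eq_one h
      rw [Even.neg_pow ⟨t * j, by rw [hord]; ring⟩, h]
    · exact ⟨l, hord, h⟩
  · rintro ⟨a, ha, ham⟩
    have : NeZero (2 * t) := ⟨by omega⟩
    obtain ⟨i, -, hi, rfl⟩ := ((IsPrimitiveRoot.iff_orderOf.2 ha).isPrimitiveRoot_iff).1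
      (IsPrimitiveRoot.iff_orderOf.2 hord)
    have hodd : Odd i := Nat.coprime_two_right.1 (Nat.Coprime.coprime_mul_right_right hi)
    right
    rw [← hodd.neg_pow, pow_right_comm, ham, one_pow]

theorem Matrix.SpecialLinearGroup.exists_pow_eq_smul_add_smul_one {K L : Type*} [Field K] [Field L]
    (f : K →+* L) (C : SpecialLinearGroup (Fin 2) K) (k : ℕ) :
    ∃ a b : K, (C : Matrix (Fin 2) (Fin 2) K) ^ k = a • (C : Matrix (Fin 2) (Fin 2) K) + b • 1 ∧
      ∀ l : L, l ^ 2 - f (trace (C : Matrix (Fin 2) (Fin 2) K)) * l + 1 = 0 →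
        l ^ k = f a * l + f b := by
  induction k with
  | zero => exact ⟨0, 1, by simp, by simp⟩
  | succ k ih =>
    obtain ⟨a, b, hC, hl⟩ := ih
    have hsq : (C : Matrix (Fin 2) (Fin 2) K) * C =
        trace (C : Matrix (Fin 2) (Fin 2) K) • (C : Matrix (Fin 2) (Fin 2) K) - 1 := by
      have hdet := C.det_coe
      rw [det_fin_two] at hdet
      ext i j
      fin_cases i <;> fin_cases j <;> simp [mul_apply, trace_fin_two] <;>
        first | linear_combination -hdet | ring
    refine ⟨a * trace (C : Matrix (Fin 2) (Fin 2) K) + b, -a, ?_, fun l h ↦ ?_⟩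
    · rw [pow_succ, hC, add_mul, smul_mul_assoc, hsq]
      simp only [smul_mul_assoc, one_mul]
      module
    · rw [pow_succ, hl l h]
      simp only [map_add, map_mul, map_neg]
      linear_combination f a * h

/-- The order of the image of `C` in `PSL₂` is the order of `l ^ 2`, for `l` an eigenvalue. -/
theorem orderOf_mk_PSL2_dvd_iff {K L : Type*} [Field K] [Field L]
    (f : K →+* L) (C : SpecialLinearGroup (Fin 2) K)
    (h₁ : trace (C : Matrix (Fin 2) (Fin 2) K) ≠ 2)
    (h₂ : trace (C : Matrix (Fin 2) (Fin 2) K) ≠ -2) {l : L}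
    (hl : l ^ 2 - f (trace (C : Matrix (Fin 2) (Fin 2) K)) * l + 1 = 0) (k : ℕ) :
    orderOf (QuotientGroup.mk C : PSL2 K) ∣ k ↔ l ^ (2 * k) = 1 := by
  obtain ⟨a, b, hC, hroot⟩ := C.exists_pow_eq_smul_add_smul_one f k
  have hl0 : l ≠ 0 := by rintro rfl; simp at hl
  have hinv : l⁻¹ ^ 2 - f (trace (C : Matrix (Fin 2) (Fin 2) K)) * l⁻¹ + 1 = 0 := by
    field_simp
    linear_combination hl
  have hlne : l - l⁻¹ ≠ 0 := by
    intro h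
    have hsq : l ^ 2 = 1 := by
      field_simp at h
      linear_combination h
    rcases sq_eq_one_iff.1 hsq with rfl | rfl
    · exact h₁ (f.injective (by rw [map_ofNat]; linear_combination -hl))
    · exact h₂ (f.injective (by rw [map_neg, map_ofNat]; linear_combination hl))
  have hlk : l ^ (2 * k) = 1 ↔ a = 0 := by
    have hsub : l ^ k - l⁻¹ ^ k = f a * (l - l⁻¹) := by
      rw [hroot l hl, hroot _ hinv]; ring
    have : l ^ (2 * k) = 1 ↔ l ^ k - l⁻¹ ^ k = 0 := by
      rw [sub_eq_zero, inv_pow, ← mul_eq_one_iff_eq_inv₀ (pow_ne_zero _ hl0), two_mul, pow_add]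
    rw [this, hsub, mul_eq_zero, or_iff_left hlne, map_eq_zero]
  rw [hlk, orderOf_dvd_iff_pow_eq_one, ← QuotientGroup.mk_pow, QuotientGroup.eq_one_iff,
    Matrix.SpecialLinearGroup.mem_center_iff, Matrix.SpecialLinearGroup.coe_pow, hC]
  constructor
  · rintro ⟨r, -, hr⟩
    by_contra ha
    have h01 := congrFun (congrFun hr 0) 1
    have h10 := congrFun (congrFun hr 1) 0
    have h00 := congrFun (congrFun hr 0) 0
    have h11 := congrFun (congrFun hr 1) 1
    simp [ha] at h00 h01 h10 h11
    have hdiag : (C : Matrix (Fin 2) (Fin 2) K) 0 0 = (C : Matrix (Fin 2) (Fin 2) K) 1 1 :=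
      mul_left_cancel₀ ha (by linear_combination h11 - h00)
    have hdet := C.det_coe
    rw [det_fin_two, h01, hdiag] at hdet
    rw [trace_fin_two, hdiag] at h₁ h₂
    rcases mul_self_eq_one_iff.1 (show _ * _ = (1 : K) by linear_combination hdet) with h | h
    · exact h₁ (by rw [h]; norm_num)
    · exact h₂ (by rw [h]; norm_num)
  · rintro rfl
    refine ⟨b, ?_, ?_⟩
    · have hdet := congrArg det hC
      rw [det_pow, C.det_coe, one_pow] at hdet
      simpa using hdet.symm
    · ext i j
      fin_cases i <;> fin_cases j <;> simp

/-- Let `l` be a root of `X ^ 2 - x X + 1`, where `x` lies in the field with `q` elements, and let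
`2 * m` be one of `q - 1`, `q + 1`. If `l ^ (2 * m) = 1`, then `2 + x` is a square iff
`l ^ m = 1`. -/
theorem FiniteField.isSquare_two_add_iff {K L : Type*} [Field K] [Finite K] [Field L] {p e m : ℕ}
    [Fact p.Prime] [CharP L p] (h2 : (2 : L) ≠ 0) (hK : Nat.card K = p ^ e)
    (hm : 2 * m + 1 = p ^ e ∨ 2 * m = p ^ e + 1) (f : K →+* L) {x : K} (hx : x ≠ -2) {l : L}
    (hl : l ^ 2 - f x * l + 1 = 0) (hlm : l ^ (2 * m) = 1) :
    IsSquare (2 + x) ↔ l ^ m = 1 := by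
  have := Fintype.ofFinite K
  have hl0 : l ≠ 0 := by rintro rfl; simp at hl
  have hx0 : 2 + x ≠ 0 := fun h ↦ hx (by linear_combination h)
  have hchar : ringChar K ≠ 2 := fun h ↦ h2 <| by
    rw [← map_ofNat f 2, map_eq_zero]
    exact_mod_cast (ringChar.spec K 2).2 (by rw [h])
  have hfx : f (2 + x) * l = (l + 1) ^ 2 := by
    rw [map_add, map_ofNat]; linear_combination -hl
  have hl1 : l + 1 ≠ 0 := fun h ↦ by
    rw [h, zero_pow two_ne_zero, mul_eq_zero, map_eq_zero] at hfx
    tauto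
  have hfrob : (l + 1) ^ p ^ e = l ^ p ^ e + 1 := by rw [add_pow_expChar_pow, one_pow]
  rw [FiniteField.isSquare_iff hchar hx0, ← Nat.card_eq_fintype_card, hK,
    ← f.injective.eq_iff, map_pow, map_one]
  have hmm : l ^ m * l ^ m = 1 := by rw [← pow_add, ← two_mul, hlm]
  obtain ⟨n, hn⟩ : Odd (p ^ e) := Nat.odd_iff.2 (by omega)
  have hpe : p ^ e / 2 = n := by omega
  rw [hpe]
  have key : f (2 + x) ^ n * l ^ n = (l + 1) ^ (2 * n) := by rw [← mul_pow, hfx, pow_mul]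
  rw [hn, pow_succ] at hfrob
  rcases hm with hm | hm
  · obtain rfl : n = m := by omega
    rw [pow_succ, hlm, one_mul] at hfrob
    rw [mul_right_cancel₀ hl1 (hfrob.trans (one_mul _).symm)] at key
    rw [eq_inv_of_mul_eq_one_left key, inv_eq_one]
  · obtain rfl : m = n + 1 := by omega
    have h : (l + 1) ^ (2 * n) * l = 1 := by
      refine mul_right_cancel₀ hl1 ?_
      have h3 : l ^ (2 * n + 1) * l = 1 := by rw [← hlm]; ring
      linear_combination l * hfrob + h3
    have : f (2 + x) ^ n * l ^ (n + 1) = 1 := by rw [← h, ← key]; ring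
    rw [eq_inv_of_mul_eq_one_left this, inv_eq_one]

/-- A quadratic polynomial `X ^ 2 - x X + 1` over a finite field of odd order splits in a
quadratic extension. -/
theorem FiniteField.exists_root_of_card_eq_sq {K L : Type*} [Field K] [Finite K] [Field L]
    [Finite L] (h2 : (2 : L) ≠ 0) (hK : Odd (Nat.card K)) (hKL : Nat.card L = Nat.card K ^ 2)
    (f : K →+* L) (x : K) : ∃ l : L, l ^ 2 - f x * l + 1 = 0 := by
  have := Fintype.ofFinite K
  have := Fintype.ofFinite L
  have hchar : ringChar L ≠ 2 := fun h ↦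
    h2 (by exact_mod_cast (ringChar.spec L 2).2 (by rw [h]))
  obtain ⟨s, hs⟩ : IsSquare (f (x ^ 2 - 4)) := by
    by_cases hd : x ^ 2 - 4 = 0
    · simp [hd]
    rw [FiniteField.isSquare_iff hchar ((map_ne_zero f).2 hd), ← Nat.card_eq_fintype_card, hKL]
    obtain ⟨n, hn⟩ := hK
    have hpow : (x ^ 2 - 4) ^ (2 * n) = 1 := by
      have := FiniteField.pow_card_sub_one_eq_one _ hd
      rwa [← Nat.card_eq_fintype_card, hn, Nat.add_sub_cancel] at this
    have : Nat.card K ^ 2 / 2 = 2 * n * (n + 1) := by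
      rw [hn, show (2 * n + 1) ^ 2 = 2 * (2 * n * (n + 1)) + 1 by ring]; omega
    rw [this, ← map_pow, pow_mul, hpow, one_pow, map_one]
  rw [map_sub, map_pow, map_ofNat] at hs
  refine ⟨(f x + s) / 2, ?_⟩
  field_simp
  linear_combination -hs

/-- The eigenvalues of an element of `SL(2, q)` lie in the multiplicative group of `𝔽_q` or in the
norm-one group of `𝔽_{q²}`. -/
theorem FiniteField.pow_card_sub_one_eq_one_or_pow_card_add_one_eq_one {K L : Type*} [Field K]
    [Finite K] [Field L] {p e : ℕ} [Fact p.Prime] [CharP L p] (hK : Nat.card K = p ^ e)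
    (f : K →+* L) {x : K} {l : L} (hl : l ^ 2 - f x * l + 1 = 0) :
    l ^ (p ^ e - 1) = 1 ∨ l ^ (p ^ e + 1) = 1 := by
  have := Fintype.ofFinite K
  have hl0 : l ≠ 0 := by rintro rfl; simp at hl
  have hx : x ^ p ^ e = x := by rw [← hK, Nat.card_eq_fintype_card, FiniteField.pow_card]
  have hfrob := congrArg (· ^ p ^ e) (show l ^ 2 + 1 = f x * l by linear_combination hl)
  simp only [add_pow_expChar_pow, mul_pow, ← map_pow, hx, one_pow] at hfrob
  rw [pow_right_comm] at hfrob
  have hprod : (l ^ p ^ e - l) * (l ^ p ^ e * l - 1) = 0 := by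
    linear_combination l * hfrob - l ^ p ^ e * hl
  rcases mul_eq_zero.1 hprod with h | h
  · left
    refine mul_right_cancel₀ hl0 ?_
    rw [← pow_succ, Nat.sub_add_cancel (Nat.one_le_pow _ _ (Fact.out : p.Prime).pos), one_mul]
    exact sub_eq_zero.1 h
  · right
    rw [pow_succ]
    exact sub_eq_zero.1 h

/-- Both alternatives in the definition of a good `G`-order, expressed inside `𝔽_{q²}`. -/
theorem isGoodGOrder_iff {p e n : ℕ} [Fact p.Prime] (hp : Odd p) (he : 0 < e)
    (f : GaloisField p e →+* GaloisField p (2 * e)) :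
    IsGoodGOrder p e n ↔ 1 < n ∧
      ((n ∣ (p ^ e - 1) / 2 ∧ ∃ a : GaloisField p (2 * e), orderOf a = 2 * n ∧
          (-a) ^ ((p ^ e - 1) / 2) = 1) ∨
        (n ∣ (p ^ e + 1) / 2 ∧ ∃ a : GaloisField p (2 * e), orderOf a = 2 * n ∧
          (-a) ^ ((p ^ e + 1) / 2) = 1)) := by
  have hK : Nat.card (GaloisField p e) = p ^ e := GaloisField.card p e he.ne'
  have hL : Nat.card (GaloisField p (2 * e)) = (p ^ e) ^ 2 := by
    rw [GaloisField.card p (2 * e) (by omega), ← pow_mul, mul_comm]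
  have hq1 : 1 < p ^ e := Nat.one_lt_pow he.ne' (Fact.out : p.Prime).one_lt
  obtain ⟨m, hm⟩ : Odd (p ^ e) := hp.pow
  have hsub : (p ^ e - 1) / 2 = m := by omega
  have hadd : (p ^ e + 1) / 2 = m + 1 := by omega
  unfold IsGoodGOrder
  rw [hsub, hadd]
  refine and_congr_right fun _ ↦ or_congr (and_congr_right fun hnm ↦ ?_)
    (and_congr_right fun _ ↦ exists_congr fun a ↦ and_congr_right fun _ ↦ ?_)
  · have hKm : Nat.card (GaloisField p e) - 1 = 2 * m := by omega
    constructor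
    · rintro ⟨a, ha, c, hc⟩
      have hc0 : c ≠ 0 := by
        rintro rfl
        obtain rfl : a = 0 := by simpa using hc
        simp at ha
        omega
      refine ⟨f a, by rw [← ha]; exact orderOf_injective (f : GaloisField p e →* GaloisField p (2 * e)) f.injective a, ?_⟩
      have := Fintype.ofFinite (GaloisField p e)
      have hcm := FiniteField.pow_card_sub_one_eq_one c hc0
      rw [← Nat.card_eq_fintype_card, hKm] at hcm
      rw [← map_neg, hc, ← map_pow, ← pow_mul, hcm, map_one]
    · rintro ⟨a, ha, ham⟩
      obtain ⟨b, rfl⟩ := FiniteField.exists_map_eq_of_pow_eq_one f (a := a) (by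
        rw [hKm, ← orderOf_dvd_iff_pow_eq_one, ha]
        exact mul_dvd_mul_left 2 hnm)
      rw [← map_neg, ← map_pow, map_eq_one_iff f f.injective] at ham
      obtain ⟨c, hc, -⟩ := (FiniteField.exists_sq_eq_and_pow_eq_one_iff (by omega)
        (by rw [hKm]) (-b)).2 ham
      exact ⟨b, by rw [← ha]; exact (orderOf_injective (f : GaloisField p e →* GaloisField p (2 * e)) f.injective b).symm, c, hc⟩
  · rw [← FiniteField.exists_sq_eq_and_pow_eq_one_iff (by omega), hm]
    · rfl
    · rw [hL, hm]
      exact ⟨2 * m, Nat.sub_eq_of_eq_add (by ring)⟩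

/-- Let `q = p ^ e` be an odd prime power, `C ∈ SL(2, 𝔽_q)`, `γ = tr C`,
and `t` the order of the image of `C` in `PSL₂(q)`.  If `γ ≠ ±2` then one of `2 + γ`,
`2 - γ` is a square in `𝔽_q` iff `t` is a good `G`-order with respect to `q`. -/
theorem square_iff_goodGOrder (p e : ℕ) [hp : Fact p.Prime] (hodd : Odd p) (he : 0 < e)
    (C : Matrix.SpecialLinearGroup (Fin 2) (GaloisField p e))
    (hγ : Matrix.trace (C : Matrix (Fin 2) (Fin 2) (GaloisField p e)) ≠ 2)
    (hγ' : Matrix.trace (C : Matrix (Fin 2) (Fin 2) (GaloisField p e)) ≠ -2)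
    (t : ℕ) (ht : t = orderOf (QuotientGroup.mk C : PSL2 (GaloisField p e))) :
    (IsSquare (2 + Matrix.trace (C : Matrix (Fin 2) (Fin 2) (GaloisField p e))) ∨
      IsSquare (2 - Matrix.trace (C : Matrix (Fin 2) (Fin 2) (GaloisField p e)))) ↔
      IsGoodGOrder p e t := by
  obtain ⟨f⟩ : Nonempty (GaloisField p e →ₐ[ZMod p] GaloisField p (2 * e)) :=
    FiniteField.nonempty_algHom_of_finrank_dvd <| by
      rw [GaloisField.finrank p he.ne', GaloisField.finrank p (by omega)]
      exact dvd_mul_left e 2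
  replace f : GaloisField p e →+* GaloisField p (2 * e) := f
  rw [isGoodGOrder_iff hodd he f]
  have hK : Nat.card (GaloisField p e) = p ^ e := GaloisField.card p e he.ne'
  have hL : Nat.card (GaloisField p (2 * e)) = Nat.card (GaloisField p e) ^ 2 := by
    rw [hK, GaloisField.card p (2 * e) (by omega), ← pow_mul, mul_comm]
  have h2 : (2 : GaloisField p (2 * e)) ≠ 0 := fun h ↦ by
    have := (Nat.prime_dvd_prime_iff_eq hp.out Nat.prime_two).1
      ((CharP.cast_eq_zero_iff (GaloisField p (2 * e)) p 2).1 (by exact_mod_cast h))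
    rw [this] at hodd
    exact absurd hodd (by decide)
  have hq1 : 1 < p ^ e := Nat.one_lt_pow he.ne' hp.out.one_lt
  obtain ⟨n, hn⟩ : Odd (p ^ e) := hodd.pow
  obtain ⟨l, hl⟩ := FiniteField.exists_root_of_card_eq_sq h2 (by rw [hK]; exact hodd.pow) hL f
    (trace (C : Matrix (Fin 2) (Fin 2) (GaloisField p e)))
  have hord := orderOf_mk_PSL2_dvd_iff f C hγ hγ' hl
  rw [← ht] at hord
  have ht1 : t ≠ 1 := by
    rintro rfl
    have hsq : l ^ 2 = 1 := (hord 1).1 dvd_rfl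
    rcases sq_eq_one_iff.1 hsq with rfl | rfl
    · exact hγ (f.injective (by rw [map_ofNat]; linear_combination -hl))
    · exact hγ' (f.injective (by rw [map_neg, map_ofNat]; linear_combination hl))
  have main (m : ℕ) (hm : 2 * m + 1 = p ^ e ∨ 2 * m = p ^ e + 1) (hlm : l ^ (2 * m) = 1) :
      1 < t ∧ t ∣ m ∧
      ((IsSquare (2 + trace (C : Matrix (Fin 2) (Fin 2) (GaloisField p e))) ∨
        IsSquare (2 - trace (C : Matrix (Fin 2) (Fin 2) (GaloisField p e)))) ↔
        ∃ a : GaloisField p (2 * e), orderOf a = 2 * t ∧ (-a) ^ m = 1) := by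
    have htm : t ∣ m := (hord m).2 hlm
    have ht0 : 0 < t := Nat.pos_of_dvd_of_pos htm (by omega)
    refine ⟨by omega, htm, ?_⟩
    rw [← pow_eq_one_or_neg_pow_eq_one_iff h2 ht0 hord htm,
      FiniteField.isSquare_two_add_iff h2 hK hm f hγ' hl hlm, sub_eq_add_neg,
      FiniteField.isSquare_two_add_iff h2 hK hm f (l := -l) (fun h ↦ hγ (neg_injective h))
        (by rw [map_neg]; linear_combination hl) (by rw [pow_mul, neg_sq, ← pow_mul, hlm])]
  have hexcl : t ∣ n → t ∣ n + 1 → False := fun h h' ↦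
    ht1 (Nat.dvd_one.1 ((Nat.dvd_add_right h).1 h'))
  have hsub : (p ^ e - 1) / 2 = n := by omega
  have hadd : (p ^ e + 1) / 2 = n + 1 := by omega
  rw [hsub, hadd]
  rcases FiniteField.pow_card_sub_one_eq_one_or_pow_card_add_one_eq_one hK f hl with h | h
  · obtain ⟨ht, htn, hiff⟩ := main n (by omega) (by rw [← h]; congr 1; omega)
    exact hiff.trans ⟨fun H ↦ ⟨ht, Or.inl ⟨htn, H⟩⟩, fun H ↦ H.2.elim And.right
      fun H' ↦ (hexcl htn H'.1).elim⟩
  · obtain ⟨ht, htn, hiff⟩ := main (n + 1) (by omega) (by rw [← h]; congr 1; omega)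
    exact hiff.trans ⟨fun H ↦ ⟨ht, Or.inr ⟨htn, H⟩⟩, fun H ↦ H.2.elim
      (fun H' ↦ (hexcl H'.1 htn).elim) And.right⟩
end

section
/- Let q = p^e where p is an odd prime, 5 ≤ q and q ≠ 9, and let t > 1 be an integer coprime to p. Then there exist elements A, B, C ∈ PSL₂(q) with ABC = 1, A and B of order p, C of order t, ⟨A, B⟩ = PSL₂(q), and A conjugate to B in PSL₂(q), if and only if e = μ_PSL(p, t) and t is a good G-order with respect to q. -/
open Matrix

/-- `μ_PSL(p, n)`: the least `f > 0` such that `p ^ f ≡ ±1 (mod gcd(2, n) · n)`. -/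
noncomputable def muPSL (p n : ℕ) : ℕ :=
  sInf {f : ℕ | 0 < f ∧
    ((p : ZMod (Nat.gcd 2 n * n)) ^ f = 1 ∨ (p : ZMod (Nat.gcd 2 n * n)) ^ f = -1)}

namespace UnipotentPair

open OnePoint
open scoped MatrixGroups

section Matrices

variable {L : Type*} [Field L]

/-- The upper unitriangular matrix with off-diagonal entry `x`. -/
def upper (x : L) : SL(2, L) := ⟨!![1, x; 0, 1], by simp⟩

/-- The lower unitriangular matrix with off-diagonal entry `x`. -/
def lower (x : L) : SL(2, L) := ⟨!![1, 0; x, 1], by simp⟩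

/-- The trace of an element of `SL(2, L)`. -/
def tr (g : SL(2, L)) : L := g 0 0 + g 1 1

@[simp] lemma upper_coe (x : L) : (upper x : Matrix (Fin 2) (Fin 2) L) = !![1, x; 0, 1] := rfl

@[simp] lemma lower_coe (x : L) : (lower x : Matrix (Fin 2) (Fin 2) L) = !![1, 0; x, 1] := rfl

lemma det_eq (g : SL(2, L)) : g 0 0 * g 1 1 - g 0 1 * g 1 0 = 1 := by
  rw [← Matrix.det_fin_two, g.2]

lemma ext_fin_two {g h : SL(2, L)} (h₀₀ : g 0 0 = h 0 0)
    (h₀₁ : g 0 1 = h 0 1) (h₁₀ : g 1 0 = h 1 0) (h₁₁ : g 1 1 = h 1 1) : g = h := by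
  ext i j
  fin_cases i <;> fin_cases j <;> assumption

lemma upper_add (x y : L) : upper (x + y) = upper x * upper y := by
  apply ext_fin_two <;> simp [Matrix.mul_apply, Fin.sum_univ_two, add_comm]

lemma lower_add (x y : L) : lower (x + y) = lower x * lower y := by
  apply ext_fin_two <;> simp [Matrix.mul_apply, Fin.sum_univ_two, add_comm]

lemma upper_zero : upper (0 : L) = 1 := by
  apply ext_fin_two <;> simp

lemma lower_zero : lower (0 : L) = 1 := by
  apply ext_fin_two <;> simp

lemma upper_neg (x : L) : upper (-x) = (upper x)⁻¹ := by
  rw [eq_inv_iff_mul_eq_one, ← upper_add, neg_add_cancel, upper_zero]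

lemma lower_neg (x : L) : lower (-x) = (lower x)⁻¹ := by
  rw [eq_inv_iff_mul_eq_one, ← lower_add, neg_add_cancel, lower_zero]

lemma tr_conj (g h : SL(2, L)) : tr (g * h * g⁻¹) = tr h := by
  have hg := det_eq g
  simp [tr, Matrix.SpecialLinearGroup.coe_inv, Matrix.adjugate_fin_two, Matrix.mul_apply,
    Fin.sum_univ_two]
  linear_combination (h 0 0 + h 1 1) * hg

lemma tr_neg (g : SL(2, L)) : tr (-g) = -tr g := by
  simp [tr]; ring

lemma tr_upper_mul_lower (u v : L) : tr (upper u * lower v) = 2 + u * v := by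
  simp [tr, Matrix.mul_apply, Fin.sum_univ_two]; ring

/-- The set of `x` with `upper x ∈ H`, an additive subgroup. -/
def upperGroup (H : Subgroup SL(2, L)) : AddSubgroup L where
  carrier := {x | upper x ∈ H}
  add_mem' hx hy := by
    simp only [Set.mem_ofPred_eq] at *
    rw [upper_add]
    exact mul_mem hx hy
  zero_mem' := by
    simp only [Set.mem_ofPred_eq, upper_zero, one_mem]
  neg_mem' hx := by
    simp only [Set.mem_ofPred_eq] at *
    rw [upper_neg]
    exact inv_mem hx

/-- The set of `x` with `lower x ∈ H`, an additive subgroup. -/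
def lowerGroup (H : Subgroup SL(2, L)) : AddSubgroup L where
  carrier := {x | lower x ∈ H}
  add_mem' hx hy := by
    simp only [Set.mem_ofPred_eq] at *
    rw [lower_add]
    exact mul_mem hx hy
  zero_mem' := by
    simp only [Set.mem_ofPred_eq, lower_zero, one_mem]
  neg_mem' hx := by
    simp only [Set.mem_ofPred_eq] at *
    rw [lower_neg]
    exact inv_mem hx

lemma mem_upperGroup {H : Subgroup SL(2, L)} {x : L} :
    x ∈ upperGroup H ↔ upper x ∈ H := Iff.rfl

lemma mem_lowerGroup {H : Subgroup SL(2, L)} {x : L} :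
    x ∈ lowerGroup H ↔ lower x ∈ H := Iff.rfl

lemma upper_pow (x : L) (n : ℕ) : upper x ^ n = upper (n * x) := by
  induction n with
  | zero => simp [upper_zero]
  | succ n ih => rw [pow_succ, ih, ← upper_add]; congr 1; push_cast; ring

lemma lower_pow (x : L) (n : ℕ) : lower x ^ n = lower (n * x) := by
  induction n with
  | zero => simp [lower_zero]
  | succ n ih => rw [pow_succ, ih, ← lower_add]; congr 1; push_cast; ring

lemma add_inv_eq_add_inv_iff {x y : L} (hx : x ≠ 0) (hy : y ≠ 0) :
    x + x⁻¹ = y + y⁻¹ ↔ x = y ∨ x = y⁻¹ := by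
  constructor
  · intro h
    have : (x - y) * (x * y - 1) = 0 := by field_simp at h; linear_combination h
    rcases mul_eq_zero.1 this with h | h
    · exact .inl (sub_eq_zero.1 h)
    · exact .inr (eq_inv_of_mul_eq_one_left (sub_eq_zero.1 h))
  · rintro (rfl | rfl)
    · rfl
    · rw [inv_inv, add_comm]

/-- If `w` is an eigenvalue of the non-scalar matrix `g`, then `g ^ n = 1` forces `w ^ n = 1`. -/
lemma eigenvalue_pow_eq_one {g : SL(2, L)} {w : L} (hw : w ≠ 0)
    (hg : w + w⁻¹ = tr g) (h₀₁ : g 0 1 ≠ 0) {n : ℕ} (hn : g ^ n = 1) : w ^ n = 1 := by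
  have hdet := det_eq g
  have key : ∀ m : ℕ, (g ^ m : SL(2, L)) 0 0 * g 0 1 +
      (g ^ m : SL(2, L)) 0 1 * (w - g 0 0) = w ^ m * g 0 1 := by
    intro m
    induction m with
    | zero => simp
    | succ m ih =>
      have hg' : w * w + 1 = (g 0 0 + g 1 1) * w := by
        rw [tr] at hg; rw [← hg]; field_simp
      rw [pow_succ, pow_succ, mul_right_comm, ← ih]
      simp only [Matrix.SpecialLinearGroup.coe_mul, Matrix.mul_apply, Fin.sum_univ_two]
      linear_combination (g ^ m : SL(2, L)) 0 1 * (-hg' - hdet)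
  have := key n
  rw [hn] at this
  simpa [h₀₁] using this.symm

/-- A subgroup containing all upper and lower unitriangular matrices is everything. -/
lemma eq_top_of_upper_lower {H : Subgroup SL(2, L)}
    (hu : ∀ x, upper x ∈ H) (hl : ∀ x, lower x ∈ H) : H = ⊤ := by
  refine eq_top_iff.2 fun g _ ↦ Matrix.SL2.transvection_induction (· ∈ H) ?_ (fun _ _ ↦ mul_mem) g
  intro i j hij c
  fin_cases i <;> fin_cases j
  · exact absurd rfl hij
  · convert hu c using 1
    apply ext_fin_two <;> simp [Matrix.SpecialLinearGroup.transvection_coe, Matrix.single]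
  · convert hl c using 1
    apply ext_fin_two <;> simp [Matrix.SpecialLinearGroup.transvection_coe, Matrix.single]
  · exact absurd rfl hij

end Matrices

section Action

variable {L : Type*} [Field L] [DecidableEq L]

/-- The action of `SL(2, L)` on the projective line by Möbius transformations. -/
instance instSLAction : MulAction SL(2, L) (OnePoint L) :=
  MulAction.compHom _ Matrix.SpecialLinearGroup.toGL

lemma smul_infty_eq (g : SL(2, L)) :
    g • (∞ : OnePoint L) = if g 1 0 = 0 then ∞ else ((g 0 0 / g 1 0 : L) : OnePoint L) :=
  OnePoint.smul_infty_eq_ite (Matrix.SpecialLinearGroup.toGL g)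

lemma smul_coe_eq (g : SL(2, L)) (k : L) :
    g • (k : OnePoint L) = if g 1 0 * k + g 1 1 = 0 then ∞
      else (((g 0 0 * k + g 0 1) / (g 1 0 * k + g 1 1) : L) : OnePoint L) :=
  OnePoint.smul_some_eq_ite (g := Matrix.SpecialLinearGroup.toGL g)

lemma smul_infty_eq_self (g : SL(2, L)) : g • (∞ : OnePoint L) = ∞ ↔ g 1 0 = 0 := by
  rw [smul_infty_eq]; split_ifs with h <;> simp [h]

lemma smul_coe_eq_self (g : SL(2, L)) (k : L) :
    g • (k : OnePoint L) = k ↔ g 1 0 * k ^ 2 + (g 1 1 - g 0 0) * k - g 0 1 = 0 := by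
  have hg := det_eq g
  rw [smul_coe_eq]
  split_ifs with h
  · refine ⟨fun h' ↦ absurd h' (infty_ne_coe _), fun h' ↦ ?_⟩
    have h1 : g 0 0 * k + g 0 1 = 0 := by linear_combination k * h - h'
    exact absurd hg (by
      rw [show g 0 0 * g 1 1 - g 0 1 * g 1 0 = 0 by linear_combination g 0 0 * h - g 1 0 * h1]
      exact zero_ne_one)
  · rw [OnePoint.coe_eq_coe, div_eq_iff h]
    constructor <;> intro h' <;> linear_combination -h'

lemma neg_smul (g : SL(2, L)) (x : OnePoint L) : (-g) • x = g • x := by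
  cases x with
  | infty => simp [smul_infty_eq]
  | coe k =>
    simp only [smul_coe_eq, Matrix.SpecialLinearGroup.coe_neg, Matrix.neg_apply]
    have h : -g 1 0 * k + -g 1 1 = -(g 1 0 * k + g 1 1) := by ring
    have h' : -g 0 0 * k + -g 0 1 = -(g 0 0 * k + g 0 1) := by ring
    simp only [h, h', neg_eq_zero, neg_div_neg_eq]

lemma upper_smul_coe (v x : L) : upper v • (x : OnePoint L) = ((x + v : L) : OnePoint L) := by
  simp [smul_coe_eq]

lemma lower_smul_infty {x : L} (hx : x ≠ 0) :
    lower x • (∞ : OnePoint L) = ((x⁻¹ : L) : OnePoint L) := by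
  simp [smul_infty_eq, hx]

lemma lower_smul_zero (x : L) : lower x • ((0 : L) : OnePoint L) = ((0 : L) : OnePoint L) := by
  simp [smul_coe_eq]

/-- A non-scalar element of `SL(2, L)` with its eigenvalues in `L` has two fixed points on the
projective line, counted with multiplicity. -/
lemma card_fixed_mul [Fintype L] [DecidableEq (OnePoint L)] {g : SL(2, L)}
    (h1 : g ≠ 1) (hn1 : g ≠ -1)
    (hg : ∃ w : L, w ≠ 0 ∧ w + w⁻¹ = tr g) :
    (Finset.univ.filter fun x : OnePoint L ↦ g • x = x).card *
      (1 + if tr g ^ 2 = 4 then 1 else 0) = 2 := by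
  have hdet := det_eq g
  by_cases hc : g 1 0 = 0
  · by_cases had : g 0 0 = g 1 1
    · have ht : tr g ^ 2 = 4 := by
        rw [tr]; linear_combination 4 * hdet + (g 0 0 - g 1 1) * had + 4 * g 0 1 * hc
      have hb : g 0 1 ≠ 0 := by
        intro hb
        have : (g 0 0 - 1) * (g 0 0 + 1) = 0 := by
          linear_combination hdet + g 0 1 * hc + g 0 0 * had
        rcases mul_eq_zero.1 this with h | h
        · refine h1 (ext_fin_two ?_ ?_ ?_ ?_) <;> simp [hb, hc, ← had, sub_eq_zero.1 h]
        · refine hn1 (ext_fin_two ?_ ?_ ?_ ?_) <;>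
            simp [hb, hc, ← had, eq_neg_of_add_eq_zero_left h]
      have : (Finset.univ.filter fun x : OnePoint L ↦ g • x = x) = {∞} := by
        ext x
        cases x with
        | infty => simp [smul_infty_eq_self, hc]
        | coe k => simp [smul_coe_eq_self, hc, had, hb]
      rw [this, if_pos ht]; simp
    · have ht : tr g ^ 2 ≠ 4 := by
        intro ht
        rw [tr] at ht
        have : (g 0 0 - g 1 1) ^ 2 = 0 := by
          linear_combination ht - 4 * hdet - 4 * g 0 1 * hc
        exact had (sub_eq_zero.1 (pow_eq_zero_iff two_ne_zero |>.1 this))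
      have had' : g 1 1 - g 0 0 ≠ 0 := sub_ne_zero.2 (Ne.symm had)
      have : (Finset.univ.filter fun x : OnePoint L ↦ g • x = x) =
          {∞, ((g 0 1 / (g 1 1 - g 0 0) : L) : OnePoint L)} := by
        ext x
        cases x with
        | infty => simp [smul_infty_eq_self, hc]
        | coe k => simp [smul_coe_eq_self, hc, eq_div_iff had', sub_eq_zero, mul_comm]
      rw [this, if_neg ht, Finset.card_pair (infty_ne_coe _)]
  · obtain ⟨w, hw, hwt⟩ := hg
    have hww : w * w⁻¹ = 1 := mul_inv_cancel₀ hw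
    have hset : (Finset.univ.filter fun x : OnePoint L ↦ g • x = x) =
        {(((w - g 1 1) / g 1 0 : L) : OnePoint L),
          (((w⁻¹ - g 1 1) / g 1 0 : L) : OnePoint L)} := by
      ext x
      cases x with
      | infty => simp [smul_infty_eq_self, hc]
      | coe k =>
        simp only [Finset.mem_filter, Finset.mem_univ, true_and, smul_coe_eq_self,
          Finset.mem_insert, Finset.mem_singleton, OnePoint.coe_eq_coe, eq_div_iff hc]
        rw [tr] at hwt
        have : (k * g 1 0 - (w - g 1 1)) * (k * g 1 0 - (w⁻¹ - g 1 1)) =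
            g 1 0 * (g 1 0 * k ^ 2 + (g 1 1 - g 0 0) * k - g 0 1) := by
          linear_combination (-k * g 1 0 - g 1 1) * hwt + hww - hdet
        rw [← sub_eq_zero (a := k * g 1 0), ← sub_eq_zero (a := k * g 1 0) (b := w⁻¹ - g 1 1),
          ← mul_eq_zero, this, mul_eq_zero, or_iff_right hc]
    have hiff : tr g ^ 2 = 4 ↔ w = w⁻¹ := by
      rw [← sub_eq_zero (a := w), ← pow_eq_zero_iff two_ne_zero, ← hwt]
      constructor <;> intro h
      · linear_combination h - 4 * hww
      · linear_combination h + 4 * hww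
    rw [hset]
    by_cases hw1 : w = w⁻¹
    · rw [if_pos (hiff.2 hw1), ← hw1]; simp
    · rw [if_neg (mt hiff.1 hw1), Finset.card_pair]
      rw [Ne, OnePoint.coe_eq_coe, div_left_inj' hc, sub_left_inj]
      exact hw1

end Action

section Counting

variable {L : Type*} [Field L] [DecidableEq L]

/-- The order of the stabilizer in `H` of a point of the projective line. -/
noncomputable def stabCard (H : Subgroup SL(2, L)) (x : OnePoint L) : ℕ :=
  Nat.card (MulAction.stabilizer H x)

/-- The number of unipotent elements of `H` fixing a point of the projective line. -/
noncomputable def unipCard (H : Subgroup SL(2, L)) (x : OnePoint L) : ℕ :=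
  Nat.card {h : H // h • x = x ∧ tr (h : SL(2, L)) = 2}

open scoped Classical in
/-- The number of non-scalar elements of `H` fixing a point of the projective line, counted with
the multiplicity of the fixed point. -/
noncomputable def excess [Fintype L] (H : Subgroup SL(2, L)) (x : OnePoint L) : ℕ :=
  Finset.sum (Finset.univ.filter fun h : H ↦
      (h • x = x ∧ (h : SL(2, L)) ≠ 1 ∧ (h : SL(2, L)) ≠ -1))
    fun h : H ↦ (1 + if tr (h : SL(2, L)) ^ 2 = 4 then 1 else 0)

variable {H : Subgroup SL(2, L)}

omit [DecidableEq L] in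
lemma one_ne_neg_one (h2 : (2 : L) ≠ 0) : (1 : SL(2, L)) ≠ -1 := by
  intro h
  have := congr_arg (fun g : SL(2, L) ↦ g 0 0) h
  simp at this
  exact h2 (by linear_combination this)

omit [DecidableEq L] in
lemma tr_one : tr (1 : SL(2, L)) = 2 := by
  simp [tr]; norm_num

variable [Fintype L]

lemma sum_excess (h2 : (2 : L) ≠ 0) (hneg : -1 ∈ H)
    (hsplit : ∀ h ∈ H, ∃ w : L, w ≠ 0 ∧ w + w⁻¹ = tr h) :
    ∑ x, excess H x + 4 = 2 * Nat.card H := by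
  classical
  have h1 : ∑ x, excess H x =
      ∑ _h ∈ Finset.univ.filter fun h : H ↦
        ((h : SL(2, L)) ≠ 1 ∧ (h : SL(2, L)) ≠ -1), 2 := by
    unfold excess
    rw [Finset.sum_comm' (t' := Finset.univ.filter fun h : H ↦
        ((h : SL(2, L)) ≠ 1 ∧ (h : SL(2, L)) ≠ -1))
      (s' := fun h : H ↦ Finset.univ.filter fun x : OnePoint L ↦ (h : SL(2, L)) • x = x)]
    · refine Finset.sum_congr rfl fun h hh ↦ ?_
      simp only [Finset.mem_filter, Finset.mem_univ, true_and] at hh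
      rw [Finset.sum_const, smul_eq_mul]
      exact card_fixed_mul hh.1 hh.2 (hsplit h h.2)
    · intro x h
      simp [Subgroup.smul_def]
  have hset : (Finset.univ.filter fun h : H ↦ ((h : SL(2, L)) ≠ 1 ∧ (h : SL(2, L)) ≠ -1)) =
      Finset.univ \ {1, ⟨-1, hneg⟩} := by
    ext h
    have e1 : h = 1 ↔ (h : SL(2, L)) = 1 := Subtype.ext_iff
    have e2 : h = ⟨-1, hneg⟩ ↔ (h : SL(2, L)) = -1 := Subtype.ext_iff
    simp only [Finset.mem_filter, Finset.mem_univ, true_and, Finset.mem_sdiff, Finset.mem_insert,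
      Finset.mem_singleton, not_or, e1, e2, ne_eq]
  have hcard : ({1, ⟨-1, hneg⟩} : Finset H).card = 2 :=
    Finset.card_pair fun h ↦ one_ne_neg_one h2 (Subtype.ext_iff.1 h)
  have hle := Finset.card_le_univ ({1, ⟨-1, hneg⟩} : Finset H)
  rw [h1, Finset.sum_const, hset, Finset.card_sdiff_of_subset (Finset.subset_univ _), hcard,
    smul_eq_mul, Nat.card_eq_fintype_card, ← Finset.card_univ]
  rw [hcard, ← Finset.card_univ] at hle
  omega

lemma excess_add_four (h2 : (2 : L) ≠ 0) (hneg : -1 ∈ H) (x : OnePoint L) :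
    excess H x + 4 = stabCard H x + 2 * unipCard H x := by
  classical
  have h4 : (2 : L) ≠ -2 := fun h ↦ by
    have : (2 : L) * 2 = 0 := by linear_combination h
    exact h2 (mul_self_eq_zero.1 this)
  set A : Finset H := Finset.univ.filter fun h ↦ h • x = x with hA
  set n : H := ⟨-1, hneg⟩ with hn
  have hns (h : H) : (n * h) • x = h • x := by
    simp only [Subgroup.smul_def, hn, Subgroup.coe_mul, neg_one_mul, neg_smul]
  have h1n : (1 : H) ≠ n := fun h ↦ one_ne_neg_one h2 (Subtype.ext_iff.1 h)
  have h1A : ({1, n} : Finset H) ⊆ A := by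
    intro h hh
    simp only [Finset.mem_insert, Finset.mem_singleton] at hh
    rcases hh with rfl | rfl
    · simp [hA]
    · simpa [hA] using hns 1
  have hset : (Finset.univ.filter fun h : H ↦
      (h • x = x ∧ (h : SL(2, L)) ≠ 1 ∧ (h : SL(2, L)) ≠ -1)) = A \ {1, n} := by
    ext h
    have e1 : h = 1 ↔ (h : SL(2, L)) = 1 := Subtype.ext_iff
    have e2 : h = n ↔ (h : SL(2, L)) = -1 := Subtype.ext_iff
    simp only [hA, Finset.mem_filter, Finset.mem_univ, true_and, Finset.mem_sdiff,
      Finset.mem_insert, Finset.mem_singleton, not_or, e1, e2, ne_eq]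
  have hs : stabCard H x = A.card := by
    rw [stabCard, Nat.card_eq_fintype_card, Fintype.card_subtype]
    simp [hA, MulAction.mem_stabilizer_iff]
  have hu : unipCard H x = (A.filter fun h : H ↦ tr (h : SL(2, L)) = 2).card := by
    rw [unipCard, Nat.card_eq_fintype_card, Fintype.card_subtype, hA, Finset.filter_filter]
  have hu' : (A.filter fun h : H ↦ tr (h : SL(2, L)) = -2).card = unipCard H x := by
    rw [hu]
    refine Finset.card_bij' (fun h _ ↦ n * h) (fun h _ ↦ n * h) ?_ ?_ ?_ ?_
    · intro h hh
      simp only [hA, Finset.mem_filter, Finset.mem_univ, true_and, hns] at hh ⊢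
      exact ⟨hh.1, by simp [hn, tr_neg, hh.2]⟩
    · intro h hh
      simp only [hA, Finset.mem_filter, Finset.mem_univ, true_and, hns] at hh ⊢
      exact ⟨hh.1, by simp [hn, tr_neg, hh.2]⟩
    · intro h _; ext1; simp [hn]
    · intro h _; ext1; simp [hn]
  have hsum : A.sum (fun h : H ↦ (1 + if tr (h : SL(2, L)) ^ 2 = 4 then 1 else 0)) =
      A.card + 2 * unipCard H x := by
    rw [Finset.sum_add_distrib, Finset.sum_const, smul_eq_mul, mul_one, ← Finset.card_filter,
      two_mul]
    congr 1
    nth_rewrite 1 [hu]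
    rw [← hu', ← Finset.card_union_of_disjoint, ← Finset.filter_or]
    · congr 1
      refine Finset.filter_congr fun h _ ↦ ?_
      rw [show (4 : L) = 2 ^ 2 by norm_num, sq_eq_sq_iff_eq_or_eq_neg]
    · rw [Finset.disjoint_filter]
      intro h _ h₁ h₂
      exact h4 (h₁.symm.trans h₂)
  rw [← Finset.sum_sdiff h1A, Finset.sum_pair h1n] at hsum
  rw [excess, hset, hs, ← hsum]
  have e1 : tr ((1 : H) : SL(2, L)) ^ 2 = 4 := by rw [Subgroup.coe_one, tr_one]; norm_num
  have e2 : tr (n : SL(2, L)) ^ 2 = 4 := by rw [hn, tr_neg, tr_one]; norm_num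
  rw [if_pos e1, if_pos e2]

lemma card_orbit_mul_stabCard (x : OnePoint L) :
    Nat.card (MulAction.orbit H x) * stabCard H x = Nat.card H := by
  classical
  rw [stabCard, Nat.card_eq_fintype_card, Nat.card_eq_fintype_card, Nat.card_eq_fintype_card,
    MulAction.card_orbit_mul_card_stabilizer_eq_card_group]

lemma stabCard_eq_of_mem_orbit {x y : OnePoint L} (h : y ∈ MulAction.orbit H x) :
    stabCard H y = stabCard H x := by
  have h1 := card_orbit_mul_stabCard (H := H) x
  have h2 := card_orbit_mul_stabCard (H := H) y
  rw [MulAction.orbit_eq_iff.2 h, ← h1] at h2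
  have : Nat.card (MulAction.orbit H x) ≠ 0 := by
    intro h0
    rw [h0, zero_mul] at h1
    exact Nat.card_pos.ne h1
  exact Nat.eq_of_mul_eq_mul_left (Nat.pos_of_ne_zero this) h2

omit [Fintype L] in
lemma two_dvd_stabCard (h2 : (2 : L) ≠ 0) (hneg : -1 ∈ H) (x : OnePoint L) :
    2 ∣ stabCard H x := by
  have hmem : (⟨-1, hneg⟩ : H) ∈ MulAction.stabilizer H x := by
    rw [MulAction.mem_stabilizer_iff, Subgroup.smul_def]
    simpa using neg_smul 1 x
  have ho : orderOf (⟨⟨-1, hneg⟩, hmem⟩ : MulAction.stabilizer H x) = 2 := by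
    apply orderOf_eq_prime
    · ext1; ext1; simp
    · intro h
      exact one_ne_neg_one h2 (congr_arg (fun z : MulAction.stabilizer H x ↦ (z : H).1) h).symm
  exact ho ▸ orderOf_dvd_natCard _

omit [Fintype L] in
lemma unipCard_smul (g : H) (x : OnePoint L) : unipCard H (g • x) = unipCard H x := by
  refine Nat.card_congr ((MulAut.conj g⁻¹).toEquiv.subtypeEquiv fun h ↦ ?_)
  have ht : tr ((g⁻¹ * h * g⁻¹⁻¹ : H) : SL(2, L)) = tr (h : SL(2, L)) := tr_conj (g : SL(2, L))⁻¹ h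
  simp only [MulEquiv.toEquiv_eq_coe, EquivLike.coe_coe, MulAut.conj_apply, ht]
  simp only [mul_smul, inv_smul_eq_iff, inv_inv]

omit [Fintype L] in
lemma unipCard_eq_of_mem_orbit {x y : OnePoint L} (h : y ∈ MulAction.orbit H x) :
    unipCard H y = unipCard H x := by
  obtain ⟨g, rfl⟩ := h
  exact unipCard_smul g x

end Counting

section Unipotent

variable {L : Type*} [Field L]

lemma upper_injective : Function.Injective (upper : L → SL(2, L)) := fun x y h ↦ by
  simpa using congr_arg (fun g : SL(2, L) ↦ g 0 1) h

lemma tr_upper (x : L) : tr (upper x) = 2 := by simp [tr]; norm_num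

lemma tr_lower (x : L) : tr (lower x) = 2 := by simp [tr]; norm_num

lemma eq_upper {h : SL(2, L)} (h₁₀ : h 1 0 = 0) (h₀₀ : h 0 0 = 1) : h = upper (h 0 1) := by
  have hdet := det_eq h
  refine ext_fin_two ?_ ?_ ?_ ?_ <;> simp [h₁₀, h₀₀]
  simpa [h₁₀, h₀₀] using hdet

lemma pow_char_eq_one (p : ℕ) [hp : Fact p.Prime] [CharP L p] {h : SL(2, L)} (ht : tr h = 2) :
    h ^ p = 1 := by
  have hdet := det_eq h
  rw [tr] at ht
  have hsq : ((h : Matrix (Fin 2) (Fin 2) L) - 1) ^ 2 = 0 := by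
    rw [sq]
    ext i j
    fin_cases i <;> fin_cases j <;> simp [Matrix.mul_apply, Fin.sum_univ_two]
    · linear_combination h 0 0 * ht - hdet
    · linear_combination h 0 1 * ht
    · linear_combination h 1 0 * ht
    · linear_combination h 1 1 * ht - hdet
  have hp' : ((h : Matrix (Fin 2) (Fin 2) L) - 1) ^ p = 0 :=
    pow_eq_zero_of_le hp.out.two_le hsq
  rw [sub_pow_char_of_commute (p := p) (Commute.one_right _), one_pow, sub_eq_zero] at hp'
  exact Subtype.ext (by rwa [Matrix.SpecialLinearGroup.coe_pow, Matrix.SpecialLinearGroup.coe_one])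

variable [DecidableEq L] [Fintype L] {H : Subgroup SL(2, L)}

lemma exists_unique_fixed (h2 : (2 : L) ≠ 0) {h : SL(2, L)} (h1 : h ≠ 1) (ht : tr h = 2) :
    ∃! x : OnePoint L, h • x = x := by
  classical
  have hn1 : h ≠ -1 := by
    rintro rfl
    rw [tr_neg, tr_one] at ht
    exact h2 (mul_self_eq_zero.1 (by linear_combination -ht : (2 : L) * 2 = 0))
  have hc := card_fixed_mul h1 hn1 ⟨1, one_ne_zero, by rw [ht]; norm_num⟩
  rw [if_pos (by rw [ht]; norm_num)] at hc
  have hc' : (Finset.univ.filter fun x : OnePoint L ↦ h • x = x).card = 1 := by omega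
  obtain ⟨x, hx⟩ := Finset.card_eq_one.1 hc'
  refine ⟨x, ?_, fun y hy ↦ ?_⟩
  · simpa using (Finset.ext_iff.1 hx x).2 (by simp)
  · simpa using (Finset.ext_iff.1 hx y).1 (by simpa using hy)

open scoped Classical in
lemma card_orbit_modEq (p : ℕ) [hp : Fact p.Prime] [CharP L p] (h2 : (2 : L) ≠ 0) {h : SL(2, L)}
    (hH : h ∈ H) (h1 : h ≠ 1) (ht : tr h = 2) {x : OnePoint L} (hx : h • x = x)
    (y : OnePoint L) :
    Nat.card (MulAction.orbit H y) ≡ (if x ∈ MulAction.orbit H y then 1 else 0) [MOD p] := by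
  let f : Function.End (MulAction.orbit H y) := MulAction.toEndHom (⟨h, hH⟩ : H)
  have hf : f ^ p ^ 1 = 1 := by
    rw [pow_one, ← map_pow]
    have : (⟨h, hH⟩ : H) ^ p = 1 := Subtype.ext (pow_char_eq_one p ht)
    rw [this, map_one]
  have hmod := Equiv.Perm.card_fixedPoints_modEq hf
  rw [← Nat.card_eq_fintype_card, Fintype.card_eq_nat_card] at hmod
  have huniq := exists_unique_fixed h2 h1 ht
  have hfix (z : MulAction.orbit H y) : z ∈ Function.fixedPoints (f : _ → _) ↔
      (z : OnePoint L) = x := by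
    refine (Subtype.ext_iff (a1 := f z)).trans ?_
    change h • (z : OnePoint L) = z ↔ _
    exact ⟨fun hz ↦ huniq.unique hz hx, fun hz ↦ hz ▸ hx⟩
  convert hmod using 1
  split_ifs with hxy
  · refine (Nat.card_eq_one_iff_exists.2 ⟨⟨⟨x, hxy⟩, (hfix _).2 rfl⟩, fun z ↦ ?_⟩).symm
    exact Subtype.ext (Subtype.ext ((hfix z.1).1 z.2))
  · have : IsEmpty (Function.fixedPoints (f : _ → _)) := ⟨fun z ↦ hxy (by
      rw [← (hfix z.1).1 z.2]
      exact z.1.2)⟩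
    exact Nat.card_of_isEmpty.symm

/-- All nontrivial unipotent elements of `H` fix a point in the same orbit. -/
lemma mem_orbit_of_unipotent (p : ℕ) [hp : Fact p.Prime] [CharP L p] (h2 : (2 : L) ≠ 0)
    {g h : SL(2, L)} (hg : g ∈ H) (hg1 : g ≠ 1) (hgt : tr g = 2) (hh : h ∈ H) (hh1 : h ≠ 1)
    (hht : tr h = 2) {x y : OnePoint L} (hx : g • x = x) (hy : h • y = y) :
    x ∈ MulAction.orbit H y := by
  classical
  by_contra hxy
  have e1 := card_orbit_modEq p h2 hg hg1 hgt hx y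
  have e2 := card_orbit_modEq p h2 hh hh1 hht hy y
  rw [if_neg hxy] at e1
  rw [if_pos (MulAction.mem_orbit_self _)] at e2
  have := (e1.symm.trans e2)
  rw [Nat.ModEq, Nat.zero_mod, Nat.mod_eq_of_lt hp.out.one_lt] at this
  exact zero_ne_one this

end Unipotent

section Infinity

variable {L : Type*} [Field L] [DecidableEq L] [Fintype L] {H : Subgroup SL(2, L)}

omit [Fintype L] in
lemma unipCard_infty : unipCard H ∞ = Nat.card (upperGroup H) := by
  symm
  refine Nat.card_eq_of_bijective
    (fun v ↦ ⟨⟨upper v.1, v.2⟩, by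
      rw [Subgroup.smul_def, smul_infty_eq_self]; simp, tr_upper _⟩) ⟨?_, ?_⟩
  · intro v w h
    exact Subtype.ext (upper_injective (congr_arg (fun z ↦ (z.1 : SL(2, L))) h))
  · rintro ⟨⟨h, hH⟩, hfix, ht⟩
    rw [Subgroup.smul_def, smul_infty_eq_self] at hfix
    simp only at hfix ht
    have hdet := det_eq h
    rw [tr] at ht
    have : (h 0 0 - 1) ^ 2 = 0 := by
      linear_combination h 0 0 * ht - hdet - h 0 1 * hfix
    have h00 := sub_eq_zero.1 (pow_eq_zero_iff two_ne_zero |>.1 this)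
    have he := eq_upper hfix h00
    exact ⟨⟨h 0 1, by rw [mem_upperGroup, ← he]; exact hH⟩, by simp [← he]⟩

/-- The finite part of the orbit of `∞`. -/
def finOrbit (H : Subgroup SL(2, L)) : Set L := {x | (x : OnePoint L) ∈ MulAction.orbit H ∞}

lemma card_orbit_infty : Nat.card (MulAction.orbit H (∞ : OnePoint L)) =
    Nat.card (finOrbit H) + 1 := by
  have h : MulAction.orbit H (∞ : OnePoint L) = insert ∞ ((↑) '' finOrbit H) := by
    ext x
    cases x with
    | infty => simp
    | coe x => simp [finOrbit]
  rw [h, Nat.card_coe_set_eq, Set.ncard_insert_of_notMem (by simp) (Set.toFinite _),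
    Set.ncard_image_of_injective _ OnePoint.coe_injective, Nat.card_coe_set_eq]

omit [Fintype L] in
lemma add_mem_finOrbit {x v : L} (hx : x ∈ finOrbit H) (hv : v ∈ upperGroup H) :
    x + v ∈ finOrbit H := by
  have : ((x + v : L) : OnePoint L) = (⟨upper v, hv⟩ : H) • (x : OnePoint L) := by
    rw [Subgroup.smul_def, upper_smul_coe]
  change ((x + v : L) : OnePoint L) ∈ MulAction.orbit H ∞
  rw [this]
  exact MulAction.mem_orbit_of_mem_orbit _ hx

omit [Fintype L] in
lemma card_upperGroup_dvd : Nat.card (upperGroup H) ∣ Nat.card (finOrbit H) := by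
  have h : finOrbit H = QuotientAddGroup.mk ⁻¹'
      ((QuotientAddGroup.mk : L → L ⧸ upperGroup H) '' finOrbit H) := by
    refine Set.Subset.antisymm (Set.subset_preimage_image _ _) ?_
    rintro x ⟨y, hy, hxy⟩
    rw [QuotientAddGroup.eq] at hxy
    simpa using add_mem_finOrbit hy hxy
  rw [h, Nat.card_congr (QuotientAddGroup.preimageMkEquivAddSubgroupProdSet _ _), Nat.card_prod]
  exact dvd_mul_right _ _

/-- The upper left entry, as a character of the stabilizer of `∞`. -/
def infChar (H : Subgroup SL(2, L)) : MulAction.stabilizer H (∞ : OnePoint L) →* L where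
  toFun h := (h : H).1 0 0
  map_one' := by simp
  map_mul' g h := by
    have : (h : H).1 1 0 = 0 := (smul_infty_eq_self _).1 h.2
    simp [Matrix.mul_apply, Fin.sum_univ_two, this]

omit [Fintype L] in
lemma infChar_sq_mem (h1 : upper 1 ∈ H) (h : MulAction.stabilizer H (∞ : OnePoint L)) :
    infChar H h ^ 2 ∈ upperGroup H := by
  have h10 : (h : H).1 1 0 = 0 := (smul_infty_eq_self _).1 h.2
  have hmem : (h : H).1 * upper 1 * (h : H).1⁻¹ ∈ H :=
    mul_mem (mul_mem (h : H).2 h1) (inv_mem (h : H).2)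
  rw [mem_upperGroup]
  convert hmem using 1
  have hdet := det_eq (h : H).1
  rw [eq_mul_inv_iff_mul_eq]
  rw [h10] at hdet
  refine ext_fin_two ?_ ?_ ?_ ?_ <;>
    simp [Matrix.mul_apply, Fin.sum_univ_two, h10, infChar]
  linear_combination (h : H).1 0 0 * hdet

omit [Fintype L] in
lemma card_ker_infChar :
    Nat.card (infChar H).toHomUnits.ker = Nat.card (upperGroup H) := by
  have hker (h : MulAction.stabilizer H (∞ : OnePoint L)) :
      h ∈ (infChar H).toHomUnits.ker ↔ (h : H).1 0 0 = 1 := by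
    rw [MonoidHom.mem_ker, Units.ext_iff]; rfl
  symm
  refine Nat.card_eq_of_bijective (fun v ↦ ⟨⟨⟨upper v.1, v.2⟩, by
      rw [MulAction.mem_stabilizer_iff, Subgroup.smul_def, smul_infty_eq_self]; simp⟩, by
      rw [hker]; simp⟩) ⟨?_, ?_⟩
  · intro v w h
    exact Subtype.ext (upper_injective (congr_arg (fun z ↦ (z.1.1 : SL(2, L))) h))
  · rintro ⟨⟨⟨h, hH⟩, hfix⟩, hk⟩
    rw [hker] at hk
    rw [MulAction.mem_stabilizer_iff, Subgroup.smul_def, smul_infty_eq_self] at hfix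
    have he := eq_upper hfix hk
    exact ⟨⟨h 0 1, by rw [mem_upperGroup, ← he]; exact hH⟩, by simp [← he]⟩

lemma exists_stabCard_infty (h2 : (2 : L) ≠ 0) (hneg : -1 ∈ H) (h1 : upper 1 ∈ H) :
    ∃ d, 1 ≤ d ∧ d + 1 ≤ Nat.card (upperGroup H) ∧
      stabCard H ∞ = 2 * d * Nat.card (upperGroup H) := by
  classical
  set χ := (infChar H).toHomUnits with hχ
  have hcard : stabCard H ∞ = Nat.card χ.range * Nat.card (upperGroup H) := by
    rw [stabCard, ← Subgroup.card_mul_index χ.ker, Subgroup.index_ker, card_ker_infChar, mul_comm]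
  have hmem : (-1 : Lˣ) ∈ χ.range := by
    refine ⟨⟨⟨-1, hneg⟩, ?_⟩, ?_⟩
    · rw [MulAction.mem_stabilizer_iff, Subgroup.smul_def, smul_infty_eq_self]; simp
    · ext1; simp [hχ, infChar]
  have hdvd : 2 ∣ Nat.card χ.range := by
    have ho : orderOf (⟨-1, hmem⟩ : χ.range) = 2 := by
      apply orderOf_eq_prime
      · ext1; simp
      · intro h
        have h' : (-1 : L) = 1 := congr_arg (fun z : χ.range ↦ ((z : Lˣ) : L)) h
        exact h2 (by linear_combination -h')
    exact ho.symm.dvd.trans (orderOf_dvd_natCard _)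
  obtain ⟨d, hd⟩ := hdvd
  have hpos : 0 < Nat.card χ.range := Nat.card_pos
  have hle : Nat.card χ.range ≤ 2 * (Nat.card (upperGroup H) - 1) := by
    set s : Finset Lˣ := Finset.univ.filter (· ∈ χ.range)
    set V : Finset L := Finset.univ.filter (· ∈ upperGroup H)
    have hs : Nat.card χ.range = s.card := by
      rw [Nat.card_eq_fintype_card, Fintype.card_subtype]
    have hV : Nat.card (upperGroup H) = V.card := by
      rw [Nat.card_eq_fintype_card, Fintype.card_subtype]
    rw [hs, hV, ← Finset.card_erase_of_mem (a := 0) (by simp [V, zero_mem])]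
    refine Finset.card_le_mul_card_image_of_maps_to (f := fun a : Lˣ ↦ (a : L) ^ 2) ?_ 2 ?_
    · rintro a ha
      obtain ⟨h, rfl⟩ := (Finset.mem_filter.1 ha).2
      simp only [Finset.mem_erase, V, Finset.mem_filter, Finset.mem_univ, true_and]
      exact ⟨pow_ne_zero _ (Units.ne_zero _), infChar_sq_mem h1 h⟩
    · intro b _
      by_cases hb : ∃ a : Lˣ, (a : L) ^ 2 = b
      · obtain ⟨a, rfl⟩ := hb
        refine (Finset.card_le_card (t := {a, -a}) ?_).trans Finset.card_le_two
        intro c hc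
        have := (Finset.mem_filter.1 hc).2
        rcases sq_eq_sq_iff_eq_or_eq_neg.1 this with h | h
        · simp [Units.ext h]
        · have : c = -a := Units.ext (by simpa using h)
          simp [this]
      · push Not at hb
        rw [Finset.filter_false_of_mem fun a _ ↦ hb a]
        simp
  refine ⟨d, by omega, by omega, ?_⟩
  rw [hcard, hd]

end Infinity

section Dichotomy

lemma eq_one_or_of_mul_eq {Q k d d' : ℕ} (hQ : 3 ≤ Q) (hodd : Odd Q) (hk : 1 ≤ k) (hd : 1 ≤ d)
    (hdQ : d + 1 ≤ Q) (h : (2 + (1 + k * Q) * (Q - 2)) * d' = Q * d * (1 + k * Q)) :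
    k = 1 ∨ Q = 3 ∧ d = 2 ∧ d' = 5 := by
  obtain ⟨r, rfl⟩ : ∃ r, Q = r + 2 := ⟨Q - 2, by omega⟩
  rw [Nat.add_sub_cancel] at h
  have h' : (1 + k * r) * d' = (1 + k * r) * d + 2 * d * k := by
    refine Nat.eq_of_mul_eq_mul_left (by omega : 0 < r + 2) ?_
    linear_combination h
  have hle : d ≤ d' := by
    by_contra! hlt
    have := Nat.mul_le_mul_left (1 + k * r) hlt.le
    have : 0 < 2 * d * k := by positivity
    omega
  obtain ⟨c, rfl⟩ := Nat.exists_eq_add_of_le hle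
  have hc : (1 + k * r) * c = 2 * d * k := by linear_combination h'
  have hcop : Nat.Coprime k (1 + k * r) := by simp
  obtain ⟨c', rfl⟩ : k ∣ c := hcop.dvd_of_dvd_mul_left ⟨2 * d, by linear_combination hc⟩
  have hc' : (1 + k * r) * c' = 2 * d := by
    refine Nat.eq_of_mul_eq_mul_left (by omega : 0 < k) ?_
    linear_combination hc
  have hc0 : 1 ≤ c' := by
    rcases Nat.eq_zero_or_pos c' with rfl | h0
    · omega
    · exact h0
  have hm : 1 + k * r ≤ 2 * d := hc' ▸ Nat.le_mul_of_pos_right _ hc0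
  by_cases hk1 : k = 1
  · exact .inl hk1
  right
  by_cases hk2 : k = 2
  · exfalso
    subst hk2
    have : (1 + 2 * r) ∣ d := by
      refine Nat.Coprime.dvd_of_dvd_mul_left (m := 2) ?_ ⟨c', hc'.symm⟩
      exact Nat.coprime_two_right.2 ⟨r, by ring⟩
    have := Nat.le_of_dvd (by omega) this
    omega
  have h3 : 3 * r ≤ k * r := Nat.mul_le_mul_right _ (by omega)
  obtain rfl : r = 1 := by omega
  obtain rfl : k = 3 := by omega
  omega

variable {L : Type*} [Field L] [DecidableEq L] [Fintype L] {H : Subgroup SL(2, L)}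

omit [DecidableEq L] in
lemma odd_card_upperGroup (h2 : (2 : L) ≠ 0) : Odd (Nat.card (upperGroup H)) := by
  rw [← Nat.not_even_iff_odd, even_iff_two_dvd]
  intro h
  obtain ⟨x, hx⟩ := exists_prime_addOrderOf_dvd_card' 2 h
  have hx2 := addOrderOf_nsmul_eq_zero x
  rw [hx] at hx2
  have hx0 : (2 : L) * x = 0 := by
    simpa using congr_arg (fun z : upperGroup H ↦ (z : L)) hx2
  have : x = 0 := Subtype.ext ((mul_eq_zero.1 hx0).resolve_left h2)
  rw [this, addOrderOf_zero] at hx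
  exact absurd hx (by norm_num)

omit [DecidableEq L] in
lemma three_le_card_upperGroup (h2 : (2 : L) ≠ 0) (h1 : upper 1 ∈ H) :
    3 ≤ Nat.card (upperGroup H) := by
  have : Nontrivial (upperGroup H) := ⟨⟨⟨1, h1⟩, 0, fun h ↦ one_ne_zero (Subtype.ext_iff.1 h)⟩⟩
  have := Finite.one_lt_card (α := upperGroup H)
  obtain ⟨r, hr⟩ := odd_card_upperGroup (H := H) h2
  omega

open scoped Classical in
lemma sum_excess_orbit (h2 : (2 : L) ≠ 0) (hneg : -1 ∈ H) (y : OnePoint L) :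
    ∑ x ∈ Finset.univ.filter (· ∈ MulAction.orbit H y), excess H x =
      Nat.card (MulAction.orbit H y) * excess H y := by
  rw [Finset.sum_const_nat (m := excess H y), Nat.card_eq_fintype_card, Fintype.card_subtype]
  intro x hx
  have hx' := (Finset.mem_filter.1 hx).2
  have e1 := excess_add_four h2 hneg x
  have e2 := excess_add_four h2 hneg y
  rw [stabCard_eq_of_mem_orbit hx', unipCard_eq_of_mem_orbit hx'] at e1
  omega

lemma unipCard_eq_one (p : ℕ) [Fact p.Prime] [CharP L p] (h2 : (2 : L) ≠ 0)
    (h1 : upper 1 ∈ H) {x : OnePoint L} (hx : x ∉ MulAction.orbit H ∞) : unipCard H x = 1 := by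
  refine Nat.card_eq_one_iff_exists.2 ⟨⟨1, one_smul _ _, tr_one⟩, ?_⟩
  rintro ⟨⟨h, hH⟩, hfix, ht⟩
  by_contra hne
  refine hx (mem_orbit_of_unipotent p h2 hH (fun h' ↦ hne ?_) ht h1 ?_ (tr_upper 1) hfix ?_)
  · exact Subtype.ext (Subtype.ext h')
  · rw [← upper_zero]
    exact fun h ↦ one_ne_zero (upper_injective h)
  · rw [smul_infty_eq_self]; simp

lemma zero_mem_finOrbit (p : ℕ) [Fact p.Prime] [CharP L p] (h2 : (2 : L) ≠ 0)
    (h1 : upper 1 ∈ H) {l : L} (hl : lower l ∈ H) (hl0 : l ≠ 0) : (0 : L) ∈ finOrbit H := by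
  refine mem_orbit_of_unipotent p h2 hl (fun h ↦ hl0 ?_) (tr_lower l) h1 ?_ (tr_upper 1)
    (lower_smul_zero _) ?_
  · simpa using congr_arg (fun g : SL(2, L) ↦ g 1 0) h
  · rw [← upper_zero]
    exact fun h ↦ one_ne_zero (upper_injective h)
  · rw [smul_infty_eq_self]; simp

/-- Counting fixed points on the projective line: either the finite part of the orbit of `∞` is a
single translate of the group of upper unipotents, or the numerical data are those of `SL(2, 5)` in
characteristic three. -/
lemma card_finOrbit_eq_or (p : ℕ) [Fact p.Prime] [CharP L p] (h2 : (2 : L) ≠ 0)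
    (hneg : -1 ∈ H) (hsplit : ∀ h ∈ H, ∃ w : L, w ≠ 0 ∧ w + w⁻¹ = tr h)
    (h1 : upper 1 ∈ H) {l : L} (hl : lower l ∈ H) (hl0 : l ≠ 0) :
    Nat.card (finOrbit H) = Nat.card (upperGroup H) ∨
      Nat.card (upperGroup H) = 3 ∧ stabCard H ∞ = 12 ∧
        ∀ x ∉ MulAction.orbit H (∞ : OnePoint L), excess H x ≠ 0 → stabCard H x = 10 := by
  classical
  obtain ⟨d, hd, hdQ, hstab⟩ := exists_stabCard_infty h2 hneg h1
  have hQ := three_le_card_upperGroup h2 h1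
  have hodd := odd_card_upperGroup (H := H) h2
  obtain ⟨k, hk⟩ := card_upperGroup_dvd (H := H)
  have hfin : 0 < Nat.card (finOrbit H) :=
    Nat.card_pos_iff.2 ⟨⟨0, zero_mem_finOrbit p h2 h1 hl hl0⟩, inferInstance⟩
  have hω := card_orbit_infty (H := H)
  have hN := card_orbit_mul_stabCard (H := H) ∞
  have hE := excess_add_four h2 hneg (∞ : OnePoint L) (H := H)
  have hsum := sum_excess h2 hneg hsplit
  have hO := sum_excess_orbit h2 hneg (∞ : OnePoint L) (H := H)
  rw [unipCard_infty] at hE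
  set Q := Nat.card (upperGroup H)
  set N := Nat.card H
  set ω := Nat.card (MulAction.orbit H (∞ : OnePoint L))
  rw [hstab] at hE hN
  have hk1 : 1 ≤ k := by
    rcases Nat.eq_zero_or_pos k with rfl | h
    · omega
    · exact h
  have hω' : ω = 1 + k * Q := by rw [hω, hk]; ring
  have hω4 : 4 ≤ ω := by nlinarith
  have hEval : excess H ∞ = 2 * d * Q + 2 * (Q - 2) := by omega
  have hOval : ω * excess H ∞ = N + 2 * (ω * (Q - 2)) := by rw [hEval, ← hN]; ring
  have hωQ : ω ≤ ω * (Q - 2) := Nat.le_mul_of_pos_right _ (by omega)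
  have hout {y : OnePoint L} (hy : y ∉ MulAction.orbit H ∞) : excess H y + 2 = stabCard H y := by
    have := excess_add_four h2 hneg y
    rw [unipCard_eq_one p h2 h1 hy] at this
    omega
  have hfour {y : OnePoint L} (hy : y ∉ MulAction.orbit H ∞) (hy0 : excess H y ≠ 0) :
      4 ≤ stabCard H y := by
    have := hout hy
    have := two_dvd_stabCard h2 hneg y
    omega
  have hhalf {y : OnePoint L} (hy : y ∉ MulAction.orbit H ∞) (hy0 : excess H y ≠ 0) :
      N ≤ 2 * (Nat.card (MulAction.orbit H y) * excess H y) := by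
    have hNy : _ = N := card_orbit_mul_stabCard y
    rw [← hNy]
    have h1 := hout hy
    have h2 := hfour hy hy0
    rw [← mul_assoc, mul_comm 2, mul_assoc]
    exact Nat.mul_le_mul_left _ (by omega)
  have hdisj {y z : OnePoint L} (hyz : y ∉ MulAction.orbit H z) :
      Disjoint (Finset.univ.filter (· ∈ MulAction.orbit H z))
        (Finset.univ.filter (· ∈ MulAction.orbit H y)) := by
    rw [Finset.disjoint_filter]
    intro x _ hxz hxy
    apply hyz
    rw [← MulAction.orbit_eq_iff] at hxz hxy ⊢
    rw [← hxz, ← hxy]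
  obtain ⟨y, hy, hy0⟩ : ∃ y ∉ MulAction.orbit H (∞ : OnePoint L), excess H y ≠ 0 := by
    by_contra! hall
    have : ∑ x, excess H x = ω * excess H ∞ := by
      rw [← hO]
      refine (Finset.sum_subset (Finset.subset_univ _) fun x _ hx ↦ hall x ?_).symm
      simpa using hx
    have h3 : ω * Q ≤ ω * (Q * d) := Nat.mul_le_mul_left _ (Nat.le_mul_of_pos_right _ hd)
    have h4 : ω * (Q - 2) + ω * 2 = ω * Q := by rw [← mul_add, Nat.sub_add_cancel (by omega)]
    have h5 : N = 2 * (ω * (Q * d)) := by rw [← hN]; ring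
    omega
  have hYs := sum_excess_orbit h2 hneg y (H := H)
  have huniq (z : OnePoint L) (hz : z ∉ MulAction.orbit H ∞) (hz0 : excess H z ≠ 0) :
      z ∈ MulAction.orbit H y := by
    by_contra hzy
    have hZs := sum_excess_orbit h2 hneg z (H := H)
    have hle := Finset.sum_le_sum_of_subset (f := excess H) (Finset.subset_univ
      ((Finset.univ.filter (· ∈ MulAction.orbit H (∞ : OnePoint L)) ∪
        Finset.univ.filter (· ∈ MulAction.orbit H y)) ∪
          Finset.univ.filter (· ∈ MulAction.orbit H z)))
    rw [Finset.sum_union (Finset.disjoint_union_left.2 ⟨hdisj hz, hdisj hzy⟩),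
      Finset.sum_union (hdisj hy), hO, hYs, hZs] at hle
    have := hhalf hy hy0
    have := hhalf hz hz0
    omega
  have htot : ∑ x, excess H x =
      ω * excess H ∞ + Nat.card (MulAction.orbit H y) * excess H y := by
    rw [← hO, ← hYs, ← Finset.sum_union (hdisj hy)]
    refine (Finset.sum_subset (Finset.subset_univ _) fun x _ hx ↦ ?_).symm
    by_contra hx0
    simp only [Finset.mem_union, Finset.mem_filter, Finset.mem_univ, true_and, not_or] at hx
    exact hx.2 (huniq x hx.1 hx0)
  have hNy : _ = N := card_orbit_mul_stabCard y
  obtain ⟨d', hd'⟩ := two_dvd_stabCard h2 hneg y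
  have hsy := hout hy
  have h6 : Nat.card (MulAction.orbit H y) * excess H y +
      2 * Nat.card (MulAction.orbit H y) = N := by
    rw [← hNy, ← hsy]; ring
  have hoy : Nat.card (MulAction.orbit H y) = 2 + ω * (Q - 2) := by omega
  have key : (2 + (1 + k * Q) * (Q - 2)) * d' = Q * d * (1 + k * Q) := by
    rw [← hω', ← hoy]
    refine Nat.eq_of_mul_eq_mul_left two_pos ?_
    rw [hd', ← hN] at hNy
    linear_combination hNy
  rcases eq_one_or_of_mul_eq hQ hodd hk1 hd hdQ key with rfl | ⟨hQ3, rfl, rfl⟩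
  · left
    rw [hk, mul_one]
  · refine .inr ⟨hQ3, by rw [hstab, hQ3], fun z hz hz0 ↦ ?_⟩
    rw [stabCard_eq_of_mem_orbit (huniq z hz hz0), hd']

end Dichotomy

section Subfield

variable {L : Type*} [Field L] [DecidableEq L] [Fintype L] {H : Subgroup SL(2, L)}

/-- If the finite part of the orbit of `∞` is a single translate, inversion exchanges the groups of
upper and of lower unipotents. -/
lemma inv_mem_of_card_finOrbit (h0 : (0 : L) ∈ finOrbit H)
    (hcard : Nat.card (finOrbit H) = Nat.card (upperGroup H)) :
    (∀ x ∈ lowerGroup H, x⁻¹ ∈ upperGroup H) ∧ ∀ x ∈ upperGroup H, x⁻¹ ∈ lowerGroup H := by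
  have hsub : (upperGroup H : Set L) ⊆ finOrbit H := fun v hv ↦ by
    simpa using add_mem_finOrbit h0 hv
  have heq : (upperGroup H : Set L) = finOrbit H :=
    Set.eq_of_subset_of_ncard_le hsub hcard.le (Set.toFinite _)
  have hlow (x : L) (hx : x ∈ lowerGroup H) : x⁻¹ ∈ upperGroup H := by
    rcases eq_or_ne x 0 with rfl | hx0
    · simp
    · rw [← SetLike.mem_coe, heq]
      exact ⟨⟨lower x, hx⟩, lower_smul_infty hx0⟩
  refine ⟨hlow, fun x hx ↦ ?_⟩
  obtain ⟨⟨h, hH⟩, hh⟩ := h0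
  change h • ∞ = ((0 : L) : OnePoint L) at hh
  have h10 : h 1 0 ≠ 0 := by
    intro h10
    rw [(smul_infty_eq_self _).2 h10] at hh
    exact OnePoint.infty_ne_coe _ hh
  have h00 : h 0 0 = 0 := by
    rw [smul_infty_eq, if_neg h10, OnePoint.coe_eq_coe, div_eq_zero_iff] at hh
    exact hh.resolve_right h10
  have hconj (v : L) (hv : v ∈ upperGroup H) : -(h 1 0 ^ 2 * v) ∈ lowerGroup H := by
    have hmem : h * upper v * h⁻¹ ∈ H := mul_mem (mul_mem hH hv) (inv_mem hH)
    rw [mem_lowerGroup]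
    convert hmem using 1
    have hdet := det_eq h
    rw [eq_mul_inv_iff_mul_eq]
    rw [h00] at hdet
    refine ext_fin_two ?_ ?_ ?_ ?_ <;>
      simp [Matrix.mul_apply, Fin.sum_univ_two, h00]
    linear_combination h 1 0 * v * hdet
  let f : upperGroup H → upperGroup H := fun v ↦ ⟨(-(h 1 0 ^ 2 * v))⁻¹, hlow _ (hconj v v.2)⟩
  have hf : Function.Injective f := fun v w hvw ↦
    Subtype.ext (mul_left_cancel₀ (pow_ne_zero 2 h10)
      (neg_injective (inv_injective (Subtype.ext_iff.1 hvw))))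
  obtain ⟨v, hv⟩ := Finite.surjective_of_injective hf ⟨x, hx⟩
  have hx' : (-(h 1 0 ^ 2 * v))⁻¹ = x := Subtype.ext_iff.1 hv
  rw [← hx', inv_inv]
  exact hconj v v.2

omit [DecidableEq L] in
/-- An additive subgroup containing `1` whose inverses form an additive subgroup is a subfield. -/
lemma exists_subfield_coe_eq (h2 : (2 : L) ≠ 0) {V W : AddSubgroup L} (h1 : 1 ∈ V)
    (hVW : ∀ x ∈ V, x⁻¹ ∈ W) (hWV : ∀ x ∈ W, x⁻¹ ∈ V) :
    ∃ K : Subfield L, (∀ x, x ∈ K ↔ x ∈ V) ∧ ∀ x, x ∈ K ↔ x ∈ W := by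
  have hsq (a : L) (ha : a ∈ V) : a ^ 2 ∈ V := by
    rcases eq_or_ne a 0 with rfl | ha0
    · simp [zero_mem]
    rcases eq_or_ne (1 - a) 0 with ha1 | ha1
    · rw [← sub_eq_zero.1 ha1, one_pow]; exact h1
    have := sub_mem ha (hWV _ (add_mem (hVW a ha) (hVW _ (sub_mem h1 ha))))
    convert this using 1
    field_simp
    ring
  obtain ⟨p, hp⟩ := CharP.exists L
  have hpp : p.Prime := (CharP.char_is_prime_or_zero L p).resolve_right
    (CharP.char_ne_zero_of_finite L p)
  have hodd : Odd p := hpp.odd_of_ne_two fun h ↦ h2 (by exact_mod_cast h ▸ CharP.cast_eq_zero L p)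
  have hmul (a b : L) (ha : a ∈ V) (hb : b ∈ V) : a * b ∈ V := by
    obtain ⟨r, hr⟩ := hodd
    have hp0 : (2 * r + 1 : L) = 0 := by
      have := CharP.cast_eq_zero L p
      rw [hr] at this
      exact_mod_cast this
    have := nsmul_mem (sub_mem (sub_mem (hsq _ (add_mem ha hb)) (hsq a ha)) (hsq b hb)) (r + 1)
    convert this using 1
    rw [nsmul_eq_mul]
    push_cast
    linear_combination -(a * b) * hp0
  have hinv (a : L) (ha : a ∈ V) : a⁻¹ ∈ V := by
    rcases eq_or_ne a 0 with rfl | ha0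
    · simp [zero_mem]
    let f : V → V := fun v ↦ ⟨a * v, hmul a v ha v.2⟩
    have hf : Function.Injective f := fun v w hvw ↦
      Subtype.ext (mul_left_cancel₀ ha0 (Subtype.ext_iff.1 hvw))
    obtain ⟨v, hv⟩ := Finite.surjective_of_injective hf ⟨1, h1⟩
    rw [← eq_inv_of_mul_eq_one_right (Subtype.ext_iff.1 hv)]
    exact v.2
  let K : Subfield L :=
    { V with
      mul_mem' := fun ha hb ↦ hmul _ _ ha hb
      one_mem' := h1
      inv_mem' := hinv }
  refine ⟨K, fun x ↦ Iff.rfl, fun x ↦ ⟨fun hx ↦ ?_, fun hx ↦ ?_⟩⟩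
  · rw [← inv_inv x]; exact hVW _ (hinv x hx)
  · rw [← inv_inv x]; exact hinv _ (hWV x hx)

omit [DecidableEq L] [Fintype L] in
lemma pow_nine_eq_self [CharP L 3] {l w : L} (hw : w + w⁻¹ = 2 + l)
    (h : w ^ 12 = 1 ∨ w ^ 10 = 1) : l ^ 9 = l := by
  have : Fact (Nat.Prime 3) := ⟨Nat.prime_three⟩
  have hw9 : w ^ 9 = w ∨ w ^ 9 = w⁻¹ := by
    rcases h with h | h
    · have h3 : (w ^ 4 - 1) ^ 3 = 0 := by
        rw [sub_pow_char]
        linear_combination h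
      have h4 := pow_eq_zero_iff three_ne_zero |>.1 h3
      left
      linear_combination w * (w ^ 4 + 1) * h4
    · right
      exact eq_inv_of_mul_eq_one_left (by rw [← pow_succ, h])
  have hsum : (w + w⁻¹) ^ 9 = w + w⁻¹ := by
    have := add_pow_char_pow (p := 3) (n := 2) w w⁻¹
    norm_num at this
    rw [this]
    rcases hw9 with h | h <;> rw [h]
    rw [inv_inv, add_comm]
  have h3 : (3 : L) = 0 := by exact_mod_cast CharP.cast_eq_zero L 3
  have hl := add_pow_char_pow (p := 3) (n := 2) 2 l
  norm_num at hl
  rw [hw, hl] at hsum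
  linear_combination hsum - 170 * h3

/-- A subgroup of `SL(2, L)` generated by a pair of opposite unipotents contains the unipotents over
a subfield, apart from an exceptional possibility in characteristic three. -/
lemma exists_subfield_or (p : ℕ) [Fact p.Prime] [CharP L p] (h2 : (2 : L) ≠ 0)
    (hneg : -1 ∈ H) (hsplit : ∀ h ∈ H, ∃ w : L, w ≠ 0 ∧ w + w⁻¹ = tr h)
    (h1 : upper 1 ∈ H) {l : L} (hl : lower l ∈ H) (hl0 : l ≠ 0) :
    (∃ K : Subfield L, l ∈ K ∧ ∀ x ∈ K, upper x ∈ H ∧ lower x ∈ H) ∨ p = 3 ∧ l ^ 9 = l := by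
  rcases card_finOrbit_eq_or p h2 hneg hsplit h1 hl hl0 with hcard | ⟨hQ, h12, h10⟩
  · left
    obtain ⟨hWV, hVW⟩ := inv_mem_of_card_finOrbit (zero_mem_finOrbit p h2 h1 hl hl0) hcard
    obtain ⟨K, hV, hW⟩ := exists_subfield_coe_eq h2 (V := upperGroup H) h1 hVW hWV
    exact ⟨K, (hW l).2 hl, fun x hx ↦ ⟨(hV x).1 hx, (hW x).1 hx⟩⟩
  · right
    have h3 : (3 : L) = 0 := by
      have := card_nsmul_eq_zero' (x := (⟨1, h1⟩ : upperGroup H))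
      rw [hQ] at this
      simpa using congr_arg (fun z : upperGroup H ↦ (z : L)) this
    obtain rfl : p = 3 := by
      have := (CharP.cast_eq_zero_iff L p 3).1 (by exact_mod_cast h3)
      exact (Nat.prime_dvd_prime_iff_eq Fact.out Nat.prime_three).1 this
    refine ⟨rfl, ?_⟩
    set h : SL(2, L) := upper 1 * lower l with hh
    have hH : h ∈ H := mul_mem h1 hl
    have h01 : h 0 1 = 1 := by simp [hh, Matrix.mul_apply, Fin.sum_univ_two]
    have hne1 : h ≠ 1 := fun h' ↦ by simp [h'] at h01
    have hne2 : h ≠ -1 := fun h' ↦ by simp [h'] at h01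
    obtain ⟨w, hw0, hw⟩ := hsplit h hH
    classical
    have hc := card_fixed_mul hne1 hne2 ⟨w, hw0, hw⟩
    obtain ⟨x, hx⟩ : ∃ x : OnePoint L, h • x = x := by
      by_contra! hall
      rw [Finset.filter_false_of_mem fun x _ ↦ hall x] at hc
      simp at hc
    have hpow : h ^ stabCard H x = 1 := by
      have := pow_card_eq_one' (x := (⟨⟨h, hH⟩, hx⟩ : MulAction.stabilizer H x))
      exact congr_arg (fun z : MulAction.stabilizer H x ↦ ((z : H) : SL(2, L))) this
    have hcases : stabCard H x = 12 ∨ stabCard H x = 10 := by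
      by_cases hxo : x ∈ MulAction.orbit H (∞ : OnePoint L)
      · exact .inl (by rw [stabCard_eq_of_mem_orbit hxo, h12])
      · refine .inr (h10 x hxo (Finset.sum_pos (fun _ _ ↦ by positivity) ⟨⟨h, hH⟩, ?_⟩).ne')
        simpa using ⟨hx, hne1, hne2⟩
    refine pow_nine_eq_self (by rw [hw, hh, tr_upper_mul_lower, one_mul]) ?_
    have hmain := eigenvalue_pow_eq_one hw0 hw (by rw [h01]; exact one_ne_zero) hpow
    rcases hcases with h | h <;> rw [h] at hmain
    · exact .inl hmain
    · exact .inr hmain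

end Subfield

section FiniteFields

lemma card_le_of_pow_eq_self {M : Type*} [Field M] {m : ℕ} (hm : 1 < m) {S : Finset M}
    (hS : ∀ x ∈ S, x ^ m = x) : S.card ≤ m := by
  rw [← FiniteField.X_pow_card_sub_X_natDegree_eq M hm]
  refine Polynomial.card_le_degree_of_subset_roots fun x hx ↦ ?_
  rw [Polynomial.mem_roots (FiniteField.X_pow_card_sub_X_ne_zero M hm)]
  simp [hS x (by simpa using hx)]

lemma mem_range_of_pow_card_eq_self {K M : Type*} [Field K] [Finite K] [Field M] (φ : K →+* M)
    {x : M} (hx : x ^ Nat.card K = x) : x ∈ Set.range φ := by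
  classical
  have := Fintype.ofFinite K
  rw [Nat.card_eq_fintype_card] at hx
  by_contra hmem
  have hle := card_le_of_pow_eq_self (Fintype.one_lt_card (α := K))
    (S := insert x (Finset.univ.image φ)) fun y hy ↦ by
      rcases Finset.mem_insert.1 hy with rfl | hy
      · exact hx
      · obtain ⟨z, -, rfl⟩ := Finset.mem_image.1 hy
        rw [← map_pow, FiniteField.pow_card]
  rw [Finset.card_insert_of_notMem (by simpa using hmem),
    Finset.card_image_of_injective _ φ.injective, Finset.card_univ] at hle
  omega

lemma add_inv_pow_eq_iff {M : Type*} [Field M] (p : ℕ) [Fact p.Prime] [CharP M p] {w : M}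
    (hw : w ≠ 0) (f : ℕ) :
    (w + w⁻¹) ^ p ^ f = w + w⁻¹ ↔ w ^ p ^ f = w ∨ w ^ p ^ f = w⁻¹ := by
  rw [add_pow_char_pow, inv_pow, add_inv_eq_add_inv_iff (pow_ne_zero _ hw) hw]

lemma exists_add_inv_eq {F L : Type*} [Field F] [Finite F] [Field L] [Finite L] (φ : F →+* L)
    (p e : ℕ) [Fact p.Prime] [CharP F p] (hF : Nat.card F = p ^ e)
    (hL : Nat.card L = p ^ (2 * e)) (τ : F) :
    ∃ w : L, w ≠ 0 ∧ w + w⁻¹ = φ τ ∧ (w ^ p ^ e = w ∨ w ^ p ^ e = w⁻¹) := by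
  have : CharP L p := (φ.charP_iff φ.injective p).1 inferInstance
  have : CharP (AlgebraicClosure L) p :=
    ((algebraMap L (AlgebraicClosure L)).charP_iff
      (algebraMap L (AlgebraicClosure L)).injective p).1 inferInstance
  let ψ := algebraMap L (AlgebraicClosure L)
  obtain ⟨w, hw⟩ := IsAlgClosed.exists_root
    (Polynomial.X ^ 2 - Polynomial.C (ψ (φ τ)) * Polynomial.X + 1 :
      Polynomial (AlgebraicClosure L)) (by
        refine ne_of_eq_of_ne (b := 2) ?_ two_ne_zero
        compute_degree!)
  have hw' : w ^ 2 - ψ (φ τ) * w + 1 = 0 := by simpa using hw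
  have hw0 : w ≠ 0 := by rintro rfl; simp at hw'
  have hsum : w + w⁻¹ = ψ (φ τ) := by
    field_simp
    linear_combination hw'
  have hτ : (w + w⁻¹) ^ p ^ e = w + w⁻¹ := by
    have := Fintype.ofFinite F
    rw [hsum, ← map_pow, ← map_pow, ← hF, Nat.card_eq_fintype_card, FiniteField.pow_card]
  have hcases := (add_inv_pow_eq_iff p hw0 e).1 hτ
  obtain ⟨v, rfl⟩ : w ∈ Set.range ψ := by
    refine mem_range_of_pow_card_eq_self ψ ?_
    rw [hL, two_mul, pow_add, pow_mul]
    rcases hcases with h | h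
    · rw [h, h]
    · rw [h, inv_pow, h, inv_inv]
  refine ⟨v, by simpa using hw0, ψ.injective (by simpa using hsum), ?_⟩
  rcases hcases with h | h
  · exact .inl (ψ.injective (by simpa using h))
  · exact .inr (ψ.injective (by simpa using h))

lemma gcd_two_mul_dvd_iff (t m : ℕ) : Nat.gcd 2 t * t ∣ 2 * m ↔ t ∣ m := by
  rcases Nat.even_or_odd t with h | h
  · rw [Nat.gcd_eq_left h.two_dvd, Nat.mul_dvd_mul_iff_left two_pos]
  · have hc : Nat.Coprime t 2 := Nat.coprime_two_right.2 h
    rw [hc.symm, one_mul, hc.dvd_mul_left]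

/-- The Frobenius condition on `w + w⁻¹` in terms of the order of `w ^ 2`. -/
lemma add_inv_pow_eq_iff_zmod {M : Type*} [Field M] (p : ℕ) [Fact p.Prime] [CharP M p]
    (hp : Odd p) {w : M} (hw : w ≠ 0) (f : ℕ) :
    (w + w⁻¹) ^ p ^ f = w + w⁻¹ ↔
      ((p : ZMod (Nat.gcd 2 (orderOf (w ^ 2)) * orderOf (w ^ 2))) ^ f = 1 ∨
        (p : ZMod (Nat.gcd 2 (orderOf (w ^ 2)) * orderOf (w ^ 2))) ^ f = -1) := by
  rw [add_inv_pow_eq_iff p hw]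
  obtain ⟨m, hm⟩ := hp.pow (n := f)
  set t := orderOf (w ^ 2) with ht
  have hcast : (p : ZMod (Nat.gcd 2 t * t)) ^ f = ((2 * m : ℕ) : ZMod (Nat.gcd 2 t * t)) + 1 := by
    rw [← Nat.cast_pow, hm, Nat.cast_add, Nat.cast_one]
  refine or_congr ?_ ?_
  · rw [hcast, add_eq_right, ZMod.natCast_eq_zero_iff, gcd_two_mul_dvd_iff, ht,
      orderOf_dvd_iff_pow_eq_one, ← pow_mul, hm, pow_succ]
    exact mul_eq_right₀ hw
  · rw [hcast, eq_neg_iff_add_eq_zero, add_assoc, one_add_one_eq_two,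
      show ((2 * m : ℕ) : ZMod (Nat.gcd 2 t * t)) + 2 = ((2 * (m + 1) : ℕ) : ZMod _) by
        push_cast; ring,
      ZMod.natCast_eq_zero_iff, gcd_two_mul_dvd_iff, ht,
      orderOf_dvd_iff_pow_eq_one, ← pow_mul, hm, ← mul_eq_one_iff_eq_inv₀ hw, ← pow_succ]
    rfl

lemma pow_char_pow_two_add {M : Type*} [Field M] (p : ℕ) [Fact p.Prime] [CharP M p] (f : ℕ)
    (l : M) : (2 + l) ^ p ^ f = 2 + l ↔ l ^ p ^ f = l := by
  rw [add_pow_char_pow, ← one_add_one_eq_two, add_pow_char_pow, one_pow, add_right_inj]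

/-- If `-c ^ 2` has a square of order `t`, then some `a` of order `2 * t` is such that `-a` is the
square of a power of `±c`. -/
lemma exists_orderOf_eq_two_mul {M : Type*} [Field M] (h2 : (2 : M) ≠ 0) {c : M} {n t : ℕ}
    (hn : Even n) (hc : c ^ n = 1) (hct : orderOf ((-c ^ 2) ^ 2) = t) :
    ∃ a c' : M, orderOf a = 2 * t ∧ -a = c' ^ 2 ∧ c' ^ n = 1 ∧ t ∣ n / 2 := by
  have hdvd {a c' : M} (ha : orderOf a = 2 * t) (hac : -a = c' ^ 2) (hc' : c' ^ n = 1) :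
      t ∣ n / 2 := by
    obtain ⟨m, rfl⟩ := hn.two_dvd
    rw [Nat.mul_div_cancel_left _ two_pos, ← Nat.mul_dvd_mul_iff_left two_pos, ← ha,
      orderOf_dvd_iff_pow_eq_one, ← hn.neg_pow, hac, ← pow_mul, mul_comm 2, pow_mul, hc', one_pow]
  have hord := orderOf_pow' (-c ^ 2) two_ne_zero
  rw [hct] at hord
  rcases Nat.even_or_odd (orderOf (-c ^ 2)) with h | h
  · rw [Nat.gcd_eq_right h.two_dvd] at hord
    have := Nat.div_mul_cancel h.two_dvd
    have ha : orderOf (-c ^ 2) = 2 * t := by omega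
    exact ⟨-c ^ 2, c, ha, neg_neg _, hc, hdvd ha (neg_neg _) hc⟩
  · rw [(Nat.coprime_two_right.2 h : Nat.gcd _ 2 = 1), Nat.div_one] at hord
    rw [← hord] at h
    obtain ⟨m, hm⟩ := h
    have hpow : (-c ^ 2) ^ t = 1 := by rw [hord, pow_orderOf_eq_one]
    have ha : orderOf (c ^ 2) = 2 * t := by
      have hneg : orderOf (-1 : M) = 2 := by
        refine orderOf_eq_prime (by norm_num) fun h ↦ h2 ?_
        linear_combination -h
      have hmul := (Commute.all (-1 : M) (-c ^ 2)).orderOf_mul_eq_mul_orderOf_of_coprime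
        (by rw [hneg, ← hord]; exact (Nat.coprime_two_left.2 ⟨m, hm⟩))
      rwa [hneg, ← hord, neg_one_mul, neg_neg] at hmul
    have hac : -c ^ 2 = ((-c ^ 2) ^ (m + 1)) ^ 2 := by
      rw [← pow_mul, show (m + 1) * 2 = t + 1 by omega, pow_succ (-c ^ 2), hpow,
        one_mul]
    have hc' : ((-c ^ 2) ^ (m + 1)) ^ n = 1 := by
      rw [pow_right_comm, hn.neg_pow, pow_right_comm c, hc, one_pow, one_pow]
    exact ⟨c ^ 2, _, ha, hac, hc', hdvd ha hac hc'⟩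

end FiniteFields

section Projective

variable {F : Type*} [Field F]

/-- The projection from `SL(2, F)` to `PSL₂(F)`. -/
abbrev proj (F : Type*) [Field F] : SL(2, F) →* PSL2 F := QuotientGroup.mk' _

lemma proj_surjective : Function.Surjective (proj F) := QuotientGroup.mk'_surjective _

lemma mem_center_iff_eq {g : SL(2, F)} : g ∈ Subgroup.center SL(2, F) ↔ g = 1 ∨ g = -1 := by
  rw [Matrix.SpecialLinearGroup.mem_center_iff]
  constructor
  · rintro ⟨r, hr, hg⟩
    rw [Fintype.card_fin] at hr
    have h (i j : Fin 2) : g i j = Matrix.diagonal (fun _ : Fin 2 ↦ r) i j := by rw [← hg]; rfl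
    rcases sq_eq_one_iff.1 hr with rfl | rfl
    · exact .inl (by apply ext_fin_two <;> simp [h])
    · exact .inr (by apply ext_fin_two <;> simp [h])
  · rintro (rfl | rfl)
    · exact ⟨1, by simp, by simp⟩
    · exact ⟨-1, by simp, by ext i j; fin_cases i <;> fin_cases j <;> simp⟩

lemma proj_eq_one_iff {g : SL(2, F)} : proj F g = 1 ↔ g = 1 ∨ g = -1 := by
  rw [← mem_center_iff_eq]
  exact QuotientGroup.eq_one_iff g

lemma proj_eq_proj_iff {g h : SL(2, F)} : proj F g = proj F h ↔ g = h ∨ g = -h := by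
  rw [← mul_inv_eq_one, ← map_inv, ← map_mul, proj_eq_one_iff, mul_inv_eq_one,
    mul_inv_eq_iff_eq_mul, neg_one_mul]

lemma eq_top_of_closure_proj {T : Subgroup SL(2, F)} (hneg : -1 ∈ T) {a b : SL(2, F)}
    (ha : a ∈ T) (hb : b ∈ T) (h : Subgroup.closure {proj F a, proj F b} = ⊤) : T = ⊤ := by
  have hle : Subgroup.closure {proj F a, proj F b} ≤ T.map (proj F) := by
    rw [Subgroup.closure_le]
    rintro x (rfl | rfl)
    · exact ⟨a, ha, rfl⟩
    · exact ⟨b, hb, rfl⟩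
  rw [eq_top_iff]
  intro g _
  obtain ⟨s, hs, hsg⟩ := hle (h ▸ Subgroup.mem_top (proj F g))
  rcases proj_eq_proj_iff.1 hsg.symm with rfl | rfl
  · exact hs
  · rw [← neg_one_mul]; exact mul_mem hneg hs

lemma pow_eq_one_or_neg_one_iff {g : SL(2, F)} {w : F} (hw : w ≠ 0) (hg : w + w⁻¹ = tr g)
    (h₀₁ : g 0 1 ≠ 0) (hw2 : w ^ 2 ≠ 1) (n : ℕ) :
    g ^ n = 1 ∨ g ^ n = -1 ↔ (w ^ 2) ^ n = 1 := by
  constructor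
  · intro h
    have h2 : g ^ (2 * n) = 1 := by
      rw [mul_comm, pow_mul]
      rcases h with h | h <;> rw [h] <;> simp
    rw [← pow_mul]
    exact eigenvalue_pow_eq_one hw hg h₀₁ h2
  · intro h
    have hdet := det_eq g
    have htr : g 0 0 + g 1 1 = w + w⁻¹ := hg.symm
    have hww : w * w⁻¹ = 1 := mul_inv_cancel₀ hw
    generalize w⁻¹ = v at htr hww
    have key (m : ℕ) :
        (w - v) * (g ^ m) 0 0 = (w ^ m - v ^ m) * g 0 0 - (w ^ m * v - v ^ m * w) ∧
        (w - v) * (g ^ m) 0 1 = (w ^ m - v ^ m) * g 0 1 ∧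
        (w - v) * (g ^ m) 1 0 = (w ^ m - v ^ m) * g 1 0 ∧
        (w - v) * (g ^ m) 1 1 = (w ^ m - v ^ m) * g 1 1 - (w ^ m * v - v ^ m * w) := by
      induction m with
      | zero => simp
      | succ m ih =>
        obtain ⟨h00, h01, h10, h11⟩ := ih
        simp only [pow_succ, Matrix.SpecialLinearGroup.coe_mul, Matrix.mul_apply,
          Fin.sum_univ_two]
        refine ⟨?_, ?_, ?_, ?_⟩
        · linear_combination g 0 0 * h00 + g 1 0 * h01 +
            (w ^ m - v ^ m) * (g 0 0 * htr - hdet + hww)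
        · linear_combination g 0 1 * h00 + g 1 1 * h01 + (w ^ m - v ^ m) * g 0 1 * htr
        · linear_combination g 0 0 * h10 + g 1 0 * h11 + (w ^ m - v ^ m) * g 1 0 * htr
        · linear_combination g 0 1 * h10 + g 1 1 * h11 +
            (w ^ m - v ^ m) * (g 1 1 * htr - hdet + hww)
    have hwv : w - v ≠ 0 := by
      intro h'
      exact hw2 (by linear_combination w * h' + hww)
    have hwn : w ^ n ≠ 0 := pow_ne_zero _ hw
    have hvn : v ^ n = w ^ n := by
      have : w ^ n * v ^ n = 1 := by rw [← mul_pow, hww, one_pow]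
      refine mul_left_cancel₀ hwn ?_
      rw [this, ← sq, ← pow_mul, mul_comm n, pow_mul, h]
    obtain ⟨h00, h01, h10, h11⟩ := key n
    rw [hvn] at h00 h01 h10 h11
    have e00 : (g ^ n) 0 0 = w ^ n := mul_left_cancel₀ hwv (by linear_combination h00)
    have e01 : (g ^ n) 0 1 = 0 := mul_left_cancel₀ hwv (by linear_combination h01)
    have e10 : (g ^ n) 1 0 = 0 := mul_left_cancel₀ hwv (by linear_combination h10)
    have e11 : (g ^ n) 1 1 = w ^ n := mul_left_cancel₀ hwv (by linear_combination h11)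
    have hsq : (w ^ n) ^ 2 = 1 := by rw [← pow_mul, mul_comm, pow_mul, h]
    rcases sq_eq_one_iff.1 hsq with h' | h'
    · exact .inl (by apply ext_fin_two <;> simp [e00, e01, e10, e11, h'])
    · exact .inr (by apply ext_fin_two <;> simp [e00, e01, e10, e11, h'])

section Map

variable {L : Type*} [Field L] (φ : F →+* L)

lemma map_injective : Function.Injective (Matrix.SpecialLinearGroup.map (n := Fin 2) φ) :=
  fun _ _ h ↦ Subtype.ext (Matrix.map_injective φ.injective (Subtype.ext_iff.1 h))

lemma map_neg_one : Matrix.SpecialLinearGroup.map (n := Fin 2) φ (-1) = -1 := by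
  apply ext_fin_two <;> simp

lemma map_upper (x : F) : Matrix.SpecialLinearGroup.map φ (upper x) = upper (φ x) := by
  apply ext_fin_two <;> simp

lemma map_lower (x : F) : Matrix.SpecialLinearGroup.map φ (lower x) = lower (φ x) := by
  apply ext_fin_two <;> simp

lemma tr_map (g : SL(2, F)) : tr (Matrix.SpecialLinearGroup.map φ g) = φ (tr g) := by
  simp [tr]

lemma orderOf_proj {g : SL(2, F)} {w : L} (hw : w ≠ 0) (hg : w + w⁻¹ = φ (tr g))
    (h₀₁ : g 0 1 ≠ 0) (hw2 : w ^ 2 ≠ 1) : orderOf (proj F g) = orderOf (w ^ 2) := by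
  rw [orderOf_eq_orderOf_iff]
  intro n
  rw [← pow_eq_one_or_neg_one_iff (g := Matrix.SpecialLinearGroup.map φ g) hw
    (by rw [hg, tr_map]) (by simpa using h₀₁) hw2, ← map_pow, ← map_pow, proj_eq_one_iff]
  refine or_congr ?_ ?_
  · rw [← (map_injective φ).eq_iff, map_one]
  · rw [← (map_injective φ).eq_iff, map_neg_one]

end Map

end Projective

section NormalForm

variable {F : Type*} [Field F]

lemma upper_pow_char (p : ℕ) [CharP F p] (x : F) : upper x ^ p = 1 := by
  rw [upper_pow, CharP.cast_eq_zero, zero_mul, upper_zero]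

lemma lower_pow_char (p : ℕ) [CharP F p] (x : F) : lower x ^ p = 1 := by
  rw [lower_pow, CharP.cast_eq_zero, zero_mul, lower_zero]

lemma orderOf_proj_upper (p : ℕ) [Fact p.Prime] [CharP F p] {x : F} (hx : x ≠ 0) :
    orderOf (proj F (upper x)) = p := by
  refine orderOf_eq_prime (by rw [← map_pow, upper_pow_char p, map_one]) fun h ↦ hx ?_
  rcases proj_eq_one_iff.1 h with h | h <;> simpa using congr_arg (fun g : SL(2, F) ↦ g 0 1) h

lemma orderOf_proj_lower (p : ℕ) [Fact p.Prime] [CharP F p] {x : F} (hx : x ≠ 0) :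
    orderOf (proj F (lower x)) = p := by
  refine orderOf_eq_prime (by rw [← map_pow, lower_pow_char p, map_one]) fun h ↦ hx ?_
  rcases proj_eq_one_iff.1 h with h | h <;> simpa using congr_arg (fun g : SL(2, F) ↦ g 1 0) h

lemma exists_proj_eq_of_pow_eq_one (p : ℕ) [Fact p.Prime] [CharP F p] (hp : Odd p) {A : PSL2 F}
    (hA : A ^ p = 1) : ∃ a, proj F a = A ∧ tr a = 2 := by
  obtain ⟨b, rfl⟩ := proj_surjective A
  obtain ⟨a, ha, hap⟩ : ∃ a, proj F a = proj F b ∧ a ^ p = 1 := by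
    rw [← map_pow, proj_eq_one_iff] at hA
    rcases hA with h | h
    · exact ⟨b, rfl, h⟩
    · exact ⟨-b, proj_eq_proj_iff.2 (.inr rfl), by rw [hp.neg_pow, h, neg_neg]⟩
  refine ⟨a, ha, ?_⟩
  have hnil : IsNilpotent ((a : Matrix (Fin 2) (Fin 2) F) - 1) := by
    refine ⟨p, ?_⟩
    rw [sub_pow_char_of_commute (p := p) (Commute.one_right _), one_pow, sub_eq_zero,
      ← Matrix.SpecialLinearGroup.coe_pow, hap, Matrix.SpecialLinearGroup.coe_one]
  have := (Matrix.isNilpotent_trace_of_isNilpotent hnil).eq_zero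
  rw [Matrix.trace_fin_two] at this
  simp only [Matrix.sub_apply, Matrix.one_apply_eq] at this
  rw [tr]
  linear_combination this

lemma exists_entries_eq {a b c d : F} (h : a * d - b * c = 1) :
    ∃ g : SL(2, F), g 0 0 = a ∧ g 0 1 = b ∧ g 1 0 = c ∧ g 1 1 = d :=
  ⟨⟨!![a, b; c, d], by rw [Matrix.det_fin_two_of, h]⟩, rfl, rfl, rfl, rfl⟩

lemma exists_conj_eq_upper {a : SL(2, F)} (ha : tr a = 2) :
    ∃ g u, g * a * g⁻¹ = upper u := by
  have hdet := det_eq a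
  rw [tr] at ha
  by_cases hc : a 1 0 = 0
  · have h00 : (a 0 0 - 1) ^ 2 = 0 := by
      linear_combination a 0 0 * ha - hdet - a 0 1 * hc
    exact ⟨1, a 0 1, by
      simpa using eq_upper hc (sub_eq_zero.1 (pow_eq_zero_iff two_ne_zero |>.1 h00))⟩
  · obtain ⟨k, k00, k01, k10, k11⟩ := exists_entries_eq
      (show (a 0 0 - 1) * 0 - -(a 1 0)⁻¹ * a 1 0 = 1 by field_simp; ring)
    refine ⟨k⁻¹, -(a 1 0)⁻¹, ?_⟩
    rw [inv_inv, mul_assoc, inv_mul_eq_iff_eq_mul]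
    apply ext_fin_two <;> simp [k00, k01, k10, k11, Matrix.mul_apply, Fin.sum_univ_two]
    · linear_combination a 0 0 * ha - hdet
    · field_simp; ring
    · linear_combination a 1 0 * ha

/-- Two non-commuting elements of order `p` are simultaneously conjugate to an upper and a lower
unipotent. -/
lemma exists_conj_upper_lower (p : ℕ) [Fact p.Prime] [CharP F p] (hp : Odd p) {A B : PSL2 F}
    (hA : A ^ p = 1) (hB : B ^ p = 1) (hAB : A * B ≠ B * A) :
    ∃ (g : PSL2 F) (u v : F), u ≠ 0 ∧ v ≠ 0 ∧ g * A * g⁻¹ = proj F (upper u) ∧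
      g * B * g⁻¹ = proj F (lower v) := by
  obtain ⟨a, rfl, ha⟩ := exists_proj_eq_of_pow_eq_one p hp hA
  obtain ⟨b, rfl, hb⟩ := exists_proj_eq_of_pow_eq_one p hp hB
  obtain ⟨g, u, hu⟩ := exists_conj_eq_upper ha
  set b' := g * b * g⁻¹ with hb'
  have htr : tr b' = 2 := by rw [hb', tr_conj, hb]
  have hcomm : upper u * b' ≠ b' * upper u := by
    intro h
    apply hAB
    rw [← map_mul, ← map_mul]
    congr 1
    have h' : g * (a * b) * g⁻¹ = g * (b * a) * g⁻¹ := by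
      rw [← hu, hb'] at h
      simpa [mul_assoc] using h
    simpa using h'
  have hdet := det_eq b'
  rw [tr] at htr
  have hz : b' 1 0 ≠ 0 := by
    intro hz
    have h00 : (b' 0 0 - 1) ^ 2 = 0 := by
      linear_combination b' 0 0 * htr - hdet - b' 0 1 * hz
    apply hcomm
    rw [eq_upper hz (sub_eq_zero.1 (pow_eq_zero_iff two_ne_zero |>.1 h00)), ← upper_add,
      ← upper_add, add_comm]
  have hu0 : u ≠ 0 := by
    rintro rfl
    exact hcomm (by rw [upper_zero, one_mul, mul_one])
  set s := (1 - b' 0 0) / b' 1 0 with hs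
  have hsz : s * b' 1 0 = 1 - b' 0 0 := by rw [hs, div_mul_cancel₀ _ hz]
  refine ⟨proj F (upper s * g), u, b' 1 0, hu0, hz, ?_, ?_⟩
  · rw [← map_inv, ← map_mul, ← map_mul, _root_.mul_inv_rev, ← upper_neg]
    congr 1
    calc upper s * g * a * (g⁻¹ * upper (-s)) = upper s * (g * a * g⁻¹) * upper (-s) := by group
      _ = upper u := by rw [hu, ← upper_add, ← upper_add]; congr 1; ring
  · rw [← map_inv, ← map_mul, ← map_mul, _root_.mul_inv_rev]
    congr 1
    calc upper s * g * b * (g⁻¹ * (upper s)⁻¹) = upper s * b' * (upper s)⁻¹ := by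
          rw [hb']; group
      _ = lower (b' 1 0) := by
        rw [mul_inv_eq_iff_eq_mul]
        apply ext_fin_two <;> simp [Matrix.mul_apply, Fin.sum_univ_two]
        · linear_combination hsz
        · refine mul_left_cancel₀ hz ?_
          linear_combination (b' 1 1 - 1) * hsz - hdet + htr
        · linear_combination htr - hsz

lemma isConj_upper_lower_iff (h2 : (2 : F) ≠ 0) {u v : F} (hu : u ≠ 0) (hv : v ≠ 0) :
    IsConj (proj F (upper u)) (proj F (lower v)) ↔ ∃ s, -(u * v) = s ^ 2 := by
  rw [isConj_iff]
  constructor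
  · rintro ⟨C, hC⟩
    obtain ⟨g, rfl⟩ := proj_surjective C
    rw [← map_inv, ← map_mul, ← map_mul, proj_eq_proj_iff] at hC
    rcases hC with hC | hC
    · rw [mul_inv_eq_iff_eq_mul] at hC
      have e00 := congr_arg (fun g : SL(2, F) ↦ g 0 1) hC
      have e11 := congr_arg (fun g : SL(2, F) ↦ g 1 1) hC
      simp [Matrix.mul_apply, Fin.sum_univ_two, hu] at e00 e11
      have hdet := det_eq g
      rw [e00] at hdet
      exact ⟨g 1 0 * u, by linear_combination u * v * hdet - u * g 1 0 * e11⟩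
    · exfalso
      have := congr_arg tr hC
      rw [tr_conj, tr_neg, tr_upper, tr_lower] at this
      exact h2 (mul_self_eq_zero.1 (by linear_combination this : (2 : F) * 2 = 0))
  · rintro ⟨s, hs⟩
    have hs0 : s ≠ 0 := by
      rintro rfl
      exact mul_ne_zero hu hv (by linear_combination -hs)
    obtain ⟨k, k00, k01, k10, k11⟩ := exists_entries_eq
      (show 0 * 0 - -u / s * (s / u) = 1 by field_simp; ring)
    refine ⟨proj F k, ?_⟩
    rw [← map_inv, ← map_mul, ← map_mul, proj_eq_proj_iff]
    left
    rw [mul_inv_eq_iff_eq_mul]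
    apply ext_fin_two <;> simp [Matrix.mul_apply, Fin.sum_univ_two, k00, k01, k10, k11, hu]
    field_simp
    linear_combination -hs

lemma tr_ne_neg_two_of_coprime (p : ℕ) [Fact p.Prime] [CharP F p] {g : SL(2, F)}
    (hg : 1 < orderOf (proj F g)) (hc : Nat.Coprime (orderOf (proj F g)) p) : tr g ≠ -2 := by
  intro h
  have hpow : proj F g ^ p = 1 := by
    rw [proj_eq_proj_iff.2 (.inr (neg_neg g).symm), ← map_pow,
      pow_char_eq_one p (by rw [tr_neg, h, neg_neg]), map_one]
  have := Nat.eq_one_of_dvd_coprimes hc dvd_rfl (orderOf_dvd_of_pow_eq_one hpow)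
  omega

/-- The elements of `SL(2, F)` which are conjugate by `diag(1, u)` to a matrix over a subfield. -/
def twistedSubgroup (K : Subfield F) (u : F) (hu : u ≠ 0) : Subgroup SL(2, F) where
  carrier := {g | g 0 0 ∈ K ∧ u⁻¹ * g 0 1 ∈ K ∧ u * g 1 0 ∈ K ∧ g 1 1 ∈ K}
  one_mem' := by simp [one_mem, zero_mem]
  mul_mem' := by
    rintro g h ⟨g00, g01, g10, g11⟩ ⟨h00, h01, h10, h11⟩
    simp only [Set.mem_ofPred_eq, Matrix.SpecialLinearGroup.coe_mul, Matrix.mul_apply,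
      Fin.sum_univ_two]
    refine ⟨?_, ?_, ?_, ?_⟩
    · convert add_mem (mul_mem g00 h00) (mul_mem g01 h10) using 1; field_simp
    · convert add_mem (mul_mem g00 h01) (mul_mem g01 h11) using 1; ring
    · convert add_mem (mul_mem g10 h00) (mul_mem g11 h10) using 1; ring
    · convert add_mem (mul_mem g10 h01) (mul_mem g11 h11) using 1; field_simp
  inv_mem' := by
    rintro g ⟨g00, g01, g10, g11⟩
    simp only [Set.mem_ofPred_eq, Matrix.SpecialLinearGroup.coe_inv, Matrix.adjugate_fin_two]
    simpa using ⟨g11, g01, g10, g00⟩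

/-- A pair of opposite unipotents generating `PSL₂(F)` is not defined over a proper subfield. -/
lemma eq_top_of_closure_upper_lower {u v : F} (hu : u ≠ 0)
    (h : Subgroup.closure {proj F (upper u), proj F (lower v)} = ⊤) (K : Subfield F)
    (huv : u * v ∈ K) (x : F) : x ∈ K := by
  have := eq_top_of_closure_proj (T := twistedSubgroup K u hu)
    (by simp [twistedSubgroup, one_mem, zero_mem])
    (by simp [twistedSubgroup, one_mem, zero_mem, hu])
    (by simp [twistedSubgroup, one_mem, zero_mem, huv]) h
  have hx : upper (u * x) ∈ twistedSubgroup K u hu := this ▸ Subgroup.mem_top _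
  simpa [hu] using hx.2.1

end NormalForm

section MainTheorem

variable {F L : Type*} [Field F] [Field L]

/-- The condition on `n` in `IsGoodGOrder`, for `F` of order `q` and `L` of order `q ^ 2`. -/
def HasGoodOrder (F L : Type*) [Field F] [Field L] (q n : ℕ) : Prop :=
  (n ∣ (q - 1) / 2 ∧ ∃ a : F, orderOf a = 2 * n ∧ ∃ c : F, -a = c ^ 2) ∨
    (n ∣ (q + 1) / 2 ∧ ∃ a : L, orderOf a = 2 * n ∧ ∃ c : L, -a = c ^ 2 ∧ c ^ (q + 1) = 1)

lemma exists_hasGoodOrder [Finite F] [Finite L] (φ : F →+* L) (p e : ℕ) [Fact p.Prime]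
    [CharP F p] (hp : Odd p) (h2 : (2 : F) ≠ 0) (hF : Nat.card F = p ^ e)
    (hL : Nat.card L = p ^ (2 * e)) (s : F) :
    ∃ w : L, w ≠ 0 ∧ w + w⁻¹ = φ (2 - s ^ 2) ∧ HasGoodOrder F L (p ^ e) (orderOf (w ^ 2)) := by
  obtain ⟨c, hc0, hc, hcases⟩ := exists_add_inv_eq φ p e hF hL s
  refine ⟨-c ^ 2, neg_ne_zero.2 (pow_ne_zero 2 hc0), ?_, ?_⟩
  · rw [map_sub, map_pow, ← hc, map_ofNat]
    field_simp
    ring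
  have hodd : Odd (p ^ e) := hp.pow
  rcases hcases with h | h
  · left
    obtain ⟨d, rfl⟩ := mem_range_of_pow_card_eq_self φ (by rw [hF, h])
    have hd0 : d ≠ 0 := by simpa using hc0
    have hd : d ^ (p ^ e - 1) = 1 := by
      refine mul_right_cancel₀ hd0 (φ.injective ?_)
      rw [← pow_succ, Nat.sub_add_cancel hodd.pos, map_pow, h, one_mul]
    have hord : orderOf ((-d ^ 2) ^ 2) = orderOf ((-φ d ^ 2) ^ 2) := by
      rw [← orderOf_injective (φ : F →* L) φ.injective]
      simp
    obtain ⟨a, c, ha, hac, -, hdvd⟩ :=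
      exists_orderOf_eq_two_mul h2 (Nat.Odd.sub_odd hodd odd_one) hd hord
    exact ⟨hdvd, a, ha, c, hac⟩
  · right
    have h2' : (2 : L) ≠ 0 := map_ofNat φ 2 ▸ (map_ne_zero φ).2 h2
    obtain ⟨a, c', ha, hac, hc', hdvd⟩ := exists_orderOf_eq_two_mul (n := p ^ e + 1) h2'
      hodd.add_one (by rw [pow_succ, h, inv_mul_cancel₀ hc0]) rfl
    exact ⟨hdvd, a, ha, c', hac, hc'⟩

lemma HasGoodOrder.exists_eq [Finite F] (φ : F →+* L) (p e : ℕ) [Fact p.Prime]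
    [CharP L p] (hF : Nat.card F = p ^ e) {t : ℕ} (ht : HasGoodOrder F L (p ^ e) t) (ht0 : t ≠ 0) :
    ∃ (s : F) (w : L), w ≠ 0 ∧ w + w⁻¹ = φ (2 - s ^ 2) ∧ orderOf (w ^ 2) = t := by
  obtain ⟨c, hct, s, hs⟩ : ∃ c : L, orderOf (-c ^ 2) = 2 * t ∧ ∃ s, φ s = c + c⁻¹ := by
    rcases ht with ⟨-, a, ha, c, hac⟩ | ⟨-, a, ha, c, hac, hc⟩
    · refine ⟨φ c, ?_, c + c⁻¹, by simp⟩
      rw [← map_pow, ← hac, map_neg, neg_neg]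
      exact (orderOf_injective (φ : F →* L) φ.injective a).trans ha
    · refine ⟨c, by rw [← hac, neg_neg, ha], ?_⟩
      have hc0 : c ≠ 0 := by
        rintro rfl
        simp at hc
      refine mem_range_of_pow_card_eq_self φ ?_
      rw [hF, add_inv_pow_eq_iff p hc0]
      exact .inr (eq_inv_of_mul_eq_one_left (by rwa [pow_succ] at hc))
  have hc0 : c ≠ 0 := by
    rintro rfl
    simp at hct
    omega
  refine ⟨s, -c ^ 2, neg_ne_zero.2 (pow_ne_zero 2 hc0), ?_, ?_⟩
  · rw [map_sub, map_pow, hs, map_ofNat]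
    field_simp
    ring
  · rw [orderOf_pow' _ two_ne_zero, hct, Nat.gcd_mul_right_left, Nat.mul_div_cancel_left _ two_pos]

lemma eq_muPSL_iff [Finite F] (φ : F →+* L) (p e : ℕ) [Fact p.Prime] [CharP F p] (hp : Odd p)
    (he : 0 < e) (hF : Nat.card F = p ^ e) {l : F} {w : L} (hw0 : w ≠ 0)
    (hw : w + w⁻¹ = φ (2 + l)) :
    e = muPSL p (orderOf (w ^ 2)) ↔ ∀ f, 0 < f → l ^ p ^ f = l → e ≤ f := by
  have : CharP L p := (φ.charP_iff φ.injective p).1 inferInstance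
  have key (f : ℕ) := add_inv_pow_eq_iff_zmod p hp hw0 f
  simp only [hw, ← map_pow, φ.injective.eq_iff, pow_char_pow_two_add] at key
  have hle : l ^ p ^ e = l := by
    have := Fintype.ofFinite F
    rw [← hF, Nat.card_eq_fintype_card, FiniteField.pow_card]
  simp only [muPSL, ← key]
  constructor
  · rintro h f hf hl
    exact h.trans_le (Nat.sInf_le ⟨hf, hl⟩)
  · intro h
    obtain ⟨hpos, hl⟩ := Nat.sInf_mem (s := {f | 0 < f ∧ l ^ p ^ f = l}) ⟨e, he, hle⟩
    exact (h _ hpos hl).antisymm (Nat.sInf_le ⟨he, hle⟩)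

lemma le_of_closure_eq_top [Finite F] (p e : ℕ) [Fact p.Prime] [CharP F p]
    (hF : Nat.card F = p ^ e) {u v : F} (hu : u ≠ 0)
    (h : Subgroup.closure {proj F (upper u), proj F (lower v)} = ⊤) {f : ℕ} (hf : 0 < f)
    (huv : (u * v) ^ p ^ f = u * v) : e ≤ f := by
  have := Fintype.ofFinite F
  have hp := (Fact.out : p.Prime).one_lt
  have hfix (x : F) : x ^ p ^ f = x :=
    eq_top_of_closure_upper_lower hu h ((iterateFrobenius F p f).eqLocusField (RingHom.id F)) huv x
  have hle := card_le_of_pow_eq_self (S := Finset.univ) (Nat.one_lt_pow hf.ne' hp)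
    fun x _ ↦ hfix x
  rw [Finset.card_univ, ← Nat.card_eq_fintype_card, hF] at hle
  exact (Nat.pow_le_pow_iff_right hp).1 hle

lemma closure_eq_top [Finite F] [Finite L] (φ : F →+* L) (p e : ℕ) [Fact p.Prime]
    [CharP F p] (h2 : (2 : F) ≠ 0) (hF : Nat.card F = p ^ e) (hL : Nat.card L = p ^ (2 * e))
    {l : F} (hl0 : l ≠ 0) (hmin : ∀ f, 0 < f → l ^ p ^ f = l → e ≤ f)
    (hexc : ¬(p = 3 ∧ l ^ 9 = l)) :
    Subgroup.closure {proj F (upper 1), proj F (lower l)} = ⊤ := by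
  classical
  have := Fintype.ofFinite L
  have : CharP L p := (φ.charP_iff φ.injective p).1 inferInstance
  set P := Subgroup.closure {proj F (upper 1), proj F (lower l)} with hP
  refine Subgroup.comap_injective proj_surjective ?_
  rw [Subgroup.comap_top]
  set H₀ := P.comap (proj F) with hH₀
  have hneg : -1 ∈ H₀ := by
    rw [hH₀, Subgroup.mem_comap, proj_eq_one_iff.2 (.inr rfl)]
    exact one_mem P
  have hu1 : upper 1 ∈ H₀ := Subgroup.subset_closure (.inl rfl)
  have hll : lower l ∈ H₀ := Subgroup.subset_closure (.inr rfl)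
  set H := H₀.map (Matrix.SpecialLinearGroup.map φ)
  rcases exists_subfield_or (H := H) (l := φ l) p
      (map_ofNat φ 2 ▸ (map_ne_zero φ).2 h2) ⟨-1, hneg, map_neg_one φ⟩
      (by
        rintro _ ⟨g, -, rfl⟩
        obtain ⟨w, hw0, hw, -⟩ := exists_add_inv_eq φ p e hF hL (tr g)
        exact ⟨w, hw0, by rw [hw, tr_map]⟩)
      ⟨_, hu1, by rw [map_upper, map_one]⟩ ⟨_, hll, map_lower φ l⟩ ((map_ne_zero φ).2 hl0)
    with ⟨K, hlK, hK⟩ | ⟨hp3, hl9⟩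
  · have hsub : (K : Set L) ⊆ Set.range φ := by
      intro x hx
      obtain ⟨g, -, hg⟩ := (hK x hx).1
      exact ⟨g 0 1, by simpa using congr_arg (fun g : SL(2, L) ↦ g 0 1) hg⟩
    have : CharP K p := (K.subtype.charP_iff K.subtype.injective p).2 inferInstance
    have := Fintype.ofFinite K
    obtain ⟨f, -, hf⟩ := FiniteField.card K p
    have hlf : l ^ p ^ (f : ℕ) = l := by
      refine φ.injective ?_
      rw [map_pow, ← hf]
      exact congr_arg K.subtype (FiniteField.pow_card (⟨φ l, hlK⟩ : K))
    have heq : (K : Set L) = Set.range φ := by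
      refine Set.eq_of_subset_of_ncard_le hsub ?_
      rw [← Set.image_univ, Set.ncard_image_of_injective _ φ.injective, Set.ncard_univ, hF,
        ← Nat.card_coe_set_eq]
      change p ^ e ≤ Nat.card K
      rw [Nat.card_eq_fintype_card, hf]
      exact Nat.pow_le_pow_right (Fact.out : p.Prime).pos (hmin f f.pos hlf)
    have hmem (x : F) : upper x ∈ H₀ ∧ lower x ∈ H₀ := by
      have hx : φ x ∈ K := heq.symm.subset ⟨x, rfl⟩
      rw [← Subgroup.mem_map_iff_mem (map_injective φ),
        ← Subgroup.mem_map_iff_mem (map_injective φ), map_upper, map_lower]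
      exact hK _ hx
    exact eq_top_of_upper_lower (fun x ↦ (hmem x).1) fun x ↦ (hmem x).2
  · exact absurd ⟨hp3, φ.injective (by rw [map_pow, hl9])⟩ hexc

lemma exists_pair_upper_lower (p : ℕ) [Fact p.Prime] [CharP F p] (hp : Odd p) {A B : PSL2 F}
    (hA : orderOf A = p) (hB : orderOf B = p) (ht : 1 < orderOf (A * B))
    (htp : Nat.Coprime (orderOf (A * B)) p) (hgen : Subgroup.closure {A, B} = ⊤)
    (hAB : IsConj A B) :
    ∃ u v : F, u ≠ 0 ∧ v ≠ 0 ∧ orderOf (proj F (upper u * lower v)) = orderOf (A * B) ∧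
      Subgroup.closure {proj F (upper u), proj F (lower v)} = ⊤ ∧
      IsConj (proj F (upper u)) (proj F (lower v)) := by
  have hA1 : A ^ p = 1 := orderOf_dvd_iff_pow_eq_one.1 hA.dvd
  have hB1 : B ^ p = 1 := orderOf_dvd_iff_pow_eq_one.1 hB.dvd
  obtain ⟨g, u, v, hu, hv, hgA, hgB⟩ := exists_conj_upper_lower p hp hA1 hB1 fun h ↦ by
    have hdvd : orderOf (A * B) ∣ p := orderOf_dvd_of_pow_eq_one (by
      rw [Commute.mul_pow h, hA1, hB1, one_mul])
    exact ht.ne' (Nat.eq_one_of_dvd_coprimes htp dvd_rfl hdvd)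
  refine ⟨u, v, hu, hv, ?_, ?_, ?_⟩
  · rw [map_mul, ← hgA, ← hgB, ← MulAut.conj_apply, ← MulAut.conj_apply, ← map_mul]
    exact MulEquiv.orderOf_eq _ _
  · rw [← hgA, ← hgB, ← MulAut.conj_apply, ← MulAut.conj_apply, ← Set.image_pair,
      ← MulEquiv.coe_toMonoidHom, ← MonoidHom.map_closure, hgen]
    exact Subgroup.map_top_of_surjective _ (MulAut.conj g).surjective
  · rw [← hgA, ← hgB]
    exact ((isConj_iff.2 ⟨g, rfl⟩ : IsConj A _).symm.trans hAB).trans (isConj_iff.2 ⟨g, rfl⟩)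

lemma eq_two_or_eq_neg_two (φ : F →+* L) {τ : F} {w : L} (hw : w + w⁻¹ = φ τ)
    (hw2 : w ^ 2 = 1) : τ = 2 ∨ τ = -2 := by
  rcases sq_eq_one_iff.1 hw2 with rfl | rfl
  · refine .inl (φ.injective ?_)
    rw [← hw, map_ofNat]
    norm_num
  · refine .inr (φ.injective ?_)
    rw [← hw, map_neg, map_ofNat]
    norm_num

theorem exists_triple_iff [Finite F] [Finite L] (φ : F →+* L) (p e : ℕ) [Fact p.Prime]
    [CharP F p] (hp : Odd p) (he : 0 < e) (h2 : (2 : F) ≠ 0) (hF : Nat.card F = p ^ e)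
    (hL : Nat.card L = p ^ (2 * e)) (hq : 5 ≤ p ^ e) (hq9 : p ^ e ≠ 9) {t : ℕ} (ht : 1 < t)
    (htp : Nat.Coprime t p) :
    (∃ A B C : PSL2 F, A * B * C = 1 ∧ orderOf A = p ∧ orderOf B = p ∧ orderOf C = t ∧
        Subgroup.closure {A, B} = ⊤ ∧ IsConj A B) ↔
      e = muPSL p t ∧ HasGoodOrder F L (p ^ e) t := by
  constructor
  · rintro ⟨A, B, C, hABC, hA, hB, hC, hgen, hAB⟩
    rw [← orderOf_inv, ← eq_inv_of_mul_eq_one_left hABC] at hC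
    rw [← hC] at ht htp
    obtain ⟨u, v, hu, hv, hord, hgen', hconj⟩ := exists_pair_upper_lower p hp hA hB ht htp hgen hAB
    obtain ⟨s, hs⟩ := (isConj_upper_lower_iff h2 hu hv).1 hconj
    obtain ⟨w, hw0, hw, hgood⟩ := exists_hasGoodOrder φ p e hp h2 hF hL s
    rw [show 2 - s ^ 2 = 2 + u * v by linear_combination hs] at hw
    have hw2 : w ^ 2 ≠ 1 := by
      intro hw2
      rcases eq_two_or_eq_neg_two φ hw hw2 with h | h
      · exact mul_ne_zero hu hv (by linear_combination h)
      · rw [← tr_upper_mul_lower] at h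
        exact tr_ne_neg_two_of_coprime p (hord ▸ ht) (hord ▸ htp) h
    have hwt : orderOf (w ^ 2) = t := by
      rw [← orderOf_proj φ hw0 (g := upper u * lower v) (by rw [hw, tr_upper_mul_lower])
        (by simpa [Matrix.mul_apply, Fin.sum_univ_two] using hu) hw2, hord, hC]
    rw [← hwt]
    exact ⟨(eq_muPSL_iff φ p e hp he hF hw0 hw).2 fun f hf h ↦
      le_of_closure_eq_top p e hF hu hgen' hf h, hgood⟩
  · rintro ⟨hmu, hgood⟩
    have : CharP L p := (φ.charP_iff φ.injective p).1 inferInstance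
    obtain ⟨s, w, hw0, hw, rfl⟩ := hgood.exists_eq φ p e hF (by omega)
    have hw2 : w ^ 2 ≠ 1 := fun h ↦ by simp [h] at ht
    rw [show 2 - s ^ 2 = 2 + -s ^ 2 by ring] at hw
    have hs0 : -s ^ 2 ≠ 0 := by
      intro h
      rw [h, add_zero, map_ofNat] at hw
      refine hw2 ?_
      field_simp at hw
      have : (w - 1) ^ 2 = 0 := by linear_combination hw
      rw [sub_eq_zero.1 (pow_eq_zero_iff two_ne_zero |>.1 this), one_pow]
    have hmin := (eq_muPSL_iff φ p e hp he hF hw0 hw).1 hmu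
    refine ⟨proj F (upper 1), proj F (lower (-s ^ 2)),
      (proj F (upper 1) * proj F (lower (-s ^ 2)))⁻¹,
      mul_inv_cancel _, orderOf_proj_upper p one_ne_zero, orderOf_proj_lower p hs0, ?_, ?_,
      (isConj_upper_lower_iff h2 one_ne_zero hs0).2 ⟨s, by ring⟩⟩
    · rw [orderOf_inv, ← map_mul]
      exact orderOf_proj φ hw0 (by rw [hw, tr_upper_mul_lower, one_mul])
        (by simp [Matrix.mul_apply, Fin.sum_univ_two]) hw2
    · refine closure_eq_top φ p e h2 hF hL hs0 hmin ?_
      rintro ⟨rfl, h9⟩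
      have : e ≤ 2 := hmin 2 two_pos h9
      interval_cases e <;> omega

end MainTheorem

end UnipotentPair

/-- Let `q = p ^ e` with `p` an odd prime, `5 ≤ q`, `q ≠ 9`, and let
`t > 1` be coprime to `p`.  There exists a triple `A, B, C ∈ PSL₂(q)` with `A * B * C = 1`,
`A, B` of order `p`, `C` of order `t`, `⟨A, B⟩ = PSL₂(q)` and `A` conjugate to `B`, iff
`e = μ_PSL(p, t)` and `t` is a good `G`-order with respect to `q`. -/
theorem exists_conj_unipotent_triple_iff (p e : ℕ) [hp : Fact p.Prime] (hodd : Odd p)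
    (he : 0 < e) (hq : 5 ≤ p ^ e) (hq9 : p ^ e ≠ 9)
    (t : ℕ) (ht : 1 < t) (htp : Nat.Coprime t p) :
    (∃ A B C : PSL2 (GaloisField p e), A * B * C = 1 ∧
        orderOf A = p ∧ orderOf B = p ∧ orderOf C = t ∧
        Subgroup.closure ({A, B} : Set (PSL2 (GaloisField p e))) = ⊤ ∧
        IsConj A B) ↔
      (e = muPSL p t ∧ IsGoodGOrder p e t) := by
  have h2 : (2 : GaloisField p e) ≠ 0 := by
    have := CharP.cast_eq_zero_iff (GaloisField p e) p 2
    intro h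
    rw [← Nat.cast_ofNat, this, Nat.prime_dvd_prime_iff_eq hp.out Nat.prime_two] at h
    exact absurd hodd (by rw [h]; decide)
  obtain ⟨φ⟩ : Nonempty (GaloisField p e →ₐ[ZMod p] GaloisField p (2 * e)) := by
    refine FiniteField.nonempty_algHom_of_finrank_dvd ?_
    rw [GaloisField.finrank p he.ne', GaloisField.finrank p (by omega)]
    exact dvd_mul_left _ _
  rw [UnipotentPair.exists_triple_iff (φ : GaloisField p e →+* GaloisField p (2 * e)) p e hodd he h2
    (GaloisField.card p e he.ne') (GaloisField.card p (2 * e) (by omega)) hq hq9 ht htp]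
  exact and_congr_right fun _ ↦ (and_iff_right ht).symm
end
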